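/- In the fast diffusion setting below, there exists a constant C > 0, depending only on n, Ω, T, p, b, c₀ and ∫_Ω ( |∇u(x,0)|² + u(x,0)² ) dx, such that ‖∂_t u‖_{L^∞(Ω × [T/2, T])} ≤ C and ∫_{T/2}^{T} ∫_Ω ( |∇ ∂_t u(x,t)|² + |∂_t² u(x,t)|² u(x,t)^{p−1} ) dx dt ≤ C. -/

import Mathlib

open MeasureTheory Real Set

noncomputable section

/-- Partial derivative in the `i`-th coordinate direction. -/
def pderiv' {n : ℕ} (i : Fin n) (f : EuclideanSpace ℝ (Fin n) → ℝ)
    (x : EuclideanSpace ℝ (Fin n)) : ℝ :=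
  fderiv ℝ f x (EuclideanSpace.single i 1)

/-- The Laplacian `Δf = ∑ᵢ ∂ᵢ∂ᵢ f`. -/
def lap {n : ℕ} (f : EuclideanSpace ℝ (Fin n) → ℝ) (x : EuclideanSpace ℝ (Fin n)) : ℝ :=
  ∑ i, pderiv' i (pderiv' i f) x

/-- Distance to the boundary of `Ω`. -/
def dB {n : ℕ} (Ω : Set (EuclideanSpace ℝ (Fin n))) (x : EuclideanSpace ℝ (Fin n)) : ℝ :=
  Metric.infDist x (frontier Ω)

/-- A smooth bounded domain: a nonempty bounded open set which is the sublevel set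
of a smooth defining function with nonvanishing gradient on the boundary. -/
def IsSmoothDomain {n : ℕ} (Ω : Set (EuclideanSpace ℝ (Fin n))) : Prop :=
  IsOpen Ω ∧ Bornology.IsBounded Ω ∧ Ω.Nonempty ∧
    ∃ Φ : EuclideanSpace ℝ (Fin n) → ℝ, ContDiff ℝ (⊤ : ℕ∞) Φ ∧
      Ω = {x | Φ x < 0} ∧ frontier Ω = {x | Φ x = 0} ∧
      ∀ x ∈ frontier Ω, gradient Φ x ≠ 0

/-- A function on `Ω × [0,T]` extends continuously to `closure Ω × [0,T]`. -/
def ExtendsCont {n : ℕ} (Ω : Set (EuclideanSpace ℝ (Fin n))) (T : ℝ)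
    (f : EuclideanSpace ℝ (Fin n) → ℝ → ℝ) : Prop :=
  ∃ g : EuclideanSpace ℝ (Fin n) → ℝ → ℝ,
    ContinuousOn (fun z : EuclideanSpace ℝ (Fin n) × ℝ => g z.1 z.2)
      (closure Ω ×ˢ Set.Icc 0 T) ∧
    ∀ x ∈ Ω, ∀ t ∈ Set.Icc 0 T, g x t = f x t

/-- Membership in `C^{3,2}(closure Ω × [0,T])`, with the first and second time
derivatives recorded as the functions `ut` and `utt`:  `u`, `D_x u`, `D_x² u`,
`D_x³ u`, `∂ₜ u`, `D_x ∂ₜ u`, `D_x² ∂ₜ u`, `∂ₜ² u` all extend continuously to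
`closure Ω × [0,T]`. -/
def C32 {n : ℕ} (Ω : Set (EuclideanSpace ℝ (Fin n))) (T : ℝ)
    (u ut utt : EuclideanSpace ℝ (Fin n) → ℝ → ℝ) : Prop :=
  (∀ t ∈ Set.Icc (0 : ℝ) T, ContDiffOn ℝ 3 (fun x => u x t) Ω) ∧
  (∀ t ∈ Set.Icc (0 : ℝ) T, ContDiffOn ℝ 2 (fun x => ut x t) Ω) ∧
  (∀ x ∈ Ω, ∀ t ∈ Set.Icc (0 : ℝ) T, HasDerivWithinAt (u x) (ut x t) (Set.Icc 0 T) t) ∧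
  (∀ x ∈ Ω, ∀ t ∈ Set.Icc (0 : ℝ) T, HasDerivWithinAt (ut x) (utt x t) (Set.Icc 0 T) t) ∧
  ContinuousOn (fun z : EuclideanSpace ℝ (Fin n) × ℝ => u z.1 z.2)
    (closure Ω ×ˢ Set.Icc 0 T) ∧
  ContinuousOn (fun z : EuclideanSpace ℝ (Fin n) × ℝ => ut z.1 z.2)
    (closure Ω ×ˢ Set.Icc 0 T) ∧
  ContinuousOn (fun z : EuclideanSpace ℝ (Fin n) × ℝ => utt z.1 z.2)
    (closure Ω ×ˢ Set.Icc 0 T) ∧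
  (∀ i : Fin n, ExtendsCont Ω T fun x t => pderiv' i (fun y => u y t) x) ∧
  (∀ i j : Fin n, ExtendsCont Ω T fun x t => pderiv' i (pderiv' j fun y => u y t) x) ∧
  (∀ i j k : Fin n,
    ExtendsCont Ω T fun x t => pderiv' i (pderiv' j (pderiv' k fun y => u y t)) x) ∧
  (∀ i : Fin n, ExtendsCont Ω T fun x t => pderiv' i (fun y => ut y t) x) ∧
  (∀ i j : Fin n, ExtendsCont Ω T fun x t => pderiv' i (pderiv' j fun y => ut y t) x)

/-- The fast diffusion setting of Section 4 of the paper: `u ∈ C^{3,2}(closure Ω × [0,T])`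
is positive in `Ω × [0,T]`, solves `∂ₜ(u^p) = Δu + bu + u^p` in `Ω × (0,T]`, vanishes
on `∂Ω × [0,T]`, and is comparable to the distance to the boundary. -/
def FDSetting {n : ℕ} (Ω : Set (EuclideanSpace ℝ (Fin n))) (p b T c₀ : ℝ)
    (u ut utt : EuclideanSpace ℝ (Fin n) → ℝ → ℝ) : Prop :=
  IsSmoothDomain Ω ∧ 1 < p ∧ (n ≤ 2 ∨ p ≤ ((n : ℝ) + 2) / ((n : ℝ) - 2)) ∧
  0 < T ∧ 1 ≤ c₀ ∧
  C32 Ω T u ut utt ∧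
  (∀ x ∈ Ω, ∀ t ∈ Set.Icc (0 : ℝ) T, 0 < u x t) ∧
  (∀ x ∈ Ω, ∀ t ∈ Set.Ioc (0 : ℝ) T,
      HasDerivWithinAt (fun s => u x s ^ p)
        (lap (fun y => u y t) x + b * u x t + u x t ^ p) (Set.Icc 0 T) t) ∧
  (∀ x ∈ frontier Ω, ∀ t ∈ Set.Icc (0 : ℝ) T, u x t = 0) ∧
  (∀ x ∈ Ω, ∀ t ∈ Set.Icc (0 : ℝ) T,
      c₀⁻¹ * dB Ω x ≤ u x t ∧ u x t ≤ c₀ * dB Ω x)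

open Filter Topology

section Calculus

variable {n : ℕ}

/-- Squared length of the gradient, computed in coordinates. -/
def gradSq (f : EuclideanSpace ℝ (Fin n) → ℝ) (x : EuclideanSpace ℝ (Fin n)) : ℝ :=
  ∑ i, pderiv' i f x ^ 2

lemma gradSq_nonneg (f : EuclideanSpace ℝ (Fin n) → ℝ) (x : EuclideanSpace ℝ (Fin n)) :
    0 ≤ gradSq f x := Finset.sum_nonneg fun _ _ => sq_nonneg _

lemma norm_gradient_sq (f : EuclideanSpace ℝ (Fin n) → ℝ) (x : EuclideanSpace ℝ (Fin n)) :
    ‖gradient f x‖ ^ 2 = gradSq f x := by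
  rw [EuclideanSpace.norm_sq_eq]
  refine Finset.sum_congr rfl fun i _ => ?_
  have : gradient f x i = pderiv' i f x := by
    have h := InnerProductSpace.toDual_symm_apply (𝕜 := ℝ) (x := EuclideanSpace.single i (1 : ℝ))
      (y := fderiv ℝ f x)
    rw [EuclideanSpace.inner_single_right] at h
    simpa [gradient, pderiv'] using h
  rw [this, Real.norm_eq_abs, sq_abs]

lemma norm_fderiv_sq (f : EuclideanSpace ℝ (Fin n) → ℝ) (x : EuclideanSpace ℝ (Fin n)) :
    ‖fderiv ℝ f x‖ ^ 2 = gradSq f x := by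
  rw [← norm_gradient_sq, gradient, LinearIsometryEquiv.norm_map]

lemma norm_fderiv_le_sum (f : EuclideanSpace ℝ (Fin n) → ℝ) (x : EuclideanSpace ℝ (Fin n)) :
    ‖fderiv ℝ f x‖ ≤ ∑ i, |pderiv' i f x| := by
  have h0 : 0 ≤ ∑ i, |pderiv' i f x| := Finset.sum_nonneg fun i _ => abs_nonneg _
  refine abs_le_of_sq_le_sq' ?_ h0 |>.2
  rw [norm_fderiv_sq, gradSq]
  calc ∑ i, pderiv' i f x ^ 2 = ∑ i, |pderiv' i f x| ^ 2 := by simp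
    _ ≤ _ := Finset.sum_sq_le_sq_sum_of_nonneg fun i _ => abs_nonneg _

variable {f g : EuclideanSpace ℝ (Fin n) → ℝ} {x : EuclideanSpace ℝ (Fin n)}

lemma pderiv'_mul (hf : DifferentiableAt ℝ f x) (hg : DifferentiableAt ℝ g x) (i : Fin n) :
    pderiv' i (fun y => f y * g y) x = f x * pderiv' i g x + pderiv' i f x * g x := by
  simp only [pderiv', fderiv_fun_mul hf hg]
  simp [mul_comm]

lemma pderiv'_add (hf : DifferentiableAt ℝ f x) (hg : DifferentiableAt ℝ g x) (i : Fin n) :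
    pderiv' i (fun y => f y + g y) x = pderiv' i f x + pderiv' i g x := by
  simp [pderiv', fderiv_fun_add hf hg]

lemma pderiv'_sub (hf : DifferentiableAt ℝ f x) (hg : DifferentiableAt ℝ g x) (i : Fin n) :
    pderiv' i (fun y => f y - g y) x = pderiv' i f x - pderiv' i g x := by
  simp [pderiv', fderiv_fun_sub hf hg]

lemma pderiv'_comp {ψ : ℝ → ℝ} {ψ' : ℝ} (hψ : HasDerivAt ψ ψ' (f x))
    (hf : DifferentiableAt ℝ f x) (i : Fin n) :
    pderiv' i (fun y => ψ (f y)) x = ψ' * pderiv' i f x := by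
  have := (hψ.hasFDerivAt.comp x hf.hasFDerivAt).fderiv
  simp only [pderiv']
  rw [show (fun y => ψ (f y)) = ψ ∘ f from rfl, this]
  simp [mul_comm]

lemma pderiv'_congr {s : Set (EuclideanSpace ℝ (Fin n))} (hs : IsOpen s) (h : EqOn f g s)
    (hx : x ∈ s) (i : Fin n) : pderiv' i f x = pderiv' i g x := by
  simp only [pderiv']
  rw [Filter.EventuallyEq.fderiv_eq (h.eventuallyEq_of_mem (hs.mem_nhds hx))]

lemma ContDiffOn.pderiv' {s : Set (EuclideanSpace ℝ (Fin n))} (hs : IsOpen s) {m k : ℕ}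
    (hf : ContDiffOn ℝ m f s) (hk : k + 1 ≤ m) (i : Fin n) : ContDiffOn ℝ k (pderiv' i f) s := by
  have := hf.fderiv_of_isOpen hs (m := k) (by exact_mod_cast hk)
  exact this.clm_apply contDiffOn_const

lemma ContDiffOn.differentiableAt_mem {s : Set (EuclideanSpace ℝ (Fin n))} (hs : IsOpen s) {m : ℕ}
    (hf : ContDiffOn ℝ m f s) (hm : 1 ≤ m) (hx : x ∈ s) : DifferentiableAt ℝ f x :=
  (hf.differentiableOn (by exact_mod_cast (by omega : m ≠ 0))).differentiableAt (hs.mem_nhds hx)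

end Calculus

section Cutoff

variable {n : ℕ} {Ω : Set (EuclideanSpace ℝ (Fin n))} {φ : EuclideanSpace ℝ (Fin n) → ℝ}

/-- A smooth function positive exactly on the bounded open set `Ω`. -/
structure DefiningFun (Ω : Set (EuclideanSpace ℝ (Fin n))) (φ : EuclideanSpace ℝ (Fin n) → ℝ) :
    Prop where
  isOpen : IsOpen Ω
  bdd : Bornology.IsBounded Ω
  smooth : ContDiff ℝ (⊤ : ℕ∞) φ
  mem_iff : ∀ x, x ∈ Ω ↔ 0 < φ x

lemma exists_bound_deriv_smoothTransition : ∃ K, 0 ≤ K ∧ ∀ s, |deriv smoothTransition s| ≤ K := by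
  have hc : Continuous (deriv smoothTransition) :=
    (Real.smoothTransition.contDiff (n := 1)).continuous_deriv le_rfl
  obtain ⟨K, hK⟩ := (isCompact_Icc (a := (-1 : ℝ)) (b := 2)).exists_bound_of_continuousOn
    hc.continuousOn
  refine ⟨max K 0, le_max_right _ _, fun s => ?_⟩
  by_cases hs : s ∈ Icc (-1 : ℝ) 2
  · exact (hK s hs).trans (le_max_left _ _)
  · have : deriv smoothTransition s = 0 := by
      rw [mem_Icc, not_and_or, not_le, not_le] at hs
      rcases hs with hs | hs
      · have : smoothTransition =ᶠ[𝓝 s] fun _ => 0 := by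
          filter_upwards [Iio_mem_nhds hs] with y hy
          exact smoothTransition.zero_of_nonpos (by simp at hy; linarith)
        rw [this.deriv_eq]; simp
      · have : smoothTransition =ᶠ[𝓝 s] fun _ => 1 := by
          filter_upwards [Ioi_mem_nhds hs] with y hy
          exact smoothTransition.one_of_one_le (by simp at hy; linarith)
        rw [this.deriv_eq]; simp
    simp [this]

lemma deriv_smoothTransition_of_gt {s : ℝ} (hs : 1 < s) : deriv smoothTransition s = 0 := by
  have : smoothTransition =ᶠ[𝓝 s] fun _ => 1 := by
    filter_upwards [Ioi_mem_nhds hs] with y hy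
    exact smoothTransition.one_of_one_le (by simp at hy; linarith)
  rw [this.deriv_eq]; simp

/-- The cutoff equal to one where `φ ≥ 2 / j` and vanishing where `φ ≤ 1 / j`. -/
def cutoff (φ : EuclideanSpace ℝ (Fin n) → ℝ) (j : ℕ) (x : EuclideanSpace ℝ (Fin n)) : ℝ :=
  smoothTransition ((j + 1 : ℝ) * φ x - 1)

namespace DefiningFun

lemma volume_lt_top (D : DefiningFun Ω φ) : volume Ω < ⊤ := D.bdd.measure_lt_top

lemma isCompact_closure (D : DefiningFun Ω φ) : IsCompact (closure Ω) :=
  D.bdd.isCompact_closure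

lemma bound_closure (D : DefiningFun Ω φ) {g : EuclideanSpace ℝ (Fin n) → ℝ}
    (hg : Continuous g) : ∃ K, 0 < K ∧ ∀ x ∈ closure Ω, |g x| ≤ K := by
  obtain ⟨K, hK⟩ := D.isCompact_closure.exists_bound_of_continuousOn hg.continuousOn
  exact ⟨max K 1, by positivity, fun x hx => (hK x hx).trans (le_max_left _ _)⟩

lemma continuous_pderiv' (D : DefiningFun Ω φ) (i : Fin n) : Continuous (pderiv' i φ) :=
  (D.smooth.continuous_fderiv (by simp)).clm_apply continuous_const

lemma differentiable (D : DefiningFun Ω φ) : Differentiable ℝ φ :=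
  D.smooth.differentiable (by simp)

lemma exists_bound_pderiv' (D : DefiningFun Ω φ) :
    ∃ K, 0 < K ∧ ∀ i, ∀ x ∈ closure Ω, |pderiv' i φ x| ≤ K := by
  choose K hK0 hK using fun i => D.bound_closure (D.continuous_pderiv' i)
  refine ⟨∑ i, K i + 1, by have := Finset.sum_nonneg fun i (_ : i ∈ Finset.univ) => (hK0 i).le
                           linarith, fun i x hx => (hK i x hx).trans ?_⟩
  have := Finset.single_le_sum (fun i _ => (hK0 i).le) (Finset.mem_univ i)
  linarith

lemma contDiff_cutoff (D : DefiningFun Ω φ) (j : ℕ) : ContDiff ℝ (⊤ : ℕ∞) (cutoff φ j) := by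
  unfold cutoff
  exact Real.smoothTransition.contDiff.comp ((contDiff_const.mul D.smooth).sub contDiff_const)

lemma tsupport_cutoff_subset (D : DefiningFun Ω φ) (j : ℕ) :
    tsupport (cutoff φ j) ⊆ {x | 1 / (j + 1 : ℝ) ≤ φ x} := by
  refine closure_minimal (fun x hx => ?_) (isClosed_le continuous_const D.smooth.continuous)
  by_contra h
  simp only [mem_ofPred_eq, not_le] at h
  refine hx (smoothTransition.zero_of_nonpos ?_)
  have : (0 : ℝ) < j + 1 := by positivity
  rw [lt_div_iff₀ this] at h
  linarith

lemma tsupport_cutoff_subset' (D : DefiningFun Ω φ) (j : ℕ) : tsupport (cutoff φ j) ⊆ Ω := by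
  intro x hx
  have := D.tsupport_cutoff_subset j hx
  exact (D.mem_iff x).2 (lt_of_lt_of_le (by positivity) this)

lemma hasCompactSupport_cutoff (D : DefiningFun Ω φ) (j : ℕ) :
    HasCompactSupport (cutoff φ j) :=
  D.isCompact_closure.of_isClosed_subset (isClosed_tsupport _)
    ((D.tsupport_cutoff_subset' j).trans subset_closure)

lemma tendsto_cutoff (D : DefiningFun Ω φ) {x : EuclideanSpace ℝ (Fin n)} (hx : x ∈ Ω) :
    ∀ᶠ j in atTop, cutoff φ j x = 1 := by
  have hpos := (D.mem_iff x).1 hx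
  filter_upwards [eventually_ge_atTop ⌈2 / φ x⌉₊] with j hj
  refine smoothTransition.one_of_one_le ?_
  have : 2 / φ x ≤ j := (Nat.le_ceil _).trans (by exact_mod_cast hj)
  rw [div_le_iff₀ hpos] at this
  linarith

lemma pderiv'_cutoff (D : DefiningFun Ω φ) (j : ℕ) (i : Fin n) (x : EuclideanSpace ℝ (Fin n)) :
    pderiv' i (cutoff φ j) x
      = deriv smoothTransition ((j + 1 : ℝ) * φ x - 1) * ((j + 1 : ℝ) * pderiv' i φ x) := by
  have h1 : HasDerivAt (fun s : ℝ => smoothTransition ((j + 1 : ℝ) * s - 1))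
      (deriv smoothTransition ((j + 1 : ℝ) * φ x - 1) * (j + 1)) (φ x) := by
    have h2 : HasDerivAt (fun s : ℝ => (j + 1 : ℝ) * s - 1) (j + 1 : ℝ) (φ x) := by
      simpa using ((hasDerivAt_id (φ x)).const_mul (j + 1 : ℝ)).sub_const 1
    have h3 := (Real.smoothTransition.contDiff (n := 1)).differentiable (by simp)
      ((j + 1 : ℝ) * φ x - 1) |>.hasDerivAt
    exact h3.comp (φ x) h2
  have := pderiv'_comp h1 (D.differentiable x) i
  rw [show cutoff φ j = fun y => smoothTransition ((j + 1 : ℝ) * φ y - 1) from rfl, this]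
  ring

lemma tendsto_pderiv'_cutoff (D : DefiningFun Ω φ) {x : EuclideanSpace ℝ (Fin n)} (hx : x ∈ Ω)
    (i : Fin n) : ∀ᶠ j in atTop, pderiv' i (cutoff φ j) x = 0 := by
  have hpos := (D.mem_iff x).1 hx
  filter_upwards [eventually_ge_atTop ⌈2 / φ x⌉₊] with j hj
  have : 2 / φ x ≤ j := (Nat.le_ceil _).trans (by exact_mod_cast hj)
  rw [div_le_iff₀ hpos] at this
  rw [D.pderiv'_cutoff, deriv_smoothTransition_of_gt (by linarith), zero_mul]

lemma exists_bound_pderiv'_cutoff (D : DefiningFun Ω φ) :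
    ∃ K, 0 < K ∧ ∀ j i, ∀ x ∈ Ω, φ x * |pderiv' i (cutoff φ j) x| ≤ K := by
  obtain ⟨K1, hK1, h1⟩ := exists_bound_deriv_smoothTransition
  obtain ⟨K2, hK2, h2⟩ := D.exists_bound_pderiv'
  refine ⟨2 * K1 * K2 + 1, by positivity, fun j i x hx => ?_⟩
  have hpos := (D.mem_iff x).1 hx
  have hj : (0 : ℝ) < j + 1 := by positivity
  rw [D.pderiv'_cutoff]
  by_cases hs : 1 < (j + 1 : ℝ) * φ x - 1
  · rw [deriv_smoothTransition_of_gt hs]; simp; positivity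
  · rw [abs_mul, abs_mul, abs_of_pos hj]
    have h3 := h2 i x (subset_closure hx)
    have h4 := h1 ((j + 1 : ℝ) * φ x - 1)
    calc φ x * (|deriv smoothTransition ((j + 1 : ℝ) * φ x - 1)| * ((j + 1) * |pderiv' i φ x|))
        = ((j + 1) * φ x) * (|deriv smoothTransition ((j + 1 : ℝ) * φ x - 1)| * |pderiv' i φ x|) := by
          ring
      _ ≤ 2 * (K1 * K2) := by
          gcongr
          linarith
      _ ≤ _ := by linarith

end DefiningFun

lemma pderiv'_eq_zero_of_notMem_tsupport {f : EuclideanSpace ℝ (Fin n) → ℝ}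
    {x : EuclideanSpace ℝ (Fin n)} (hx : x ∉ tsupport f) (i : Fin n) : pderiv' i f x = 0 := by
  have : fderiv ℝ f x = 0 := by
    by_contra h
    exact hx (support_fderiv_subset ℝ h)
  simp [pderiv', this]

lemma continuous_mul_of_tsupport_subset {Ω : Set (EuclideanSpace ℝ (Fin n))} (hΩ : IsOpen Ω)
    {η f : EuclideanSpace ℝ (Fin n) → ℝ} {K : Set (EuclideanSpace ℝ (Fin n))} (hK : IsClosed K)
    (hη : Continuous η) (hs : ∀ x ∉ K, η x = 0) (hs' : K ⊆ Ω)
    (hf : ContinuousOn f Ω) : Continuous (fun x => η x * f x) := by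
  rw [continuous_iff_continuousAt]
  intro x
  by_cases hx : x ∈ Ω
  · exact hη.continuousAt.mul (hf.continuousAt (hΩ.mem_nhds hx))
  · have : (fun y => η y * f y) =ᶠ[𝓝 x] fun _ => 0 := by
      filter_upwards [hK.isOpen_compl.mem_nhds (fun h => hx (hs' h))] with y hy
      simp [hs y hy]
    exact continuousAt_const.congr this.symm

/-- Divergence theorem for vector fields vanishing linearly at the boundary. -/
theorem DefiningFun.integral_div_eq_zero (D : DefiningFun Ω φ)
    {X : Fin n → EuclideanSpace ℝ (Fin n) → ℝ} {M : ℝ}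
    (hX : ∀ i, ContDiffOn ℝ 1 (X i) Ω) (hM : ∀ i, ∀ x ∈ Ω, |X i x| ≤ M * φ x)
    (hg : IntegrableOn (fun x => ∑ i, pderiv' i (X i) x) Ω) :
    ∫ x in Ω, ∑ i, pderiv' i (X i) x = 0 := by
  have hD : ∀ i, ∀ x ∈ Ω, DifferentiableAt ℝ (X i) x := fun i x hx =>
    (hX i).differentiableAt_mem (m := 1) D.isOpen le_rfl hx
  have hcont : ∀ i, ContinuousOn (pderiv' i (X i)) Ω := fun i =>
    ((hX i).pderiv' (m := 1) (k := 0) D.isOpen (by simp) i).continuousOn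
  have hXc : ∀ i, ContinuousOn (X i) Ω := fun i => (hX i).continuousOn
  have hηc : ∀ j, Continuous (cutoff φ j) := fun j => (D.contDiff_cutoff j).continuous
  have hηd : ∀ j i, Continuous (pderiv' i (cutoff φ j)) := fun j i =>
    ((D.contDiff_cutoff j).continuous_fderiv (by simp)).clm_apply continuous_const
  have c1 : ∀ j i, Continuous fun x => cutoff φ j x * pderiv' i (X i) x := fun j i =>
    continuous_mul_of_tsupport_subset D.isOpen (isClosed_tsupport (cutoff φ j)) (hηc j)
      (fun x hx => image_eq_zero_of_notMem_tsupport hx) (D.tsupport_cutoff_subset' j) (hcont i)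
  have c2 : ∀ j i, Continuous fun x => pderiv' i (cutoff φ j) x * X i x := fun j i =>
    continuous_mul_of_tsupport_subset D.isOpen (isClosed_tsupport (cutoff φ j)) (hηd j i)
      (fun x hx => pderiv'_eq_zero_of_notMem_tsupport hx i) (D.tsupport_cutoff_subset' j) (hXc i)
  have c3 : ∀ j i, Continuous fun x => cutoff φ j x * X i x := fun j i =>
    continuous_mul_of_tsupport_subset D.isOpen (isClosed_tsupport (cutoff φ j)) (hηc j)
      (fun x hx => image_eq_zero_of_notMem_tsupport hx) (D.tsupport_cutoff_subset' j) (hXc i)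
  have s1 : ∀ j, ∀ x ∉ tsupport (cutoff φ j), cutoff φ j x = 0 := fun j x hx =>
    image_eq_zero_of_notMem_tsupport hx
  have i1 : ∀ j i, Integrable fun x => cutoff φ j x * pderiv' i (X i) x := fun j i =>
    (c1 j i).integrable_of_hasCompactSupport
      (HasCompactSupport.intro (D.hasCompactSupport_cutoff j) fun x hx => by simp [s1 j x hx])
  have i2 : ∀ j i, Integrable fun x => pderiv' i (cutoff φ j) x * X i x := fun j i =>
    (c2 j i).integrable_of_hasCompactSupport
      (HasCompactSupport.intro (D.hasCompactSupport_cutoff j) fun x hx => by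
        simp [pderiv'_eq_zero_of_notMem_tsupport hx i])
  have i3 : ∀ j i, Integrable fun x => cutoff φ j x * X i x := fun j i =>
    (c3 j i).integrable_of_hasCompactSupport
      (HasCompactSupport.intro (D.hasCompactSupport_cutoff j) fun x hx => by simp [s1 j x hx])
  have parts : ∀ j i, ∫ x, cutoff φ j x * pderiv' i (X i) x
      = - ∫ x, pderiv' i (cutoff φ j) x * X i x := fun j i =>
    integral_mul_fderiv_eq_neg_fderiv_mul_of_integrable (i2 j i) (i1 j i) (i3 j i)
      (fun x _ => (D.contDiff_cutoff j).differentiable (by simp) x)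
      (fun x hx => hD i x (D.tsupport_cutoff_subset' j hx))
  have res : ∀ (F : EuclideanSpace ℝ (Fin n) → ℝ) (j : ℕ),
      (∀ x ∉ tsupport (cutoff φ j), F x = 0) → ∫ x, F x = ∫ x in Ω, F x := fun F j h =>
    (setIntegral_eq_integral_of_forall_compl_eq_zero
      fun x hx => h x fun h' => hx (D.tsupport_cutoff_subset' j h')).symm
  have key : ∀ j, ∫ x in Ω, cutoff φ j x * ∑ i, pderiv' i (X i) x
      = - ∫ x in Ω, ∑ i, pderiv' i (cutoff φ j) x * X i x := by
    intro j
    rw [← res _ j (fun x hx => by simp [s1 j x hx]),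
      ← res _ j (fun x hx => by simp [pderiv'_eq_zero_of_notMem_tsupport hx])]
    simp_rw [Finset.mul_sum]
    rw [integral_finsetSum _ (fun i _ => i1 j i), integral_finsetSum _ (fun i _ => i2 j i),
      ← Finset.sum_neg_distrib]
    exact Finset.sum_congr rfl fun i _ => parts j i
  obtain ⟨K, hK0, hK⟩ := D.exists_bound_pderiv'_cutoff
  have lim1 : Tendsto (fun j => ∫ x in Ω, cutoff φ j x * ∑ i, pderiv' i (X i) x) atTop
      (𝓝 (∫ x in Ω, ∑ i, pderiv' i (X i) x)) := by
    refine tendsto_integral_of_dominated_convergence (fun x => |∑ i, pderiv' i (X i) x|)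
      (fun j => (hηc j).aestronglyMeasurable.mul hg.aestronglyMeasurable) hg.abs
      (fun j => ae_of_all _ fun x => ?_) ?_
    · rw [Real.norm_eq_abs, abs_mul, cutoff, abs_of_nonneg (smoothTransition.nonneg _)]
      exact mul_le_of_le_one_left (abs_nonneg _) (smoothTransition.le_one _)
    · filter_upwards [ae_restrict_mem D.isOpen.measurableSet] with x hx
      refine tendsto_const_nhds.congr' ?_
      filter_upwards [D.tendsto_cutoff hx] with j hj
      rw [hj, one_mul]
  have lim2 : Tendsto (fun j => ∫ x in Ω, ∑ i, pderiv' i (cutoff φ j) x * X i x) atTop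
      (𝓝 (∫ x in Ω, (0 : ℝ))) := by
    refine tendsto_integral_of_dominated_convergence (fun _ => ∑ _i : Fin n, K * |M|)
      (fun j => (integrable_finsetSum _ fun i _ => i2 j i).aestronglyMeasurable.restrict)
      (integrableOn_const D.volume_lt_top.ne) (fun j => ?_) ?_
    · filter_upwards [ae_restrict_mem D.isOpen.measurableSet] with x hx
      refine (norm_sum_le _ _).trans (Finset.sum_le_sum fun i _ => ?_)
      rw [norm_mul, Real.norm_eq_abs, Real.norm_eq_abs]
      have hpos := (D.mem_iff x).1 hx
      calc |pderiv' i (cutoff φ j) x| * |X i x|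
          ≤ |pderiv' i (cutoff φ j) x| * (|M| * φ x) := by
            gcongr
            exact (hM i x hx).trans (by gcongr; exact le_abs_self M)
        _ = (φ x * |pderiv' i (cutoff φ j) x|) * |M| := by ring
        _ ≤ K * |M| := by gcongr; exact hK j i x hx
    · filter_upwards [ae_restrict_mem D.isOpen.measurableSet] with x hx
      refine tendsto_const_nhds.congr' ?_
      filter_upwards [eventually_all.2 fun i => D.tendsto_pderiv'_cutoff hx i] with j hj
      simp [hj]
  have := tendsto_nhds_unique (lim1.congr key) lim2.neg
  simpa using this

end Cutoff

section Geometry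

variable {n : ℕ} {Ω : Set (EuclideanSpace ℝ (Fin n))} {φ : EuclideanSpace ℝ (Fin n) → ℝ}

/-- A defining function of a smooth bounded domain, with nonvanishing gradient on the boundary. -/
structure RegularDefiningFun (Ω : Set (EuclideanSpace ℝ (Fin n)))
    (φ : EuclideanSpace ℝ (Fin n) → ℝ) : Prop extends DefiningFun Ω φ where
  nonempty : Ω.Nonempty
  frontier_iff : ∀ x, x ∈ frontier Ω ↔ φ x = 0
  fderiv_ne : ∀ x ∈ frontier Ω, fderiv ℝ φ x ≠ 0

lemma IsSmoothDomain.exists_regularDefiningFun (h : IsSmoothDomain Ω) :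
    ∃ φ, RegularDefiningFun Ω φ := by
  obtain ⟨ho, hb, hne, Φ, hΦ, hΩ, hf, hg⟩ := h
  refine ⟨fun x => -Φ x, ⟨⟨ho, hb, hΦ.neg, fun x => ?_⟩, hne, fun x => ?_, fun x hx h0 => ?_⟩⟩
  · rw [hΩ]; simp
  · rw [hf]; simp
  · refine hg x hx ?_
    have h1 : fderiv ℝ Φ x = 0 := by
      have := fderiv_fun_neg (𝕜 := ℝ) (f := Φ) (x := x)
      rw [this] at h0
      simpa using h0
    rw [gradient, h1, map_zero]

namespace RegularDefiningFun

lemma mem_frontier_of_closure (D : RegularDefiningFun Ω φ) {x : EuclideanSpace ℝ (Fin n)}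
    (hx : x ∈ closure Ω) (hx' : x ∉ Ω) : x ∈ frontier Ω := by
  rw [D.isOpen.frontier_eq]; exact ⟨hx, hx'⟩

lemma frontier_nonempty (D : RegularDefiningFun Ω φ) (hn : 1 ≤ n) : (frontier Ω).Nonempty := by
  by_contra h
  rw [not_nonempty_iff_eq_empty] at h
  have hc : IsClopen Ω := isClopen_iff_frontier_eq_empty.2 h
  have : Nonempty (Fin n) := ⟨⟨0, hn⟩⟩
  have hu := (isClopen_iff.1 hc).resolve_left D.nonempty.ne_empty
  have hb := D.bdd
  rw [hu] at hb
  exact NormedSpace.unbounded_univ ℝ (EuclideanSpace ℝ (Fin n)) hb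

lemma exists_dist_eq_dB (D : RegularDefiningFun Ω φ) (hn : 1 ≤ n)
    (x : EuclideanSpace ℝ (Fin n)) : ∃ y ∈ frontier Ω, dB Ω x = dist x y :=
  isClosed_frontier.exists_infDist_eq_dist (D.frontier_nonempty hn) x

lemma ball_dB_subset (D : RegularDefiningFun Ω φ) {x : EuclideanSpace ℝ (Fin n)} (hx : x ∈ Ω) :
    Metric.ball x (dB Ω x) ⊆ Ω := by
  intro y hy
  by_contra hy'
  have hpos : 0 < dB Ω x := (dist_nonneg).trans_lt (Metric.mem_ball.1 hy)
  have hconv : IsPreconnected (Metric.ball x (dB Ω x)) := (convex_ball x _).isPreconnected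
  have : (Metric.ball x (dB Ω x) ∩ frontier Ω).Nonempty := by
    by_contra hne
    rw [not_nonempty_iff_eq_empty] at hne
    have h1 := hconv.subset_or_subset (u := Ω) (v := (closure Ω)ᶜ) D.isOpen
      isClosed_closure.isOpen_compl
      (disjoint_left.2 fun z hz hz' => hz' (subset_closure hz)) (fun z hz => by
        by_cases hzΩ : z ∈ Ω
        · exact Or.inl hzΩ
        · refine Or.inr fun hzc => ?_
          have : z ∈ Metric.ball x (dB Ω x) ∩ frontier Ω :=
            ⟨hz, D.mem_frontier_of_closure hzc hzΩ⟩
          rw [hne] at this; exact this)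
    rcases h1 with h1 | h1
    · exact hy' (h1 hy)
    · exact h1 (Metric.mem_ball_self hpos) (subset_closure hx)
  obtain ⟨z, hz, hzf⟩ := this
  have := Metric.infDist_le_dist_of_mem (x := x) hzf
  rw [Metric.mem_ball, dist_comm] at hz
  exact absurd hz (not_lt.2 this)

lemma exists_le_mul_dB (D : RegularDefiningFun Ω φ) (hn : 1 ≤ n) :
    ∃ K, 0 < K ∧ ∀ x ∈ Ω, φ x ≤ K * dB Ω x := by
  obtain ⟨R, hR⟩ := D.bdd.closure.subset_closedBall (0 : EuclideanSpace ℝ (Fin n))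
  obtain ⟨K, hK⟩ := (isCompact_closedBall (0 : EuclideanSpace ℝ (Fin n))
    R).exists_bound_of_continuousOn (D.smooth.continuous_fderiv (by simp)).continuousOn
  refine ⟨max K 1, by positivity, fun x hx => ?_⟩
  obtain ⟨y, hy, hxy⟩ := D.exists_dist_eq_dB hn x
  have h1 := (convex_closedBall (0 : EuclideanSpace ℝ (Fin n)) R).norm_image_sub_le_of_norm_fderiv_le
    (𝕜 := ℝ) (f := φ) (C := K)
    (fun z _ => D.differentiable z) (fun z hz => hK z hz) (hR (frontier_subset_closure hy))
    (hR (subset_closure hx))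
  rw [(D.frontier_iff y).1 hy, sub_zero, ← dist_eq_norm, ← hxy] at h1
  calc φ x ≤ ‖φ x‖ := le_abs_self _
    _ ≤ K * dB Ω x := h1
    _ ≤ _ := mul_le_mul_of_nonneg_right (le_max_left _ _) Metric.infDist_nonneg

lemma exists_dB_le_mul_nhds (D : RegularDefiningFun Ω φ) {y : EuclideanSpace ℝ (Fin n)}
    (hy : y ∈ closure Ω) :
    ∃ t ∈ 𝓝[closure Ω] y, ∃ K, ∀ x ∈ t, x ∈ Ω → dB Ω x ≤ K * φ x := by
  by_cases hyΩ : y ∈ Ω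
  · have hpos := (D.mem_iff y).1 hyΩ
    refine ⟨{x | φ y / 2 < φ x ∧ dB Ω x < dB Ω y + 1}, mem_nhdsWithin_of_mem_nhds ?_,
      2 * (dB Ω y + 1) / φ y, fun x hx _ => ?_⟩
    · exact ((D.smooth.continuous.continuousAt (x := y)).eventually
        (lt_mem_nhds (by linarith))).and
        ((Metric.continuous_infDist_pt (frontier Ω)).continuousAt.eventually
          (gt_mem_nhds (by simp [dB])))
    · have h0 : 0 ≤ dB Ω y := Metric.infDist_nonneg
      have : dB Ω y + 1 ≤ 2 * (dB Ω y + 1) / φ y * φ x := by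
        rw [div_mul_eq_mul_div, le_div_iff₀ hpos]
        nlinarith [hx.1]
      linarith [hx.2]
  · have hyf := D.mem_frontier_of_closure hy hyΩ
    have hne := D.fderiv_ne y hyf
    obtain ⟨e, he⟩ : ∃ e, fderiv ℝ φ y e ≠ 0 := by
      by_contra h; push Not at h; exact hne (ContinuousLinearMap.ext h)
    obtain ⟨e, he⟩ : ∃ e, 0 < fderiv ℝ φ y e := by
      rcases lt_or_gt_of_ne he with h | h
      · exact ⟨-e, by simpa using h⟩
      · exact ⟨e, h⟩
    set c := fderiv ℝ φ y e / 2 with hc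
    have hc0 : 0 < c := by positivity
    have hcont : Continuous fun z => fderiv ℝ φ z e :=
      (D.smooth.continuous_fderiv (by simp)).clm_apply continuous_const
    obtain ⟨r, hr, hball⟩ := Metric.eventually_nhds_iff_ball.1
      (hcont.continuousAt.eventually (lt_mem_nhds (show c < fderiv ℝ φ y e by linarith)))
    have hen : 0 < ‖e‖ := norm_pos_iff.2 (by rintro rfl; simp at he)
    refine ⟨Metric.ball y (r / 2) ∩ {x | φ x < c * (r / (2 * ‖e‖))}, mem_nhdsWithin_of_mem_nhds
      (inter_mem (Metric.ball_mem_nhds _ (by positivity))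
      ((D.smooth.continuous.continuousAt (x := y)).eventually (gt_mem_nhds ?_))), ‖e‖ / c, ?_⟩
    · rw [(D.frontier_iff y).1 hyf]; positivity
    rintro x ⟨hx1, hx2⟩ hxΩ
    have hxpos := (D.mem_iff x).1 hxΩ
    set s := φ x / c with hs
    have hs0 : 0 < s := by positivity
    have hsr : s * ‖e‖ < r / 2 := by
      have : s < r / (2 * ‖e‖) := by
        rw [hs, div_lt_iff₀ hc0, mul_comm]; exact hx2
      rw [lt_div_iff₀ (by positivity)] at this
      linarith
    have hmem : ∀ τ ∈ Icc 0 s, x - τ • e ∈ Metric.ball y r := by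
      intro τ hτ
      rw [Metric.mem_ball] at hx1 ⊢
      calc dist (x - τ • e) y ≤ dist (x - τ • e) x + dist x y := dist_triangle _ _ _
        _ < r / 2 + r / 2 := by
          refine add_lt_add ?_ hx1
          rw [dist_eq_norm, sub_sub_cancel_left, norm_neg, norm_smul, Real.norm_eq_abs,
            abs_of_nonneg hτ.1]
          exact (mul_le_mul_of_nonneg_right hτ.2 hen.le).trans_lt hsr
        _ = r := by ring
    have hder : ∀ τ, HasDerivAt (fun τ : ℝ => φ (x - τ • e)) (-(fderiv ℝ φ (x - τ • e) e)) τ := by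
      intro τ
      have h1 : HasDerivAt (fun τ : ℝ => x - τ • e) (-e) τ := by
        simpa using ((hasDerivAt_id τ).smul_const e).const_sub x
      have := (D.differentiable (x - τ • e)).hasFDerivAt.comp_hasDerivAt τ h1
      simpa [Function.comp_def] using this
    have hle : φ (x - s • e) ≤ 0 := by
      have hdiff := (convex_Icc (0 : ℝ) s).image_sub_le_mul_sub_of_deriv_le
        (f := fun τ : ℝ => φ (x - τ • e)) (C := -c)
        (fun τ _ => (hder τ).continuousAt.continuousWithinAt)
        (fun τ _ => (hder τ).differentiableAt.differentiableWithinAt)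
        (fun τ hτ => by
          rw [(hder τ).deriv]
          have := hball _ (hmem τ (interior_subset hτ))
          linarith)
        0 (left_mem_Icc.2 hs0.le) s (right_mem_Icc.2 hs0.le) hs0.le
      have : c * s = φ x := by rw [hs]; field_simp
      simp only [zero_smul, sub_zero] at hdiff
      linarith
    obtain ⟨τ, hτ, hτ0⟩ := intermediate_value_Icc' hs0.le
      (f := fun τ : ℝ => φ (x - τ • e))
      (fun τ _ => (hder τ).continuousAt.continuousWithinAt) ⟨hle, by simpa using hxpos.le⟩
    have h2 := Metric.infDist_le_dist_of_mem (x := x) ((D.frontier_iff _).2 hτ0)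
    calc dB Ω x ≤ dist x (x - τ • e) := h2
      _ = τ * ‖e‖ := by
        rw [dist_eq_norm, sub_sub_cancel, norm_smul, Real.norm_eq_abs, abs_of_nonneg hτ.1]
      _ ≤ s * ‖e‖ := mul_le_mul_of_nonneg_right hτ.2 hen.le
      _ = ‖e‖ / c * φ x := by rw [hs]; ring

lemma exists_dB_le_mul (D : RegularDefiningFun Ω φ) :
    ∃ K, 0 < K ∧ ∀ x ∈ Ω, dB Ω x ≤ K * φ x := by
  have : ∃ K, ∀ x ∈ closure Ω, x ∈ Ω → dB Ω x ≤ K * φ x := by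
    refine D.isCompact_closure.induction_on
      (p := fun t => ∃ K, ∀ x ∈ t, x ∈ Ω → dB Ω x ≤ K * φ x) ⟨0, by simp⟩ ?_ ?_ ?_
    · rintro s t hst ⟨K, hK⟩
      exact ⟨K, fun x hx => hK x (hst hx)⟩
    · rintro s t ⟨K, hK⟩ ⟨K', hK'⟩
      refine ⟨max K K', fun x hx hxΩ => ?_⟩
      have hpos := ((D.mem_iff x).1 hxΩ).le
      rcases hx with hx | hx
      · exact (hK x hx hxΩ).trans (mul_le_mul_of_nonneg_right (le_max_left _ _) hpos)
      · exact (hK' x hx hxΩ).trans (mul_le_mul_of_nonneg_right (le_max_right _ _) hpos)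
    · exact fun x hx => D.exists_dB_le_mul_nhds hx
  obtain ⟨K, hK⟩ := this
  refine ⟨max K 1, by positivity, fun x hx => (hK x (subset_closure hx) hx).trans
    (mul_le_mul_of_nonneg_right (le_max_left _ _) ((D.mem_iff x).1 hx).le)⟩

lemma exists_le_gradSq_add (D : RegularDefiningFun Ω φ) :
    ∃ c, 0 < c ∧ ∀ x ∈ Ω, c ≤ gradSq φ x + φ x := by
  have hcont : Continuous fun x => gradSq φ x + φ x := by
    refine Continuous.add ?_ D.smooth.continuous
    exact continuous_finsetSum _ fun i _ => (D.continuous_pderiv' i).pow 2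
  obtain ⟨x₀, hx₀, hmin⟩ := D.isCompact_closure.exists_isMinOn
    (D.nonempty.closure) hcont.continuousOn
  refine ⟨gradSq φ x₀ + φ x₀, ?_, fun x hx => hmin (subset_closure hx)⟩
  by_cases h : x₀ ∈ Ω
  · exact add_pos_of_nonneg_of_pos (gradSq_nonneg _ _) ((D.mem_iff _).1 h)
  · have hf := D.mem_frontier_of_closure hx₀ h
    rw [(D.frontier_iff x₀).1 hf, add_zero, ← norm_fderiv_sq]
    have := norm_pos_iff.2 (D.fderiv_ne x₀ hf)
    positivity

end RegularDefiningFun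

end Geometry

section Sobolev

lemma enorm_le_lintegral_fderiv_of_one {w : EuclideanSpace ℝ (Fin 1) → ℝ} (hw : ContDiff ℝ 1 w)
    (hs : HasCompactSupport w) (x : EuclideanSpace ℝ (Fin 1)) :
    ‖w x‖ₑ ≤ ∫⁻ y, ‖fderiv ℝ w y‖ₑ := by
  set e : ℝ ≃ᵐ EuclideanSpace ℝ (Fin 1) :=
    (MeasurableEquiv.funUnique (Fin 1) ℝ).symm.trans (MeasurableEquiv.toLp 2 (Fin 1 → ℝ)) with he
  have hmp : MeasurePreserving e volume volume :=
    (PiLp.volume_preserving_toLp (Fin 1)).comp (volume_preserving_funUnique (Fin 1) ℝ).symm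
  have heq : ∀ s : ℝ, e s = s • EuclideanSpace.single 0 1 := by
    intro s
    ext i
    fin_cases i
    simp [he, MeasurableEquiv.trans_apply, MeasurableEquiv.funUnique]
  rw [← hmp.lintegral_comp_emb e.measurableEmbedding]
  have hx : x = e (x 0) := by
    rw [heq]; ext i; fin_cases i; simp
  have hne : (EuclideanSpace.single (0 : Fin 1) (1 : ℝ)) ≠ 0 := by
    intro h; have := congrArg (fun v => v 0) h; simp at this
  have hsm : ContDiff ℝ 1 (fun s => w (e s)) := by
    simp_rw [heq]
    exact hw.comp (contDiff_id.smul contDiff_const)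
  have hcs : HasCompactSupport (fun s => w (e s)) := by
    have : (fun s => w (e s)) = w ∘ fun s : ℝ => s • EuclideanSpace.single (0 : Fin 1) (1 : ℝ) := by
      funext s; simp [heq]
    rw [this]
    exact hs.comp_isClosedEmbedding (isClosedEmbedding_smul_left hne)
  calc ‖w x‖ₑ = ‖(fun s => w (e s)) (x 0)‖ₑ := congrArg (fun y => ‖w y‖ₑ) hx
    _ ≤ ∫⁻ y in Iic (x 0), ‖deriv (fun s => w (e s)) y‖ₑ :=
      HasCompactSupport.enorm_le_lintegral_Ici_deriv hsm hcs _
    _ ≤ ∫⁻ y, ‖deriv (fun s => w (e s)) y‖ₑ := setLIntegral_le_lintegral _ _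
    _ ≤ _ := by
      refine lintegral_mono fun s => ?_
      have hd : HasDerivAt (fun s : ℝ => w (e s)) (fderiv ℝ w (e s) (EuclideanSpace.single 0 1)) s := by
        have h1 : HasDerivAt (fun s : ℝ => e s) (EuclideanSpace.single 0 1) s := by
          simp_rw [heq]
          simpa using (hasDerivAt_id s).smul_const (EuclideanSpace.single (0 : Fin 1) (1 : ℝ))
        exact ((hw.differentiable one_ne_zero) (e s)).hasFDerivAt.comp_hasDerivAt s h1
      rw [hd.deriv]
      rw [← ofReal_norm, ← ofReal_norm]
      refine ENNReal.ofReal_le_ofReal ?_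
      have := (fderiv ℝ w (e s)).le_opNorm (EuclideanSpace.single 0 1)
      simpa using this

open scoped ENNReal NNReal in
/-- Sobolev inequality for compactly supported functions, in subcritical or critical range. -/
lemma exists_sobolev_compact {n : ℕ} (hn : 1 ≤ n) {Ω : Set (EuclideanSpace ℝ (Fin n))}
    (hb : Bornology.IsBounded Ω) {p : ℝ} (hp : 1 < p)
    (hpn : n ≤ 2 ∨ p ≤ ((n : ℝ) + 2) / ((n : ℝ) - 2)) :
    ∃ C : ℝ≥0∞, C ≠ ⊤ ∧ ∀ w : EuclideanSpace ℝ (Fin n) → ℝ, ContDiff ℝ 1 w → tsupport w ⊆ Ω →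
      HasCompactSupport w →
      eLpNorm w (ENNReal.ofReal (p + 1)) volume ≤ C * eLpNorm (fderiv ℝ w) 2 volume := by
  have hvol : volume Ω < ⊤ := hb.measure_lt_top
  have hstep : ∀ r : ℝ≥0, 1 ≤ r → r ≤ 2 → ∀ w : EuclideanSpace ℝ (Fin n) → ℝ, ContDiff ℝ 1 w →
      tsupport w ⊆ Ω → eLpNorm (fderiv ℝ w) r volume ≤
        eLpNorm (fderiv ℝ w) 2 volume * volume Ω ^ (1 / (r : ℝ) - 1 / 2) := by
    intro r hr hr2 w hw hs
    have hsup : Function.support (fderiv ℝ w) ⊆ Ω := (support_fderiv_subset ℝ).trans hs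
    have := eLpNorm_le_eLpNorm_mul_rpow_measure_univ (μ := volume.restrict Ω) (p := r) (q := 2)
      (f := fderiv ℝ w) (by exact_mod_cast hr2)
      (hw.continuous_fderiv one_ne_zero).aestronglyMeasurable
    have e1 : ∀ q, eLpNorm (fderiv ℝ w) q (volume.restrict Ω) = eLpNorm (fderiv ℝ w) q volume :=
      fun q => eLpNorm_restrict_eq_of_support_subset (f := fderiv ℝ w) hsup
    rw [e1, e1] at this
    simpa using this
  rcases Nat.lt_or_ge n 2 with h1 | h2
  · obtain rfl : n = 1 := by omega
    refine ⟨volume Ω ^ (1 / (1 : ℝ) - 1 / 2) * volume Ω ^ (1 / (p + 1)), ?_, fun w hw hs hc => ?_⟩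
    · exact ENNReal.mul_ne_top (ENNReal.rpow_ne_top_of_nonneg (by norm_num) hvol.ne)
        (ENNReal.rpow_ne_top_of_nonneg (by positivity) hvol.ne)
    have hsup : Function.support w ⊆ Ω := (subset_tsupport w).trans hs
    have h1 := eLpNorm_le_eLpNorm_mul_rpow_measure_univ (μ := volume.restrict Ω)
      (p := ENNReal.ofReal (p + 1)) (q := ⊤) (f := w) le_top hw.continuous.aestronglyMeasurable
    rw [eLpNorm_restrict_eq_of_support_subset hsup, eLpNorm_restrict_eq_of_support_subset hsup] at h1
    have h2 : eLpNorm w ⊤ volume ≤ eLpNorm (fderiv ℝ w) 1 volume := by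
      rw [eLpNorm_exponent_top, eLpNorm_one_eq_lintegral_enorm]
      exact essSup_le_of_ae_le _ (ae_of_all _ fun x => enorm_le_lintegral_fderiv_of_one hw hc x)
    have h3 := hstep 1 le_rfl (by norm_num) w hw hs
    simp only [ENNReal.toReal_top, div_zero, sub_zero, ENNReal.toReal_ofReal (by linarith : (0:ℝ) ≤ p + 1),
      Measure.restrict_apply_univ] at h1
    simp only [ENNReal.coe_one, NNReal.coe_one] at h3
    calc _ ≤ _ := h1
      _ ≤ (eLpNorm (fderiv ℝ w) 2 volume * volume Ω ^ (1 / (1:ℝ) - 1 / 2)) * volume Ω ^ (1 / (p + 1)) :=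
        mul_le_mul_left (h2.trans h3) _
      _ = _ := by ring
  · obtain ⟨r, hr1, hr2, hrn, hr⟩ : ∃ r : ℝ≥0, 1 ≤ r ∧ r ≤ 2 ∧ r < n ∧
        (r : ℝ)⁻¹ - (n : ℝ)⁻¹ ≤ (p + 1)⁻¹ := by
      rcases Nat.lt_or_ge 2 n with h3 | h3
      · have hn3 : (2 : ℝ) < n := by exact_mod_cast h3
        refine ⟨2, by norm_num, le_rfl, by exact_mod_cast h3, ?_⟩
        have hp' := hpn.resolve_left (by omega)
        rw [le_div_iff₀ (by linarith)] at hp'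
        have : ((2 : ℝ≥0) : ℝ)⁻¹ - (n : ℝ)⁻¹ = ((n : ℝ) - 2) / (2 * n) := by
          push_cast; field_simp
        rw [this, div_le_iff₀ (by linarith), inv_mul_eq_div, le_div_iff₀ (by linarith)]
        nlinarith
      · obtain rfl : n = 2 := by omega
        have hs : 0 < (2:ℝ)⁻¹ + (p + 1)⁻¹ := by positivity
        have hs1 : (p + 1)⁻¹ < (2:ℝ)⁻¹ := inv_strictAnti₀ (by norm_num) (by linarith)
        have hs2 : 0 < (p + 1)⁻¹ := by positivity
        have hcoe : (((2:ℝ)⁻¹ + (p + 1)⁻¹)⁻¹.toNNReal : ℝ) = ((2:ℝ)⁻¹ + (p + 1)⁻¹)⁻¹ :=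
          Real.coe_toNNReal _ (by positivity)
        refine ⟨((2:ℝ)⁻¹ + (p + 1)⁻¹)⁻¹.toNNReal, ?_, ?_, ?_, ?_⟩
        · rw [← NNReal.coe_le_coe, hcoe, NNReal.coe_one, one_le_inv₀ hs]; linarith
        · rw [← NNReal.coe_le_coe, hcoe, NNReal.coe_ofNat, inv_le_comm₀ hs (by norm_num)]; linarith
        · rw [← NNReal.coe_lt_coe, hcoe]
          push_cast
          rw [inv_lt_comm₀ hs (by norm_num)]; linarith
        · rw [hcoe, inv_inv]; push_cast; linarith
    have hq0 : (0:ℝ) ≤ p + 1 := by linarith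
    refine ⟨eLpNormLESNormFDerivOfLeConst ℝ (volume : Measure (EuclideanSpace ℝ (Fin n))) Ω r
      (Real.toNNReal (p + 1)) * volume Ω ^ (1 / (r : ℝ) - 1 / 2), ?_, fun w hw hs hc => ?_⟩
    · refine ENNReal.mul_ne_top ENNReal.coe_ne_top (ENNReal.rpow_ne_top_of_nonneg ?_ hvol.ne)
      have : (0:ℝ) < r := by exact_mod_cast zero_lt_one.trans_le hr1
      rw [sub_nonneg]
      exact one_div_le_one_div_of_le this (by exact_mod_cast hr2)
    have h3 := hstep r hr1 hr2 w hw hs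
    have h4 := eLpNorm_le_eLpNorm_fderiv_of_le (μ := (volume : Measure (EuclideanSpace ℝ (Fin n))))
      hw ((subset_tsupport w).trans hs) hr1 (q := Real.toNNReal (p + 1)) (by simpa using hrn)
      (by simpa [Real.coe_toNNReal _ hq0] using hr) hb
    calc _ ≤ _ := h4
      _ ≤ _ := mul_le_mul_right h3 _
      _ = _ := by ring

end Sobolev

section Sobolev

variable {n : ℕ} {Ω : Set (EuclideanSpace ℝ (Fin n))} {φ : EuclideanSpace ℝ (Fin n) → ℝ}

lemma continuous_gradSq {w : EuclideanSpace ℝ (Fin n) → ℝ} (hw : ContDiff ℝ 1 w) :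
    Continuous (gradSq w) :=
  continuous_finsetSum _ fun _ _ =>
    ((hw.continuous_fderiv one_ne_zero).clm_apply continuous_const).pow 2

lemma exists_sobolev_integral (hn : 1 ≤ n) (hb : Bornology.IsBounded Ω) {p : ℝ} (hp : 1 < p)
    (hpn : n ≤ 2 ∨ p ≤ ((n : ℝ) + 2) / ((n : ℝ) - 2)) :
    ∃ C : ℝ, 0 < C ∧ ∀ w : EuclideanSpace ℝ (Fin n) → ℝ, ContDiff ℝ 1 w → tsupport w ⊆ Ω →
      HasCompactSupport w →
      (∫ x in Ω, |w x| ^ (p + 1)) ^ (2 / (p + 1)) ≤ C * ∫ x in Ω, gradSq w x := by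
  obtain ⟨C, hC, h⟩ := exists_sobolev_compact hn hb hp hpn
  refine ⟨C.toReal ^ 2 + 1, by positivity, fun w hw hs hc => ?_⟩
  have hp0 : (0:ℝ) < p + 1 := by linarith
  have h1 := h w hw hs hc
  have hq0 : ENNReal.ofReal (p + 1) ≠ 0 := by simpa using hp0
  have hwL : MemLp w (ENNReal.ofReal (p + 1)) volume := hw.continuous.memLp_of_hasCompactSupport hc
  have hfL : MemLp (fderiv ℝ w) 2 volume :=
    (hw.continuous_fderiv one_ne_zero).memLp_of_hasCompactSupport (hc.fderiv ℝ)
  rw [hwL.eLpNorm_eq_integral_rpow_norm hq0 ENNReal.ofReal_ne_top,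
    hfL.eLpNorm_eq_integral_rpow_norm two_ne_zero ENNReal.ofNat_ne_top,
    ENNReal.toReal_ofReal hp0.le, ← ENNReal.ofReal_toReal hC,
    ← ENNReal.ofReal_mul ENNReal.toReal_nonneg] at h1
  have e1 : ∫ x in Ω, |w x| ^ (p + 1) = ∫ x, ‖w x‖ ^ (p + 1) := by
    refine setIntegral_eq_integral_of_forall_compl_eq_zero fun x hx => ?_
    have : w x = 0 := image_eq_zero_of_notMem_tsupport fun h => hx (hs h)
    rw [this, abs_zero, Real.zero_rpow hp0.ne']
  have e2 : ∫ x in Ω, gradSq w x = ∫ x, ‖fderiv ℝ w x‖ ^ (2:ℝ) := by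
    simp_rw [Real.rpow_two, norm_fderiv_sq]
    refine setIntegral_eq_integral_of_forall_compl_eq_zero fun x hx => ?_
    refine Finset.sum_eq_zero fun i _ => ?_
    rw [pderiv'_eq_zero_of_notMem_tsupport (fun h => hx (hs h))]; simp
  have hA : 0 ≤ ∫ x, ‖w x‖ ^ (p + 1) := integral_nonneg fun x => by positivity
  have hB : 0 ≤ ∫ x, ‖fderiv ℝ w x‖ ^ (2:ℝ) := integral_nonneg fun x => by positivity
  rw [e1, e2]
  simp only [ENNReal.toReal_ofNat] at h1
  rw [ENNReal.ofReal_le_ofReal_iff (by positivity)] at h1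
  have h2 := pow_le_pow_left₀ (by positivity) h1 2
  have e3 : ((∫ x, ‖w x‖ ^ (p + 1)) ^ (p + 1)⁻¹) ^ 2 = (∫ x, ‖w x‖ ^ (p + 1)) ^ (2 / (p + 1)) := by
    rw [← Real.rpow_natCast, ← Real.rpow_mul hA]; congr 1; push_cast; field_simp
  have e4 : ((∫ x, ‖fderiv ℝ w x‖ ^ (2:ℝ)) ^ (2:ℝ)⁻¹) ^ 2 = ∫ x, ‖fderiv ℝ w x‖ ^ (2:ℝ) := by
    rw [← Real.rpow_natCast, ← Real.rpow_mul hB]; norm_num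
  rw [mul_pow, e3, e4] at h2
  nlinarith

lemma exists_linear_le_rpow {A c p : ℝ} (hA : 0 < A) (hc : 0 < c) (hp : 0 < p) :
    ∃ C, 0 < C ∧ ∀ s, 0 ≤ s → A * s ≤ c + C * s ^ (p + 1) := by
  refine ⟨A / (c / A) ^ p, by positivity, fun s hs => ?_⟩
  rcases le_or_gt (A * s) c with h | h
  · have : 0 ≤ A / (c / A) ^ p * s ^ (p + 1) := by positivity
    linarith
  · have h0 : c / A < s := by rw [div_lt_iff₀ hA]; linarith
    have hs0 : 0 < s := (by positivity : 0 < c / A).trans h0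
    have h1 : (c / A) ^ p ≤ s ^ p := Real.rpow_le_rpow (by positivity) h0.le hp.le
    rw [Real.rpow_add hs0, Real.rpow_one]
    have : A * s ≤ A / (c / A) ^ p * (s ^ p * s) := by
      rw [div_mul_eq_mul_div, le_div_iff₀ (by positivity)]
      calc A * s * (c / A) ^ p ≤ A * s * s ^ p := by gcongr
        _ = _ := by ring
    linarith

/-- Weighted Hardy inequality for compactly supported functions. -/
lemma RegularDefiningFun.exists_hardy (D : RegularDefiningFun Ω φ) {p : ℝ} (hp : 1 < p) :
    ∃ C, 0 < C ∧ ∀ g : EuclideanSpace ℝ (Fin n) → ℝ, ContDiff ℝ 1 g → HasCompactSupport g →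
      tsupport g ⊆ Ω →
      ∫ x in Ω, g x ^ 2 ≤ C * ∫ x in Ω, (φ x ^ 2 * gradSq g x + φ x ^ (p + 1) * g x ^ 2) := by
  obtain ⟨c, hc, hcb⟩ := D.exists_le_gradSq_add
  obtain ⟨K, hK, hKb⟩ := D.exists_bound_pderiv'
  have hφc := D.smooth.continuous
  have hd2 : ∀ i, ContDiff ℝ 1 (pderiv' i φ) := fun i =>
    (D.smooth.fderiv_right (m := 1) (by norm_cast)).clm_apply contDiff_const
  have hlapc : Continuous (fun x => ∑ i, pderiv' i (pderiv' i φ) x) :=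
    continuous_finsetSum _ fun i _ => ((hd2 i).continuous_fderiv one_ne_zero).clm_apply continuous_const
  obtain ⟨L, hL, hLb⟩ := D.bound_closure hlapc
  obtain ⟨C1, hC1, hC1b⟩ := exists_linear_le_rpow (A := L + 1) (c := c / 4) (p := p)
    (by positivity) (by positivity) (by linarith)
  set δ := c / (4 * (n + 1)) with hδ
  have hδ0 : 0 < δ := by positivity
  refine ⟨(K ^ 2 / δ + C1) * (2 / c), by positivity, fun g hg hgc hgs => ?_⟩
  set X : Fin n → EuclideanSpace ℝ (Fin n) → ℝ := fun i x => (g x * g x) * (φ x * pderiv' i φ x)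
    with hX
  have hφ1 : ContDiff ℝ 1 φ := D.smooth.of_le (by norm_cast)
  have hXs : ∀ i, ContDiff ℝ 1 (X i) := fun i => (hg.mul hg).mul (hφ1.mul (hd2 i))
  have hXd : ∀ i x, pderiv' i (X i) x = 2 * g x * pderiv' i g x * (φ x * pderiv' i φ x)
      + g x ^ 2 * (pderiv' i φ x ^ 2 + φ x * pderiv' i (pderiv' i φ) x) := by
    intro i x
    have a1 := hg.differentiable one_ne_zero x
    have a2 := hφ1.differentiable one_ne_zero x
    have a3 := (hd2 i).differentiable one_ne_zero x
    simp only [hX]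
    rw [pderiv'_mul (f := fun y => g y * g y) (g := fun y => φ y * pderiv' i φ y)
      (a1.mul a1) (a2.mul a3), pderiv'_mul a1 a1, pderiv'_mul a2 a3]
    ring
  obtain ⟨G, hG⟩ := hg.continuous.bounded_above_of_compact_support hgc
  have hint : ∀ f : EuclideanSpace ℝ (Fin n) → ℝ, Continuous f → (∀ x ∉ tsupport g, f x = 0) →
      IntegrableOn f Ω := by
    intro f hf h0
    exact (hf.integrable_of_hasCompactSupport (HasCompactSupport.intro hgc h0)).integrableOn
  have hdivc : Continuous fun x => ∑ i, pderiv' i (X i) x :=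
    continuous_finsetSum _ fun i _ => ((hXs i).continuous_fderiv one_ne_zero).clm_apply continuous_const
  have hdivI : IntegrableOn (fun x => ∑ i, pderiv' i (X i) x) Ω := by
    refine hint _ hdivc fun x hx => Finset.sum_eq_zero fun i _ => ?_
    rw [hXd, image_eq_zero_of_notMem_tsupport hx]; ring
  have hdiv := D.integral_div_eq_zero (X := X) (M := G ^ 2 * K) (fun i => (hXs i).contDiffOn)
    (fun i x hx => by
      have hpos := (D.mem_iff x).1 hx
      have h1 : |pderiv' i φ x| ≤ K := hKb i x (subset_closure hx)
      have h2 : |g x| ≤ G := hG x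
      simp only [hX]
      rw [abs_mul, abs_mul, abs_mul, abs_of_pos hpos]
      have : |g x| * |g x| ≤ G ^ 2 := by nlinarith [abs_nonneg (g x)]
      calc |g x| * |g x| * (φ x * |pderiv' i φ x|) ≤ G ^ 2 * (φ x * K) := by gcongr
        _ = _ := by ring) hdivI
  have hφp : Continuous fun x => φ x ^ (p + 1) :=
    hφc.rpow_const fun _ => Or.inr (by linarith)
  have hI0 : IntegrableOn (fun x => g x ^ 2) Ω := hint _ (hg.continuous.pow 2) fun x hx => by
    rw [image_eq_zero_of_notMem_tsupport hx]; ring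
  have hI1 : IntegrableOn (fun x => φ x ^ 2 * gradSq g x + φ x ^ (p + 1) * g x ^ 2) Ω := by
    refine hint _ (((hφc.pow 2).mul (continuous_gradSq hg)).add (hφp.mul (hg.continuous.pow 2)))
      fun x hx => ?_
    have : gradSq g x = 0 := Finset.sum_eq_zero fun i _ => by
      rw [pderiv'_eq_zero_of_notMem_tsupport hx]; ring
    rw [this, image_eq_zero_of_notMem_tsupport hx]; ring
  have hpt : ∀ x ∈ Ω, c / 2 * g x ^ 2 ≤ (∑ i, pderiv' i (X i) x)
      + (K ^ 2 / δ + C1) * (φ x ^ 2 * gradSq g x + φ x ^ (p + 1) * g x ^ 2) := by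
    intro x hx
    have hpos := (D.mem_iff x).1 hx
    have hxc := subset_closure hx
    have e1 : ∑ i, pderiv' i (X i) x = (∑ i, 2 * g x * pderiv' i g x * (φ x * pderiv' i φ x))
        + g x ^ 2 * gradSq φ x + g x ^ 2 * (φ x * ∑ i, pderiv' i (pderiv' i φ) x) := by
      rw [Finset.sum_congr rfl fun i _ => hXd i x, Finset.sum_add_distrib, add_assoc]
      congr 1
      simp only [gradSq, Finset.mul_sum, mul_add, Finset.sum_add_distrib]
    have e2 : -(∑ i, 2 * g x * pderiv' i g x * (φ x * pderiv' i φ x))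
        ≤ c / 4 * g x ^ 2 + K ^ 2 / δ * (φ x ^ 2 * gradSq g x) := by
      rw [← Finset.sum_neg_distrib, gradSq, Finset.mul_sum, Finset.mul_sum]
      have : ∀ i ∈ (Finset.univ : Finset (Fin n)),
          -(2 * g x * pderiv' i g x * (φ x * pderiv' i φ x)) ≤
          δ * g x ^ 2 + K ^ 2 / δ * (φ x ^ 2 * pderiv' i g x ^ 2) := by
        intro i _
        have h1 : pderiv' i φ x ^ 2 ≤ K ^ 2 := sq_le_sq' (abs_le.1 (hKb i x hxc)).1 (abs_le.1 (hKb i x hxc)).2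
        have h2 : pderiv' i φ x ^ 2 / δ * (φ x ^ 2 * pderiv' i g x ^ 2)
            ≤ K ^ 2 / δ * (φ x ^ 2 * pderiv' i g x ^ 2) := by gcongr
        have h3 : 0 ≤ δ * (g x + φ x * pderiv' i g x * pderiv' i φ x / δ) ^ 2 := by positivity
        have h4 : δ * (g x + φ x * pderiv' i g x * pderiv' i φ x / δ) ^ 2 =
          δ * g x ^ 2 + 2 * g x * pderiv' i g x * (φ x * pderiv' i φ x)
          + pderiv' i φ x ^ 2 / δ * (φ x ^ 2 * pderiv' i g x ^ 2) := by field_simp; ring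
        linarith
      refine (Finset.sum_le_sum this).trans ?_
      rw [Finset.sum_add_distrib, Finset.sum_const, Finset.card_univ, Fintype.card_fin, nsmul_eq_mul]
      have : (n:ℝ) * δ ≤ c / 4 := by
        rw [hδ, mul_div_assoc', div_le_div_iff₀ (by positivity) (by norm_num)]
        nlinarith
      have := mul_le_mul_of_nonneg_right this (sq_nonneg (g x))
      linarith
    have e3 := hC1b (φ x) hpos.le
    have e4 := hcb x hx
    have e5 := (abs_le.1 (hLb x hxc)).1
    have e6 : -(φ x * ∑ i, pderiv' i (pderiv' i φ) x) ≤ L * φ x := by nlinarith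
    have e7 : 0 ≤ g x ^ 2 := sq_nonneg _
    have e8 := gradSq_nonneg g x
    have e9 : 0 ≤ φ x ^ (p + 1) := by positivity
    have e10 : 0 ≤ C1 * (φ x ^ 2 * gradSq g x) := by positivity
    have e11 : 0 ≤ K ^ 2 / δ * (φ x ^ (p + 1) * g x ^ 2) := by positivity
    have e12 : g x ^ 2 * (c - gradSq φ x - φ x * ∑ i, pderiv' i (pderiv' i φ) x)
        ≤ g x ^ 2 * (c / 4 + C1 * φ x ^ (p + 1)) :=
      mul_le_mul_of_nonneg_left (by nlinarith) e7
    rw [e1]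
    nlinarith
  have := setIntegral_mono_on (hI0.const_mul (c / 2)) (hdivI.add (hI1.const_mul (K ^ 2 / δ + C1)))
    D.isOpen.measurableSet hpt
  simp only [Pi.add_apply] at this
  rw [integral_add hdivI (hI1.const_mul _), integral_const_mul, integral_const_mul, hdiv,
    zero_add] at this
  have h2 := mul_le_mul_of_nonneg_left this (by positivity : 0 ≤ 2 / c)
  calc ∫ x in Ω, g x ^ 2 = 2 / c * (c / 2 * ∫ x in Ω, g x ^ 2) := by field_simp
    _ ≤ _ := h2
    _ = _ := by ring

lemma RegularDefiningFun.exists_weighted_sobolev_compact (D : RegularDefiningFun Ω φ) (hn : 1 ≤ n)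
    {p : ℝ} (hp : 1 < p) (hpn : n ≤ 2 ∨ p ≤ ((n : ℝ) + 2) / ((n : ℝ) - 2)) :
    ∃ C, 0 < C ∧ ∀ g : EuclideanSpace ℝ (Fin n) → ℝ, ContDiff ℝ 1 g → HasCompactSupport g →
      tsupport g ⊆ Ω →
      (∫ x in Ω, |φ x * g x| ^ (p + 1)) ^ (2 / (p + 1)) ≤
        C * ∫ x in Ω, (φ x ^ 2 * gradSq g x + φ x ^ (p + 1) * g x ^ 2) := by
  obtain ⟨C1, hC1, h1⟩ := exists_sobolev_integral hn D.bdd hp hpn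
  obtain ⟨C2, hC2, h2⟩ := D.exists_hardy hp
  obtain ⟨K, hK, hKb⟩ := D.exists_bound_pderiv'
  refine ⟨C1 * (2 + 2 * (n * K ^ 2) * C2), by positivity, fun g hg hgc hgs => ?_⟩
  have hφ1 : ContDiff ℝ 1 φ := D.smooth.of_le (by norm_cast)
  have hφc := D.smooth.continuous
  have hts : tsupport (fun x => φ x * g x) ⊆ tsupport g := tsupport_mul_subset_right
  have hwc : HasCompactSupport fun x => φ x * g x := hgc.mul_left
  refine (h1 _ (hφ1.mul hg) (hts.trans hgs) hwc).trans ?_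
  rw [mul_assoc]
  refine mul_le_mul_of_nonneg_left ?_ hC1.le
  have hint : ∀ f : EuclideanSpace ℝ (Fin n) → ℝ, Continuous f → (∀ x ∉ tsupport g, f x = 0) →
      IntegrableOn f Ω := by
    intro f hf h0
    exact (hf.integrable_of_hasCompactSupport (HasCompactSupport.intro hgc h0)).integrableOn
  have hφp : Continuous fun x => φ x ^ (p + 1) :=
    hφc.rpow_const fun _ => Or.inr (by linarith)
  have hI0 : IntegrableOn (fun x => g x ^ 2) Ω := hint _ (hg.continuous.pow 2) fun x hx => by
    rw [image_eq_zero_of_notMem_tsupport hx]; ring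
  have hg0 : ∀ x ∉ tsupport g, gradSq g x = 0 := fun x hx => Finset.sum_eq_zero fun i _ => by
    rw [pderiv'_eq_zero_of_notMem_tsupport hx]; ring
  have hI1 : IntegrableOn (fun x => φ x ^ 2 * gradSq g x + φ x ^ (p + 1) * g x ^ 2) Ω := by
    refine hint _ (((hφc.pow 2).mul (continuous_gradSq hg)).add (hφp.mul (hg.continuous.pow 2)))
      fun x hx => ?_
    rw [hg0 x hx, image_eq_zero_of_notMem_tsupport hx]; ring
  have hI2 : IntegrableOn (gradSq fun x => φ x * g x) Ω :=
    hint _ (continuous_gradSq (hφ1.mul hg)) fun x hx => Finset.sum_eq_zero fun i _ => by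
      rw [pderiv'_eq_zero_of_notMem_tsupport fun h => hx (hts h)]; ring
  have := setIntegral_mono_on hI2 ((hI1.const_mul 2).add (hI0.const_mul (2 * (n * K ^ 2))))
    D.isOpen.measurableSet (fun x hx => by
      have hpos := (D.mem_iff x).1 hx
      have a1 := hg.differentiable one_ne_zero x
      have a2 := hφ1.differentiable one_ne_zero x
      have : gradSq (fun x => φ x * g x) x ≤ ∑ i, (2 * (φ x ^ 2 * pderiv' i g x ^ 2)
          + 2 * K ^ 2 * g x ^ 2) := by
        refine Finset.sum_le_sum fun i _ => ?_
        rw [pderiv'_mul a2 a1]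
        have hb := abs_le.1 (hKb i x (subset_closure hx))
        have : pderiv' i φ x ^ 2 ≤ K ^ 2 := sq_le_sq' hb.1 hb.2
        nlinarith [sq_nonneg (φ x * pderiv' i g x - pderiv' i φ x * g x),
          mul_le_mul_of_nonneg_right this (sq_nonneg (g x))]
      rw [Finset.sum_add_distrib, Finset.sum_const, Finset.card_univ, Fintype.card_fin, nsmul_eq_mul,
        ← Finset.mul_sum, ← Finset.mul_sum] at this
      have h0 : 0 ≤ φ x ^ (p + 1) * g x ^ 2 := by positivity
      simp only [Pi.add_apply]
      have e : gradSq g x = ∑ i, pderiv' i g x ^ 2 := rfl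
      rw [e]
      linarith)
  simp only [Pi.add_apply] at this
  rw [integral_add (hI1.const_mul 2) (hI0.const_mul _), integral_const_mul, integral_const_mul] at this
  refine this.trans ?_
  have h3 := mul_le_mul_of_nonneg_left (h2 g hg hgc hgs) (by positivity : 0 ≤ 2 * (n * K ^ 2))
  linarith

end Sobolev

section Sobolev

variable {n : ℕ} {Ω : Set (EuclideanSpace ℝ (Fin n))} {φ : EuclideanSpace ℝ (Fin n) → ℝ}

lemma DefiningFun.contDiff_cutoff_mul (D : DefiningFun Ω φ) {f : EuclideanSpace ℝ (Fin n) → ℝ}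
    (hf : ContDiffOn ℝ 1 f Ω) (j : ℕ) : ContDiff ℝ 1 fun x => cutoff φ j x * f x := by
  rw [contDiff_iff_contDiffAt]
  intro x
  by_cases hx : x ∈ Ω
  · exact (((D.contDiff_cutoff j).of_le (by norm_cast)).contDiffAt).mul
      (hf.contDiffAt (D.isOpen.mem_nhds hx))
  · have : x ∉ tsupport (cutoff φ j) := fun h => hx (D.tsupport_cutoff_subset' j h)
    rw [notMem_tsupport_iff_eventuallyEq] at this
    have h2 : (fun x => cutoff φ j x * f x) =ᶠ[𝓝 x] fun _ => 0 := by
      filter_upwards [this] with y hy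
      simp [hy]
    exact contDiffAt_const.congr_of_eventuallyEq h2

lemma cutoff_mem_Icc (φ : EuclideanSpace ℝ (Fin n) → ℝ) (j : ℕ) (x : EuclideanSpace ℝ (Fin n)) :
    cutoff φ j x ∈ Icc (0 : ℝ) 1 :=
  ⟨smoothTransition.nonneg _, smoothTransition.le_one _⟩

lemma DefiningFun.integrableOn_of_bound (D : DefiningFun Ω φ) {f : EuclideanSpace ℝ (Fin n) → ℝ}
    (hf : ContinuousOn f Ω) {M : ℝ} (hM : ∀ x ∈ Ω, |f x| ≤ M) : IntegrableOn f Ω :=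
  Integrable.mono' (g := fun _ => M) (integrableOn_const D.volume_lt_top.ne)
    (hf.aestronglyMeasurable D.isOpen.measurableSet)
    ((ae_restrict_iff' D.isOpen.measurableSet).2 (ae_of_all _ hM))

lemma DefiningFun.tendsto_setIntegral (D : DefiningFun Ω φ)
    {F : ℕ → EuclideanSpace ℝ (Fin n) → ℝ} {f : EuclideanSpace ℝ (Fin n) → ℝ}
    (hF : ∀ j, ContinuousOn (F j) Ω) {M : ℝ} (hM : ∀ j, ∀ x ∈ Ω, |F j x| ≤ M)
    (hlim : ∀ x ∈ Ω, ∀ᶠ j in atTop, F j x = f x) :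
    Tendsto (fun j => ∫ x in Ω, F j x) atTop (𝓝 (∫ x in Ω, f x)) := by
  have hm := D.isOpen.measurableSet
  refine tendsto_integral_of_dominated_convergence (fun _ => M)
    (fun j => (hF j).aestronglyMeasurable hm) ?_
    (fun j => (ae_restrict_iff' hm).2 (ae_of_all _ (hM j)))
    ((ae_restrict_iff' hm).2 (ae_of_all _ fun x hx => tendsto_nhds_of_eventually_eq (hlim x hx)))
  exact integrableOn_const D.volume_lt_top.ne

/-- Weighted Sobolev inequality on a smooth bounded domain, with the distance to the boundary
(through a defining function) as a weight. -/
theorem RegularDefiningFun.exists_weighted_sobolev (D : RegularDefiningFun Ω φ) (hn : 1 ≤ n)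
    {p : ℝ} (hp : 1 < p) (hpn : n ≤ 2 ∨ p ≤ ((n : ℝ) + 2) / ((n : ℝ) - 2)) :
    ∃ C, 0 < C ∧ ∀ f : EuclideanSpace ℝ (Fin n) → ℝ, ContDiffOn ℝ 1 f Ω →
      ∀ M, (∀ x ∈ Ω, |f x| ≤ M) → (∀ i, ∀ x ∈ Ω, φ x * |pderiv' i f x| ≤ M) →
      (∫ x in Ω, |φ x * f x| ^ (p + 1)) ^ (2 / (p + 1)) ≤
        C * ∫ x in Ω, (φ x ^ 2 * gradSq f x + φ x ^ (p + 1) * f x ^ 2) := by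
  obtain ⟨C, hC, h⟩ := D.exists_weighted_sobolev_compact hn hp hpn
  refine ⟨C, hC, fun f hf M hM hM' => ?_⟩
  obtain ⟨L, hL, hLb⟩ := D.bound_closure D.smooth.continuous
  obtain ⟨K, hK, hKb⟩ := D.exists_bound_pderiv'_cutoff
  have hM0 : 0 ≤ M := by
    obtain ⟨x, hx⟩ := D.nonempty
    exact (abs_nonneg _).trans (hM x hx)
  set g : ℕ → EuclideanSpace ℝ (Fin n) → ℝ := fun j x => cutoff φ j x * f x with hg
  have hg1 : ∀ j, ContDiff ℝ 1 (g j) := fun j => D.contDiff_cutoff_mul hf j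
  have hφc := D.smooth.continuous
  have hφp : Continuous fun x => φ x ^ (p + 1) := hφc.rpow_const fun _ => Or.inr (by linarith)
  have hgb : ∀ j, ∀ x ∈ Ω, |g j x| ≤ M := by
    intro j x hx
    simp only [hg, abs_mul, abs_of_nonneg (cutoff_mem_Icc φ j x).1]
    calc cutoff φ j x * |f x| ≤ 1 * |f x| :=
          mul_le_mul_of_nonneg_right (cutoff_mem_Icc φ j x).2 (abs_nonneg _)
      _ ≤ M := by rw [one_mul]; exact hM x hx
  have hgp : ∀ j i, ∀ x ∈ Ω,
      pderiv' i (g j) x = cutoff φ j x * pderiv' i f x + pderiv' i (cutoff φ j) x * f x := by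
    intro j i x hx
    exact pderiv'_mul ((D.contDiff_cutoff j).differentiable (by simp) x)
      (ContDiffOn.differentiableAt_mem D.isOpen (m := 1) hf le_rfl hx) i
  have hgdb : ∀ j i, ∀ x ∈ Ω, φ x * |pderiv' i (g j) x| ≤ M + K * M := by
    intro j i x hx
    have hpos := (D.mem_iff x).1 hx
    have h1 : |cutoff φ j x * pderiv' i f x| ≤ |pderiv' i f x| := by
      rw [abs_mul, abs_of_nonneg (cutoff_mem_Icc φ j x).1]
      exact mul_le_of_le_one_left (abs_nonneg _) (cutoff_mem_Icc φ j x).2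
    rw [hgp j i x hx]
    calc _ ≤ φ x * (|pderiv' i f x| + |pderiv' i (cutoff φ j) x| * |f x|) := by
          refine mul_le_mul_of_nonneg_left ((abs_add_le _ _).trans ?_) hpos.le
          rw [abs_mul (pderiv' i (cutoff φ j) x)]
          linarith
      _ = φ x * |pderiv' i f x| + (φ x * |pderiv' i (cutoff φ j) x|) * |f x| := by ring
      _ ≤ M + K * M := add_le_add (hM' i x hx)
          (mul_le_mul (hKb j i x hx) (hM x hx) (abs_nonneg _) hK.le)
  have hL' : ∀ x ∈ Ω, φ x ≤ L := fun x hx => (le_abs_self _).trans (hLb x (subset_closure hx))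
  have hlim1 : Tendsto (fun j => ∫ x in Ω, |φ x * g j x| ^ (p + 1)) atTop
      (𝓝 (∫ x in Ω, |φ x * f x| ^ (p + 1))) := by
    refine D.tendsto_setIntegral (M := (L * M) ^ (p + 1)) (fun j => ?_) (fun j x hx => ?_)
      (fun x hx => ?_)
    · exact ((hφc.mul (hg1 j).continuous).abs.rpow_const
        fun _ => Or.inr (by linarith)).continuousOn
    · have hpos := (D.mem_iff x).1 hx
      rw [abs_of_nonneg (by positivity)]
      refine Real.rpow_le_rpow (abs_nonneg _) ?_ (by linarith)
      rw [abs_mul, abs_of_pos hpos]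
      exact mul_le_mul (hL' x hx) (hgb j x hx) (abs_nonneg _) hL.le
    · filter_upwards [D.tendsto_cutoff hx] with j hj
      simp [hg, hj]
  have hlim2 : Tendsto (fun j => ∫ x in Ω, (φ x ^ 2 * gradSq (g j) x + φ x ^ (p + 1) * g j x ^ 2))
      atTop (𝓝 (∫ x in Ω, (φ x ^ 2 * gradSq f x + φ x ^ (p + 1) * f x ^ 2))) := by
    refine D.tendsto_setIntegral (M := n * (M + K * M) ^ 2 + L ^ (p + 1) * M ^ 2) (fun j => ?_)
      (fun j x hx => ?_) (fun x hx => ?_)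
    · exact (((hφc.pow 2).mul (continuous_gradSq (hg1 j))).add
        (hφp.mul ((hg1 j).continuous.pow 2))).continuousOn
    · have hpos := (D.mem_iff x).1 hx
      have h0 := gradSq_nonneg (g j) x
      rw [abs_of_nonneg (by positivity)]
      refine add_le_add ?_ ?_
      · rw [gradSq, Finset.mul_sum]
        calc _ ≤ ∑ _i : Fin n, (M + K * M) ^ 2 := by
              refine Finset.sum_le_sum fun i _ => ?_
              rw [← mul_pow, ← sq_abs, abs_mul, abs_of_pos hpos]
              exact pow_le_pow_left₀ (by positivity) (hgdb j i x hx) 2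
          _ = _ := by simp
      · refine mul_le_mul (Real.rpow_le_rpow hpos.le (hL' x hx) (by linarith)) ?_ (sq_nonneg _)
          (by positivity)
        rw [← sq_abs]
        exact pow_le_pow_left₀ (abs_nonneg _) (hgb j x hx) 2
    · have h1 : ∀ᶠ j in atTop, ∀ i, pderiv' i (cutoff φ j) x = 0 :=
        eventually_all.2 fun i => D.tendsto_pderiv'_cutoff hx i
      filter_upwards [D.tendsto_cutoff hx, h1] with j hj hj'
      have e1 : gradSq (g j) x = gradSq f x := by
        refine Finset.sum_congr rfl fun i _ => ?_
        rw [hgp j i x hx, hj, hj' i]; ring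
      have e2 : g j x = f x := by simp [hg, hj]
      rw [e1, e2]
  refine le_of_tendsto_of_tendsto' (hlim1.rpow_const (Or.inr (by positivity)))
    (hlim2.const_mul C) fun j => ?_
  have hts : tsupport (g j) ⊆ tsupport (cutoff φ j) := tsupport_mul_subset_left
  exact h (g j) (hg1 j) ((D.hasCompactSupport_cutoff j).mul_right)
    (hts.trans (D.tsupport_cutoff_subset' j))

end Sobolev

section Regularity

variable {n : ℕ} {Ω : Set (EuclideanSpace ℝ (Fin n))} {φ : EuclideanSpace ℝ (Fin n) → ℝ} {T : ℝ}

lemma ExtendsCont.continuousOn {f : EuclideanSpace ℝ (Fin n) → ℝ → ℝ} (h : ExtendsCont Ω T f) :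
    ContinuousOn (fun z : EuclideanSpace ℝ (Fin n) × ℝ => f z.1 z.2) (Ω ×ˢ Icc 0 T) := by
  obtain ⟨g, hg, hgf⟩ := h
  exact (hg.mono (prod_mono subset_closure Subset.rfl)).congr
    fun z hz => (hgf z.1 hz.1 z.2 hz.2).symm

lemma ExtendsCont.bounded {f : EuclideanSpace ℝ (Fin n) → ℝ → ℝ} (h : ExtendsCont Ω T f)
    (hb : Bornology.IsBounded Ω) : ∃ M, ∀ x ∈ Ω, ∀ t ∈ Icc 0 T, |f x t| ≤ M := by
  obtain ⟨g, hg, hgf⟩ := h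
  obtain ⟨M, hM⟩ := (hb.isCompact_closure.prod isCompact_Icc).exists_bound_of_continuousOn hg
  refine ⟨M, fun x hx t ht => ?_⟩
  rw [← hgf x hx t ht]
  exact hM (x, t) ⟨subset_closure hx, ht⟩

lemma hasDerivAt_line {f : EuclideanSpace ℝ (Fin n) → ℝ} {x : EuclideanSpace ℝ (Fin n)} {i : Fin n}
    {τ : ℝ} (hf : DifferentiableAt ℝ f (x + τ • EuclideanSpace.single i 1)) :
    HasDerivAt (fun τ : ℝ => f (x + τ • EuclideanSpace.single i 1))
      (pderiv' i f (x + τ • EuclideanSpace.single i 1)) τ := by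
  have h1 : HasDerivAt (fun τ : ℝ => x + τ • EuclideanSpace.single i (1 : ℝ))
      (EuclideanSpace.single i 1) τ := by
    simpa using ((hasDerivAt_id τ).smul_const (EuclideanSpace.single i (1 : ℝ))).const_add x
  exact hf.hasFDerivAt.comp_hasDerivAt τ h1

lemma hasDerivWithinAt_integral_Icc {f : ℝ → ℝ} (hT : 0 ≤ T) (hf : ContinuousOn f (Icc 0 T)) {t : ℝ}
    (ht : t ∈ Icc 0 T) :
    HasDerivWithinAt (fun t => ∫ s in (0:ℝ)..t, f s) (f t) (Icc 0 T) t := by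
  have hc : Continuous (IccExtend hT ((Icc 0 T).domRestrict f)) := hf.domRestrict.Icc_extend'
  have h1 := (intervalIntegral.integral_hasDerivAt_right (hc.intervalIntegrable 0 t)
    hc.stronglyMeasurable.stronglyMeasurableAtFilter hc.continuousAt).hasDerivWithinAt (s := Icc 0 T)
  have e : ∀ s ∈ Icc 0 T, IccExtend hT ((Icc 0 T).domRestrict f) s = f s := fun s hs => by
    rw [IccExtend_of_mem hT _ hs]; rfl
  rw [e t ht] at h1
  refine h1.congr_of_mem (fun s hs => intervalIntegral.integral_congr fun r hr => ?_) ht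
  rw [uIcc_of_le hs.1] at hr
  exact (e r ⟨hr.1, hr.2.trans hs.2⟩).symm

/-- Commuting a time derivative with a space derivative. -/
lemma hasDerivWithinAt_pderiv' (hΩ : IsOpen Ω) (hT : 0 ≤ T)
    {a b : EuclideanSpace ℝ (Fin n) → ℝ → ℝ}
    (hab : ∀ x ∈ Ω, ∀ t ∈ Icc 0 T, HasDerivWithinAt (a x) (b x t) (Icc 0 T) t)
    (ha : ∀ t ∈ Icc 0 T, ∀ x ∈ Ω, DifferentiableAt ℝ (fun y => a y t) x)
    (hb : ∀ t ∈ Icc 0 T, ∀ x ∈ Ω, DifferentiableAt ℝ (fun y => b y t) x)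
    (hbc : ∀ x ∈ Ω, ContinuousOn (b x) (Icc 0 T)) {i : Fin n}
    (hdb : ContinuousOn (fun z : EuclideanSpace ℝ (Fin n) × ℝ => pderiv' i (fun y => b y z.2) z.1)
      (Ω ×ˢ Icc 0 T)) {x : EuclideanSpace ℝ (Fin n)} (hx : x ∈ Ω) {t : ℝ} (ht : t ∈ Icc 0 T) :
    HasDerivWithinAt (fun s => pderiv' i (fun y => a y s) x) (pderiv' i (fun y => b y t) x)
      (Icc 0 T) t := by
  have h0 : (0:ℝ) ∈ Icc 0 T := left_mem_Icc.2 hT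
  set e : EuclideanSpace ℝ (Fin n) := EuclideanSpace.single i 1 with he
  have hline : Continuous fun τ : ℝ => x + τ • e := by fun_prop
  obtain ⟨ε, hε, hball⟩ : ∃ ε > 0, ∀ τ ∈ Metric.closedBall (0:ℝ) ε, x + τ • e ∈ Ω := by
    have : (fun τ : ℝ => x + τ • e) ⁻¹' Ω ∈ 𝓝 (0:ℝ) :=
      hline.continuousAt.preimage_mem_nhds (hΩ.mem_nhds (by simpa using hx))
    exact Metric.nhds_basis_closedBall.mem_iff.1 this
  have hcK : ContinuousOn (fun z : ℝ × ℝ => pderiv' i (fun y => b y z.2) (x + z.1 • e))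
      (Metric.closedBall (0:ℝ) ε ×ˢ Icc 0 T) := by
    refine hdb.comp (f := fun z : ℝ × ℝ => (x + z.1 • e, z.2)) ?_ fun z hz => ⟨hball _ hz.1, hz.2⟩
    exact Continuous.continuousOn (by fun_prop)
  obtain ⟨M, hM⟩ := ((isCompact_closedBall (0:ℝ) ε).prod isCompact_Icc).exists_bound_of_continuousOn
    hcK
  have hftc : ∀ y ∈ Ω, ∀ s ∈ Icc 0 T, a y s = a y 0 + ∫ r in (0:ℝ)..s, b y r := by
    intro y hy s hs
    have := intervalIntegral.integral_eq_sub_of_hasDeriv_right_of_le (a := 0) (b := s) (f := a y)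
      (f' := b y) hs.1
      (fun r hr => (hab y hy r ⟨hr.1, hr.2.trans hs.2⟩).continuousWithinAt.mono
        (Icc_subset_Icc_right hs.2))
      (fun r hr => ((hab y hy r ⟨hr.1.le, hr.2.le.trans hs.2⟩).hasDerivAt
        (Icc_mem_nhds hr.1 (hr.2.trans_le hs.2))).hasDerivWithinAt)
      (ContinuousOn.intervalIntegrable_of_Icc hs.1 ((hbc y hy).mono (Icc_subset_Icc_right hs.2)))
    linarith
  have hkey : ∀ s ∈ Icc 0 T, pderiv' i (fun y => a y s) x =
      pderiv' i (fun y => a y 0) x + ∫ r in (0:ℝ)..s, pderiv' i (fun y => b y r) x := by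
    intro s hs
    have hsub : ∀ r ∈ uIoc 0 s, r ∈ Icc 0 T := fun r hr => by
      rw [uIoc_of_le hs.1] at hr; exact ⟨hr.1.le, hr.2.trans hs.2⟩
    have hii : ∀ y ∈ Ω, IntervalIntegrable (b y) volume 0 s := fun y hy =>
      ContinuousOn.intervalIntegrable_of_Icc hs.1 ((hbc y hy).mono (Icc_subset_Icc_right hs.2))
    have hx0 : x + (0:ℝ) • e = x := by simp
    have hdbx : ContinuousOn (fun r => pderiv' i (fun y => b y r) x) (Icc 0 T) :=
      hdb.comp (f := fun r => (x, r)) (by fun_prop) fun r hr => ⟨hx, hr⟩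
    have h1 := (intervalIntegral.hasDerivAt_integral_of_dominated_loc_of_deriv_le (μ := volume)
      (a := 0) (b := s)
      (F := fun τ r => b (x + τ • e) r) (F' := fun τ r => pderiv' i (fun y => b y r) (x + τ • e))
      (x₀ := 0) (bound := fun _ => M) (Metric.ball_mem_nhds (0:ℝ) hε)
      (by
        filter_upwards [Metric.ball_mem_nhds (0:ℝ) hε] with τ hτ
        exact (hii _ (hball τ (Metric.ball_subset_closedBall hτ))).def'.aestronglyMeasurable)
      (by rw [hx0]; exact hii x hx)
      (by
        rw [hx0]
        exact (ContinuousOn.intervalIntegrable_of_Icc hs.1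
          (hdbx.mono (Icc_subset_Icc_right hs.2))).def'.aestronglyMeasurable)
      (ae_of_all _ fun r hr τ hτ => hM (τ, r) ⟨Metric.ball_subset_closedBall hτ, hsub r hr⟩)
      intervalIntegrable_const
      (ae_of_all _ fun r hr τ hτ => hasDerivAt_line
        (hb r (hsub r hr) _ (hball τ (Metric.ball_subset_closedBall hτ))))).2
    rw [hx0] at h1
    have h2 : HasDerivAt (fun τ : ℝ => a (x + τ • e) s) (pderiv' i (fun y => a y s) x) 0 := by
      have := hasDerivAt_line (f := fun y => a y s) (x := x) (i := i) (τ := 0)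
        (by rw [← he, hx0]; exact ha s hs x hx)
      rwa [← he, hx0] at this
    have h3 : HasDerivAt (fun τ : ℝ => a (x + τ • e) 0) (pderiv' i (fun y => a y 0) x) 0 := by
      have := hasDerivAt_line (f := fun y => a y 0) (x := x) (i := i) (τ := 0)
        (by rw [← he, hx0]; exact ha 0 h0 x hx)
      rwa [← he, hx0] at this
    refine h2.unique ((h3.add h1).congr_of_eventuallyEq ?_)
    filter_upwards [Metric.ball_mem_nhds (0:ℝ) hε] with τ hτ
    exact hftc _ (hball τ (Metric.ball_subset_closedBall hτ)) s hs
  have hdbx : ContinuousOn (fun r => pderiv' i (fun y => b y r) x) (Icc 0 T) :=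
    hdb.comp (f := fun r => (x, r)) (by fun_prop) fun r hr => ⟨hx, hr⟩
  refine ((hasDerivWithinAt_integral_Icc hT hdbx ht).const_add
    (pderiv' i (fun y => a y 0) x)).congr_of_mem (fun s hs => hkey s hs) ht

/-- The regularity, bounds and equations satisfied by a solution `u`, with `v = ∂ₜ u` and
`w = ∂ₜ² u`; the constant `M` depends on the solution. -/
structure FDSolution (Ω : Set (EuclideanSpace ℝ (Fin n))) (φ : EuclideanSpace ℝ (Fin n) → ℝ)
    (p b T M : ℝ) (u v w : EuclideanSpace ℝ (Fin n) → ℝ → ℝ) : Prop where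
  one_lt : 1 < p
  T_pos : 0 < T
  M_pos : 0 < M
  u_smooth : ∀ t ∈ Icc 0 T, ContDiffOn ℝ 2 (fun x => u x t) Ω
  v_smooth : ∀ t ∈ Icc 0 T, ContDiffOn ℝ 2 (fun x => v x t) Ω
  w_cont : ∀ t ∈ Icc 0 T, ContinuousOn (fun x => w x t) Ω
  u_deriv : ∀ x ∈ Ω, ∀ t ∈ Icc 0 T, HasDerivWithinAt (u x) (v x t) (Icc 0 T) t
  v_deriv : ∀ x ∈ Ω, ∀ t ∈ Icc 0 T, HasDerivWithinAt (v x) (w x t) (Icc 0 T) t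
  w_contT : ∀ x ∈ Ω, ContinuousOn (w x) (Icc 0 T)
  dv_contT : ∀ i, ∀ x ∈ Ω, ContinuousOn (fun t => pderiv' i (fun y => v y t) x) (Icc 0 T)
  lapv_contT : ∀ x ∈ Ω, ContinuousOn (fun t => lap (fun y => v y t) x) (Icc 0 T)
  u_pos : ∀ x ∈ Ω, ∀ t ∈ Icc 0 T, 0 < u x t
  v_bound : ∀ x ∈ Ω, ∀ t ∈ Icc 0 T, |v x t| ≤ M * φ x
  w_bound : ∀ x ∈ Ω, ∀ t ∈ Icc 0 T, |w x t| ≤ M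
  du_bound : ∀ i, ∀ x ∈ Ω, ∀ t ∈ Icc 0 T, |pderiv' i (fun y => u y t) x| ≤ M
  dv_bound : ∀ i, ∀ x ∈ Ω, ∀ t ∈ Icc 0 T, |pderiv' i (fun y => v y t) x| ≤ M
  lapu_bound : ∀ x ∈ Ω, ∀ t ∈ Icc 0 T, |lap (fun y => u y t) x| ≤ M
  lapv_bound : ∀ x ∈ Ω, ∀ t ∈ Icc 0 T, |lap (fun y => v y t) x| ≤ M
  pde : ∀ x ∈ Ω, ∀ t ∈ Ioc 0 T, p * u x t ^ (p - 1) * v x t =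
    lap (fun y => u y t) x + b * u x t + u x t ^ p
  pde_deriv : ∀ x ∈ Ω, ∀ t ∈ Ioo 0 T,
    p * u x t ^ (p - 1) * w x t + p * (p - 1) * u x t ^ (p - 2) * v x t ^ 2 =
    lap (fun y => v y t) x + b * v x t + p * u x t ^ (p - 1) * v x t

end Regularity

section Regularity

variable {n : ℕ} {Ω : Set (EuclideanSpace ℝ (Fin n))} {φ : EuclideanSpace ℝ (Fin n) → ℝ}
  {p b T c₀ : ℝ} {u v w : EuclideanSpace ℝ (Fin n) → ℝ → ℝ}

/-- The time derivative of a function vanishing on the boundary vanishes on the boundary. -/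
lemma time_deriv_eq_zero_of_frontier (hT : 0 < T)
    (hu : ContinuousOn (fun z : EuclideanSpace ℝ (Fin n) × ℝ => u z.1 z.2) (closure Ω ×ˢ Icc 0 T))
    (hv : ContinuousOn (fun z : EuclideanSpace ℝ (Fin n) × ℝ => v z.1 z.2) (closure Ω ×ˢ Icc 0 T))
    (hd : ∀ x ∈ Ω, ∀ t ∈ Icc 0 T, HasDerivWithinAt (u x) (v x t) (Icc 0 T) t)
    {y : EuclideanSpace ℝ (Fin n)} (hy : y ∈ closure Ω) (h0 : ∀ t ∈ Icc 0 T, u y t = 0)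
    {t : ℝ} (ht : t ∈ Icc 0 T) : v y t = 0 := by
  by_contra hne
  have hε : 0 < |v y t| / 2 := by positivity
  obtain ⟨δ, hδ, hδb⟩ := Metric.continuousWithinAt_iff.1 (hv (y, t) ⟨hy, ht⟩) _ hε
  obtain ⟨s₁, s₂, hs, hs1, hs2, hsd⟩ : ∃ s₁ s₂, s₁ < s₂ ∧ s₁ ∈ Icc 0 T ∧ s₂ ∈ Icc 0 T ∧
      ∀ s ∈ Icc s₁ s₂, |s - t| < δ := by
    rcases lt_or_ge t T with h | h
    · refine ⟨t, min T (t + δ / 2), lt_min h (by linarith), ht,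
        ⟨le_min hT.le (by linarith [ht.1]), min_le_left _ _⟩, fun s hs => ?_⟩
      rw [abs_lt]
      have := hs.2.trans (min_le_right _ _)
      constructor <;> linarith [hs.1]
    · have h' : t = T := le_antisymm ht.2 h
      refine ⟨max 0 (t - δ / 2), t, max_lt (by linarith) (by linarith),
        ⟨le_max_left _ _, max_le hT.le (by linarith [ht.2])⟩, ht, fun s hs => ?_⟩
      rw [abs_lt]
      have := (le_max_right _ _).trans hs.1
      constructor <;> linarith [hs.2]
  have hsub : Icc s₁ s₂ ⊆ Icc 0 T := Icc_subset_Icc hs1.1 hs2.2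
  have hnear : ∀ x ∈ Ω, dist x y < δ → |u x s₂ - u x s₁ - v y t * (s₂ - s₁)|
      ≤ |v y t| / 2 * (s₂ - s₁) := by
    intro x hx hxy
    have := (convex_Icc s₁ s₂).norm_image_sub_le_of_norm_hasDerivWithin_le
      (f := fun s => u x s - v y t * s) (f' := fun s => v x s - v y t) (C := |v y t| / 2)
      (fun s hs' => by
        have h1 := (hd x hx s (hsub hs')).mono hsub
        simpa using h1.fun_sub ((hasDerivWithinAt_id s (Icc s₁ s₂)).const_mul (v y t)))
      (fun s hs' => by
        have := hδb (x := (x, s)) ⟨subset_closure hx, hsub hs'⟩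
          (by rw [Prod.dist_eq]; exact max_lt hxy (hsd s hs'))
        exact this.le)
      (left_mem_Icc.2 hs.le) (right_mem_Icc.2 hs.le)
    rw [Real.norm_eq_abs, Real.norm_eq_abs, abs_of_pos (by linarith : 0 < s₂ - s₁)] at this
    convert this using 2
    ring
  have hlim : ∀ s ∈ Icc 0 T, Tendsto (fun x => u x s) (𝓝[Ω] y) (𝓝 0) := by
    intro s hs'
    have h1 : ContinuousWithinAt (fun x => u x s) (closure Ω) y :=
      (hu.comp (f := fun x => (x, s)) (by fun_prop) fun x hx => ⟨hx, hs'⟩) y hy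
    have := (h1.mono subset_closure).tendsto
    rwa [h0 s hs'] at this
  have hneb : (𝓝[Ω] y).NeBot := mem_closure_iff_nhdsWithin_neBot.1 hy
  have h2 : Tendsto (fun x => |u x s₂ - u x s₁ - v y t * (s₂ - s₁)|) (𝓝[Ω] y)
      (𝓝 |0 - 0 - v y t * (s₂ - s₁)|) :=
    (((hlim s₂ hs2).sub (hlim s₁ hs1)).sub_const _).abs
  have h3 := le_of_tendsto h2 (b := |v y t| / 2 * (s₂ - s₁)) (by
    filter_upwards [self_mem_nhdsWithin, mem_nhdsWithin_of_mem_nhds (Metric.ball_mem_nhds y hδ)]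
      with x hx hx'
    exact hnear x hx hx')
  rw [sub_zero, zero_sub, abs_neg, abs_mul, abs_of_pos (by linarith : 0 < s₂ - s₁)] at h3
  have : 0 < |v y t| * (s₂ - s₁) := mul_pos (by positivity) (by linarith)
  linarith

lemma RegularDefiningFun.abs_le_mul_dB (D : RegularDefiningFun Ω φ) (hn : 1 ≤ n)
    {f : EuclideanSpace ℝ (Fin n) → ℝ} (hf : ContinuousOn f (closure Ω))
    (hd : ∀ x ∈ Ω, DifferentiableAt ℝ f x) {K : ℝ} (hK : ∀ x ∈ Ω, ‖fderiv ℝ f x‖ ≤ K)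
    (h0 : ∀ x ∈ frontier Ω, f x = 0) {x : EuclideanSpace ℝ (Fin n)} (hx : x ∈ Ω) :
    |f x| ≤ K * dB Ω x := by
  obtain ⟨y, hy, hxy⟩ := D.exists_dist_eq_dB hn x
  have hline : ∀ s : ℝ, HasDerivAt (fun s : ℝ => x + s • (y - x)) (y - x) s := fun s => by
    simpa using ((hasDerivAt_id s).smul_const (y - x)).const_add x
  have hpos : 0 < dist x y := dist_pos.2 fun h => by
    rw [D.isOpen.frontier_eq] at hy; exact hy.2 (h ▸ hx)
  have hmem : ∀ s ∈ Ico (0:ℝ) 1, x + s • (y - x) ∈ Ω := by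
    intro s hs
    refine D.ball_dB_subset hx ?_
    rw [Metric.mem_ball, hxy, dist_eq_norm, add_sub_cancel_left, norm_smul, Real.norm_eq_abs,
      abs_of_nonneg hs.1, ← dist_eq_norm, dist_comm y x]
    nlinarith [hs.2]
  have h1 : x + (1:ℝ) • (y - x) = y := by simp
  have hmemc : ∀ s ∈ Icc (0:ℝ) 1, x + s • (y - x) ∈ closure Ω := by
    intro s hs
    rcases hs.2.lt_or_eq with h | h
    · exact subset_closure (hmem s ⟨hs.1, h⟩)
    · rw [h, h1]; exact frontier_subset_closure hy
  have := norm_image_sub_le_of_norm_deriv_right_le_segment (a := 0) (b := 1)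
    (f := fun s : ℝ => f (x + s • (y - x)))
    (f' := fun s => fderiv ℝ f (x + s • (y - x)) (y - x)) (C := K * ‖y - x‖)
    (hf.comp (f := fun s : ℝ => x + s • (y - x)) (by fun_prop) hmemc)
    (fun s hs => ((hd _ (hmem s hs)).hasFDerivAt.comp_hasDerivAt s (hline s)).hasDerivWithinAt)
    (fun s hs => (ContinuousLinearMap.le_opNorm _ _).trans
      (mul_le_mul_of_nonneg_right (hK _ (hmem s hs)) (norm_nonneg _)))
    1 (right_mem_Icc.2 zero_le_one)
  simp only [h1, h0 y hy, zero_smul, add_zero, zero_sub, norm_neg, sub_zero, mul_one] at this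
  rwa [← dist_eq_norm, dist_comm, ← hxy] at this

lemma FDSetting.exists_solution (D : RegularDefiningFun Ω φ) (hn : 1 ≤ n)
    (h : FDSetting Ω p b T c₀ u v w) : ∃ M, FDSolution Ω φ p b T M u v w := by
  obtain ⟨-, hp, -, hT, -, ⟨hu3, hv2, hut, hvt, hucl, hvcl, hwcl, hdu, hddu, -, hdv, hddv⟩, hpos,
    hpde, hbd, -⟩ := h
  have hΩ := D.isOpen
  obtain ⟨K, hK, hKb⟩ := D.exists_dB_le_mul
  choose M1 hM1 using fun i => (hdu i).bounded D.bdd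
  choose M2 hM2 using fun i => (hdv i).bounded D.bdd
  choose M3 hM3 using fun i => (hddu i i).bounded D.bdd
  choose M4 hM4 using fun i => (hddv i i).bounded D.bdd
  have hwE : ExtendsCont Ω T w := ⟨w, hwcl, fun _ _ _ _ => rfl⟩
  obtain ⟨M5, hM5⟩ := hwE.bounded D.bdd
  have hcx : ∀ {f : EuclideanSpace ℝ (Fin n) → ℝ → ℝ}, ExtendsCont Ω T f → ∀ x ∈ Ω,
      ContinuousOn (f x) (Icc 0 T) := fun hf x hx =>
    hf.continuousOn.comp (f := fun t => (x, t)) (by fun_prop) fun t ht => ⟨hx, ht⟩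
  have hct : ∀ {f : EuclideanSpace ℝ (Fin n) → ℝ → ℝ}, ExtendsCont Ω T f → ∀ t ∈ Icc 0 T,
      ContinuousOn (fun x => f x t) Ω := fun hf t ht =>
    hf.continuousOn.comp (f := fun x => (x, t)) (by fun_prop) fun x hx => ⟨hx, ht⟩
  set S : ℝ := ∑ i, |M2 i| with hS
  have hS0 : 0 ≤ S := Finset.sum_nonneg fun i _ => abs_nonneg _
  have hudiff : ∀ t ∈ Icc 0 T, ∀ x ∈ Ω, DifferentiableAt ℝ (fun y => u y t) x := fun t ht x hx =>
    ContDiffOn.differentiableAt_mem hΩ (m := 3) (hu3 t ht) (by norm_num) hx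
  have hvdiff : ∀ t ∈ Icc 0 T, ∀ x ∈ Ω, DifferentiableAt ℝ (fun y => v y t) x := fun t ht x hx =>
    ContDiffOn.differentiableAt_mem hΩ (m := 2) (hv2 t ht) (by norm_num) hx
  have hvM : ∀ x ∈ Ω, ∀ t ∈ Icc 0 T, |v x t| ≤ S * K * φ x := by
    intro x hx t ht
    have := D.abs_le_mul_dB hn (f := fun y => v y t) (K := S)
      (hvcl.comp (f := fun x => (x, t)) (by fun_prop) fun x hx => ⟨hx, ht⟩)
      (hvdiff t ht) (fun y hy => (norm_fderiv_le_sum _ _).trans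
        (Finset.sum_le_sum fun i _ => (hM2 i y hy t ht).trans (le_abs_self _)))
      (fun y hy => time_deriv_eq_zero_of_frontier hT hucl hvcl hut (frontier_subset_closure hy)
        (hbd y hy) ht) hx
    exact this.trans (by rw [mul_assoc]; exact mul_le_mul_of_nonneg_left (hKb x hx) hS0)
  have hdt : ∀ i, ∀ x ∈ Ω, ∀ t ∈ Icc 0 T, HasDerivWithinAt (fun s => pderiv' i (fun y => u y s) x)
      (pderiv' i (fun y => v y t) x) (Icc 0 T) t := fun i x hx t ht =>
    hasDerivWithinAt_pderiv' hΩ hT.le hut hudiff hvdiff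
      (fun x hx t ht => (hvt x hx t ht).continuousWithinAt) (hdv i).continuousOn hx ht
  have hddt : ∀ i, ∀ x ∈ Ω, ∀ t ∈ Icc 0 T,
      HasDerivWithinAt (fun s => pderiv' i (pderiv' i (fun y => u y s)) x)
      (pderiv' i (pderiv' i fun y => v y t) x) (Icc 0 T) t := fun i x hx t ht =>
    hasDerivWithinAt_pderiv' (a := fun x t => pderiv' i (fun y => u y t) x)
      (b := fun x t => pderiv' i (fun y => v y t) x) hΩ hT.le (hdt i)
      (fun t ht x hx => ContDiffOn.differentiableAt_mem hΩ (m := 2)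
        (ContDiffOn.pderiv' hΩ (m := 3) (hu3 t ht) (by norm_num) i) (by norm_num) hx)
      (fun t ht x hx => ContDiffOn.differentiableAt_mem hΩ (m := 1)
        (ContDiffOn.pderiv' hΩ (m := 2) (hv2 t ht) (by norm_num) i) (by norm_num) hx)
      (hcx (hdv i)) (hddv i i).continuousOn hx ht
  have hlapt : ∀ x ∈ Ω, ∀ t ∈ Icc 0 T, HasDerivWithinAt (fun s => lap (fun y => u y s) x)
      (lap (fun y => v y t) x) (Icc 0 T) t := fun x hx t ht =>
    HasDerivWithinAt.fun_sum fun i _ => hddt i x hx t ht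
  have hup : ∀ x ∈ Ω, ∀ t ∈ Icc 0 T, ∀ q : ℝ, HasDerivWithinAt (fun s => u x s ^ q)
      (q * u x t ^ (q - 1) * v x t) (Icc 0 T) t := fun x hx t ht q => by
    have := (hut x hx t ht).rpow_const (p := q) (Or.inl (hpos x hx t ht).ne')
    convert this using 1
    ring
  have hpde0 : ∀ x ∈ Ω, ∀ t ∈ Ioc 0 T, p * u x t ^ (p - 1) * v x t =
      lap (fun y => u y t) x + b * u x t + u x t ^ p := fun x hx t ht =>
    (uniqueDiffOn_Icc hT t ⟨ht.1.le, ht.2⟩).eq_deriv _ (hup x hx t ⟨ht.1.le, ht.2⟩ p) (hpde x hx t ht)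
  set M : ℝ := S * K + |M5| + (∑ i, |M1 i|) + (∑ i, |M2 i|) + (∑ i, |M3 i|) + (∑ i, |M4 i|) + 1
    with hM
  have n1 : 0 ≤ ∑ i, |M1 i| := Finset.sum_nonneg fun i _ => abs_nonneg _
  have n3 : 0 ≤ ∑ i, |M3 i| := Finset.sum_nonneg fun i _ => abs_nonneg _
  have n4 : 0 ≤ ∑ i, |M4 i| := Finset.sum_nonneg fun i _ => abs_nonneg _
  have n5 := abs_nonneg M5
  have n6 : 0 ≤ S * K := by positivity
  have l1 : ∀ (N : Fin n → ℝ) i, |N i| ≤ ∑ i, |N i| := fun N i =>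
    Finset.single_le_sum (f := fun i => |N i|) (fun i _ => abs_nonneg _) (Finset.mem_univ i)
  have l2 : ∀ (N : Fin n → ℝ) (f : EuclideanSpace ℝ (Fin n) → ℝ) x,
      (∀ i, |pderiv' i (pderiv' i f) x| ≤ N i) → |lap f x| ≤ ∑ i, |N i| := fun N f x hN =>
    (Finset.abs_sum_le_sum_abs _ _).trans
      (Finset.sum_le_sum fun i _ => (hN i).trans (le_abs_self _))
  refine ⟨M, hp, hT, by positivity, fun t ht => (hu3 t ht).of_le (by norm_num), hv2, hct hwE, hut,
    hvt, hcx hwE, fun i => hcx (hdv i), fun x hx => ?_, hpos,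
    fun x hx t ht => (hvM x hx t ht).trans (mul_le_mul_of_nonneg_right (by linarith)
      ((D.mem_iff x).1 hx).le), fun x hx t ht => (hM5 x hx t ht).trans ?_,
    fun i x hx t ht => (hM1 i x hx t ht).trans ?_, fun i x hx t ht => (hM2 i x hx t ht).trans ?_,
    fun x hx t ht => (l2 M3 _ x fun i => hM3 i x hx t ht).trans (by linarith),
    fun x hx t ht => (l2 M4 _ x fun i => hM4 i x hx t ht).trans (by linarith), hpde0, ?_⟩
  · exact continuousOn_finsetSum _ fun i _ => hcx (hddv i i) x hx
  · linarith [le_abs_self M5]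
  · linarith [le_abs_self (M1 i), l1 M1 i]
  · linarith [le_abs_self (M2 i), l1 M2 i]
  · intro x hx t ht
    have htI : t ∈ Icc 0 T := ⟨ht.1.le, ht.2.le⟩
    have hn' := Icc_mem_nhds ht.1 ht.2
    have e1 : HasDerivAt (fun s => p * u x s ^ (p - 1) * v x s)
        (p * ((p - 1) * u x t ^ (p - 1 - 1) * v x t) * v x t + p * u x t ^ (p - 1) * w x t) t :=
      (((hup x hx t htI (p - 1)).hasDerivAt hn').const_mul p).mul ((hvt x hx t htI).hasDerivAt hn')
    have e2 : HasDerivAt (fun s => lap (fun y => u y s) x + b * u x s + u x s ^ p)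
        (lap (fun y => v y t) x + b * v x t + p * u x t ^ (p - 1) * v x t) t :=
      (((hlapt x hx t htI).hasDerivAt hn').add (((hut x hx t htI).hasDerivAt hn').const_mul b)).add
        ((hup x hx t htI p).hasDerivAt hn')
    have e3 := e1.unique (e2.congr_of_eventuallyEq (by
      filter_upwards [Ioo_mem_nhds ht.1 ht.2] with s hs
      exact hpde0 x hx s ⟨hs.1, hs.2.le⟩))
    rw [← e3, show p - 1 - 1 = p - 2 by ring]
    ring

end Regularity

section TimeDerivative

variable {n : ℕ} {Ω : Set (EuclideanSpace ℝ (Fin n))} {φ : EuclideanSpace ℝ (Fin n) → ℝ}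

lemma DefiningFun.hasDerivAt_setIntegral (D : DefiningFun Ω φ)
    {ρ ρ' : EuclideanSpace ℝ (Fin n) → ℝ → ℝ} {s e K : ℝ}
    (hρ : ∀ t ∈ Ioo s e, ContinuousOn (fun x => ρ x t) Ω)
    (hρK : ∀ t ∈ Ioo s e, ∀ x ∈ Ω, |ρ x t| ≤ K)
    (hρ' : ∀ t ∈ Ioo s e, ContinuousOn (fun x => ρ' x t) Ω)
    (hρ'K : ∀ t ∈ Ioo s e, ∀ x ∈ Ω, |ρ' x t| ≤ K)
    (hd : ∀ t ∈ Ioo s e, ∀ x ∈ Ω, HasDerivAt (ρ x) (ρ' x t) t) {t : ℝ} (ht : t ∈ Ioo s e) :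
    HasDerivAt (fun t => ∫ x in Ω, ρ x t) (∫ x in Ω, ρ' x t) t := by
  have hm := D.isOpen.measurableSet
  refine (hasDerivAt_integral_of_dominated_loc_of_deriv_le (μ := volume.restrict Ω)
    (F := fun t x => ρ x t) (F' := fun t x => ρ' x t) (bound := fun _ => K)
    (Ioo_mem_nhds ht.1 ht.2) ?_ (D.integrableOn_of_bound (hρ t ht) (hρK t ht))
    ((hρ' t ht).aestronglyMeasurable hm)
    ((ae_restrict_iff' hm).2 (ae_of_all _ fun x hx r hr => hρ'K r hr x hx))
    (integrableOn_const D.volume_lt_top.ne)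
    ((ae_restrict_iff' hm).2 (ae_of_all _ fun x hx r hr => hd r hr x hx))).2
  filter_upwards [Ioo_mem_nhds ht.1 ht.2] with r hr
  exact (hρ r hr).aestronglyMeasurable hm

lemma DefiningFun.continuousOn_setIntegral (D : DefiningFun Ω φ)
    {ρ : EuclideanSpace ℝ (Fin n) → ℝ → ℝ} {I : Set ℝ} {K : ℝ}
    (hρ : ∀ t ∈ I, ContinuousOn (fun x => ρ x t) Ω)
    (hρK : ∀ t ∈ I, ∀ x ∈ Ω, |ρ x t| ≤ K)
    (hc : ∀ x ∈ Ω, ContinuousOn (ρ x) I) :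
    ContinuousOn (fun t => ∫ x in Ω, ρ x t) I := by
  have hm := D.isOpen.measurableSet
  exact continuousOn_of_dominated (F := fun t x => ρ x t) (bound := fun _ => K)
    (fun t ht => (hρ t ht).aestronglyMeasurable hm)
    (fun t ht => (ae_restrict_iff' hm).2 (ae_of_all _ (hρK t ht)))
    (integrableOn_const D.volume_lt_top.ne)
    ((ae_restrict_iff' hm).2 (ae_of_all _ hc))

lemma continuousOn_lap {f : EuclideanSpace ℝ (Fin n) → ℝ} (hΩ : IsOpen Ω)
    (hf : ContDiffOn ℝ 2 f Ω) : ContinuousOn (lap f) Ω :=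
  continuousOn_finsetSum _ fun i _ =>
    (ContDiffOn.pderiv' hΩ (m := 1) (k := 0) (ContDiffOn.pderiv' hΩ (m := 2) hf (by norm_num) i)
      (by norm_num) i).continuousOn

lemma continuousOn_gradSq {f : EuclideanSpace ℝ (Fin n) → ℝ} (hΩ : IsOpen Ω)
    (hf : ContDiffOn ℝ 1 f Ω) : ContinuousOn (gradSq f) Ω :=
  continuousOn_finsetSum _ fun i _ =>
    (ContDiffOn.pderiv' hΩ (m := 1) (k := 0) hf (by norm_num) i).continuousOn.pow 2

/-- Integration by parts for the quotient `h = g / f` of two functions vanishing at the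
boundary. -/
lemma DefiningFun.integral_ratio (D : DefiningFun Ω φ) {f g h : EuclideanSpace ℝ (Fin n) → ℝ}
    (hf : ContDiffOn ℝ 2 f Ω) (hg : ContDiffOn ℝ 2 g Ω) (hh : ContDiffOn ℝ 1 h Ω)
    (hfgh : ∀ x ∈ Ω, g x = h x * f x) {K : ℝ} (hK : 0 ≤ K)
    (hfK : ∀ x ∈ Ω, |f x| ≤ K * φ x) (hgK : ∀ x ∈ Ω, |g x| ≤ K * φ x)
    (hfd : ∀ i, ∀ x ∈ Ω, |pderiv' i f x| ≤ K) (hgd : ∀ i, ∀ x ∈ Ω, |pderiv' i g x| ≤ K)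
    (hfl : ∀ x ∈ Ω, |lap f x| ≤ K) (hgl : ∀ x ∈ Ω, |lap g x| ≤ K) (hhK : ∀ x ∈ Ω, |h x| ≤ K)
    {S : Set ℝ} (hS : IsOpen S) {ψ : ℝ → ℝ} (hψ : ContDiffOn ℝ 1 ψ S) (hmem : ∀ x ∈ Ω, h x ∈ S)
    (hψK : ∀ x ∈ Ω, |ψ (h x)| ≤ K) (hψ'K : ∀ x ∈ Ω, |deriv ψ (h x)| ≤ K) :
    IntegrableOn (fun x => ψ (h x) * (f x * lap g x - g x * lap f x)) Ω ∧
    IntegrableOn (fun x => deriv ψ (h x) * (f x ^ 2 * gradSq h x)) Ω ∧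
    ∫ x in Ω, ψ (h x) * (f x * lap g x - g x * lap f x) =
      -∫ x in Ω, deriv ψ (h x) * (f x ^ 2 * gradSq h x) := by
  have hΩ := D.isOpen
  have df : ∀ x ∈ Ω, DifferentiableAt ℝ f x := fun x hx =>
    ContDiffOn.differentiableAt_mem hΩ (m := 2) hf (by norm_num) hx
  have dg : ∀ x ∈ Ω, DifferentiableAt ℝ g x := fun x hx =>
    ContDiffOn.differentiableAt_mem hΩ (m := 2) hg (by norm_num) hx
  have dh : ∀ x ∈ Ω, DifferentiableAt ℝ h x := fun x hx =>
    ContDiffOn.differentiableAt_mem hΩ (m := 1) hh le_rfl hx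
  have cf : ∀ i, ContDiffOn ℝ 1 (pderiv' i f) Ω := fun i =>
    ContDiffOn.pderiv' hΩ (m := 2) hf (by norm_num) i
  have cg : ∀ i, ContDiffOn ℝ 1 (pderiv' i g) Ω := fun i =>
    ContDiffOn.pderiv' hΩ (m := 2) hg (by norm_num) i
  have ddf : ∀ i, ∀ x ∈ Ω, DifferentiableAt ℝ (pderiv' i f) x := fun i x hx =>
    ContDiffOn.differentiableAt_mem hΩ (m := 1) (cf i) le_rfl hx
  have ddg : ∀ i, ∀ x ∈ Ω, DifferentiableAt ℝ (pderiv' i g) x := fun i x hx =>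
    ContDiffOn.differentiableAt_mem hΩ (m := 1) (cg i) le_rfl hx
  have dψ : ∀ x ∈ Ω, HasDerivAt ψ (deriv ψ (h x)) (h x) := fun x hx =>
    ((hψ.differentiableOn (by norm_num)).differentiableAt (hS.mem_nhds (hmem x hx))).hasDerivAt
  have hψh : ContDiffOn ℝ 1 (fun x => ψ (h x)) Ω := hψ.comp hh hmem
  have dψh : ∀ x ∈ Ω, DifferentiableAt ℝ (fun x => ψ (h x)) x := fun x hx =>
    ContDiffOn.differentiableAt_mem hΩ (m := 1) hψh le_rfl hx
  have hψ'c : ContinuousOn (fun x => deriv ψ (h x)) Ω :=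
    (hψ.continuousOn_deriv_of_isOpen hS le_rfl).comp hh.continuousOn hmem
  obtain ⟨L, hL, hLb⟩ := D.bound_closure D.smooth.continuous
  have hφL : ∀ x ∈ Ω, φ x ≤ L := fun x hx => (le_abs_self _).trans (hLb x (subset_closure hx))
  have hf1 : ContDiffOn ℝ 1 f Ω := hf.of_le (by norm_num)
  have hg1 : ContDiffOn ℝ 1 g Ω := hg.of_le (by norm_num)
  have hgrad : ∀ i, ∀ x ∈ Ω, f x * pderiv' i h x = pderiv' i g x - h x * pderiv' i f x := by
    intro i x hx
    rw [pderiv'_congr hΩ hfgh hx, pderiv'_mul (dh x hx) (df x hx)]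
    ring
  have I1 : IntegrableOn (fun x => ψ (h x) * (f x * lap g x - g x * lap f x)) Ω := by
    refine D.integrableOn_of_bound (M := K * (K * L * K + K * L * K)) ?_ fun x hx => ?_
    · exact hψh.continuousOn.mul ((hf.continuousOn.mul (continuousOn_lap hΩ hg)).sub
        (hg.continuousOn.mul (continuousOn_lap hΩ hf)))
    · rw [abs_mul]
      refine mul_le_mul (hψK x hx) ((abs_sub _ _).trans ?_) (abs_nonneg _) hK
      rw [abs_mul, abs_mul]
      have := mul_le_mul_of_nonneg_left (hφL x hx) hK
      exact add_le_add (mul_le_mul ((hfK x hx).trans this) (hgl x hx) (abs_nonneg _) (by positivity))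
        (mul_le_mul ((hgK x hx).trans this) (hfl x hx) (abs_nonneg _) (by positivity))
  have I2 : IntegrableOn (fun x => deriv ψ (h x) * (f x ^ 2 * gradSq h x)) Ω := by
    refine D.integrableOn_of_bound (M := K * ∑ i : Fin n, (K + K * K) ^ 2) ?_ fun x hx => ?_
    · exact hψ'c.mul ((hf.continuousOn.pow 2).mul (continuousOn_gradSq hΩ hh))
    · rw [abs_mul]
      refine mul_le_mul (hψ'K x hx) ?_ (abs_nonneg _) hK
      rw [abs_of_nonneg (mul_nonneg (sq_nonneg _) (gradSq_nonneg _ _)), gradSq, Finset.mul_sum]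
      refine Finset.sum_le_sum fun i _ => ?_
      rw [← mul_pow, hgrad i x hx, ← sq_abs]
      refine pow_le_pow_left₀ (abs_nonneg _) ((abs_sub _ _).trans ?_) 2
      rw [abs_mul]
      exact add_le_add (hgd i x hx) (mul_le_mul (hhK x hx) (hfd i x hx) (abs_nonneg _) hK)
  refine ⟨I1, I2, ?_⟩
  have hdiv : ∀ x ∈ Ω, ∑ i, pderiv' i (fun y => ψ (h y) *
      (f y * pderiv' i g y - g y * pderiv' i f y)) x =
      ψ (h x) * (f x * lap g x - g x * lap f x) + deriv ψ (h x) * (f x ^ 2 * gradSq h x) := by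
    intro x hx
    simp only [lap, gradSq, Finset.mul_sum, ← Finset.sum_sub_distrib, ← Finset.sum_add_distrib]
    refine Finset.sum_congr rfl fun i _ => ?_
    have e1 : DifferentiableAt ℝ (fun y => f y * pderiv' i g y) x := (df x hx).mul (ddg i x hx)
    have e2 : DifferentiableAt ℝ (fun y => g y * pderiv' i f y) x := (dg x hx).mul (ddf i x hx)
    rw [pderiv'_mul (dψh x hx) (e1.fun_sub e2), pderiv'_sub e1 e2, pderiv'_mul (df x hx) (ddg i x hx),
      pderiv'_mul (dg x hx) (ddf i x hx), pderiv'_comp (dψ x hx) (dh x hx)]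
    have e3 : f x * pderiv' i g x - g x * pderiv' i f x = f x * (f x * pderiv' i h x) := by
      rw [hgrad i x hx, hfgh x hx]; ring
    rw [e3]
    ring
  have key := D.integral_div_eq_zero
    (X := fun i y => ψ (h y) * (f y * pderiv' i g y - g y * pderiv' i f y)) (M := K * (K * K + K * K))
    (fun i => hψh.mul ((hf1.mul (cg i)).sub (hg1.mul (cf i)))) (fun i x hx => by
      have hφ0 : 0 ≤ φ x := ((D.mem_iff x).1 hx).le
      rw [abs_mul, mul_assoc]
      refine mul_le_mul (hψK x hx) ((abs_sub _ _).trans ?_) (abs_nonneg _) hK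
      rw [abs_mul, abs_mul, show (K * K + K * K) * φ x = K * φ x * K + K * φ x * K by ring]
      exact add_le_add (mul_le_mul (hfK x hx) (hgd i x hx) (abs_nonneg _) (by positivity))
        (mul_le_mul (hgK x hx) (hfd i x hx) (abs_nonneg _) (by positivity)))
    ((I1.add I2).congr_fun (fun x hx => (hdiv x hx).symm) hΩ.measurableSet)
  rw [setIntegral_congr_fun hΩ.measurableSet hdiv, integral_add I1 I2] at key
  linarith

end TimeDerivative

section Energy

variable {n : ℕ} {Ω : Set (EuclideanSpace ℝ (Fin n))} {φ : EuclideanSpace ℝ (Fin n) → ℝ}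

/-- A solution comparable to the defining function `φ`, together with the ratio
`h = ∂ₜ u / u`. -/
structure FDRatio (Ω : Set (EuclideanSpace ℝ (Fin n))) (φ : EuclideanSpace ℝ (Fin n) → ℝ)
    (p b T M m m' : ℝ) (u v w h : EuclideanSpace ℝ (Fin n) → ℝ → ℝ) : Prop
    extends FDSolution Ω φ p b T M u v w where
  m_pos : 0 < m
  m'_pos : 0 < m'
  u_lower : ∀ x ∈ Ω, ∀ t ∈ Icc 0 T, m * φ x ≤ u x t
  u_upper : ∀ x ∈ Ω, ∀ t ∈ Icc 0 T, u x t ≤ m' * φ x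
  ratio : ∀ x t, h x t = v x t / u x t

namespace FDRatio

variable {p b T M m m' : ℝ} {u v w h : EuclideanSpace ℝ (Fin n) → ℝ → ℝ}

lemma v_eq (R : FDRatio Ω φ p b T M m m' u v w h) {x : EuclideanSpace ℝ (Fin n)} (hx : x ∈ Ω) {t : ℝ}
    (ht : t ∈ Icc 0 T) : v x t = h x t * u x t := by
  rw [R.ratio, div_mul_cancel₀ _ (R.u_pos x hx t ht).ne']

lemma h_bound (R : FDRatio Ω φ p b T M m m' u v w h) {x : EuclideanSpace ℝ (Fin n)} (hx : x ∈ Ω)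
    {t : ℝ} (ht : t ∈ Icc 0 T) : |h x t| ≤ M / m := by
  have hm := R.m_pos
  have hM := R.M_pos
  rw [R.ratio, abs_div, abs_of_pos (R.u_pos x hx t ht), div_le_div_iff₀ (R.u_pos x hx t ht) hm]
  have h1 := R.v_bound x hx t ht
  have h2 := R.u_lower x hx t ht
  nlinarith

lemma h_smooth (R : FDRatio Ω φ p b T M m m' u v w h) {t : ℝ}
    (ht : t ∈ Icc 0 T) : ContDiffOn ℝ 1 (fun x => h x t) Ω := by
  simp only [R.ratio]
  exact ((R.v_smooth t ht).of_le (by norm_num)).div ((R.u_smooth t ht).of_le (by norm_num))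
    fun x hx => (R.u_pos x hx t ht).ne'

lemma h_deriv (R : FDRatio Ω φ p b T M m m' u v w h) {x : EuclideanSpace ℝ (Fin n)} (hx : x ∈ Ω)
    {t : ℝ} (ht : t ∈ Icc 0 T) :
    HasDerivWithinAt (h x) ((w x t - h x t * v x t) / u x t) (Icc 0 T) t := by
  have h0 := (R.u_pos x hx t ht).ne'
  have := (R.v_deriv x hx t ht).fun_div (R.u_deriv x hx t ht) h0
  rw [show h x = fun t => v x t / u x t from funext fun t => R.ratio x t]
  refine this.congr_deriv ?_
  field_simp

lemma h_contT (R : FDRatio Ω φ p b T M m m' u v w h) {x : EuclideanSpace ℝ (Fin n)} (hx : x ∈ Ω) :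
    ContinuousOn (h x) (Icc 0 T) := fun _ ht => (R.h_deriv hx ht).continuousWithinAt

lemma u_contT (R : FDRatio Ω φ p b T M m m' u v w h) {x : EuclideanSpace ℝ (Fin n)} (hx : x ∈ Ω) :
    ContinuousOn (u x) (Icc 0 T) := fun t ht => (R.u_deriv x hx t ht).continuousWithinAt

lemma continuousOn_rpow (R : FDRatio Ω φ p b T M m m' u v w h) (q : ℝ) {t : ℝ}
    (ht : t ∈ Icc 0 T) : ContinuousOn (fun x => u x t ^ q) Ω :=
  (R.u_smooth t ht).continuousOn.rpow_const fun x hx => Or.inl (R.u_pos x hx t ht).ne'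

lemma continuousOn_rpowT (R : FDRatio Ω φ p b T M m m' u v w h) (q : ℝ)
    {x : EuclideanSpace ℝ (Fin n)} (hx : x ∈ Ω) : ContinuousOn (fun t => u x t ^ q) (Icc 0 T) :=
  (R.u_contT hx).rpow_const fun t ht => Or.inl (R.u_pos x hx t ht).ne'

lemma exists_rpow_le (R : FDRatio Ω φ p b T M m m' u v w h) (D : DefiningFun Ω φ) {q : ℝ} (hq : 0 ≤ q) :
    ∃ K, 0 ≤ K ∧ ∀ x ∈ Ω, ∀ t ∈ Icc 0 T, u x t ^ q ≤ K := by
  obtain ⟨L, hL, hLb⟩ := D.bound_closure D.smooth.continuous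
  have hm' := R.m'_pos
  refine ⟨(m' * L) ^ q, by positivity, fun x hx t ht => ?_⟩
  refine Real.rpow_le_rpow (R.u_pos x hx t ht).le ((R.u_upper x hx t ht).trans ?_) hq
  exact mul_le_mul_of_nonneg_left ((le_abs_self _).trans (hLb x (subset_closure hx))) hm'.le

lemma mul_lap_sub (R : FDRatio Ω φ p b T M m m' u v w h) {x : EuclideanSpace ℝ (Fin n)} (hx : x ∈ Ω)
    {t : ℝ} (ht : t ∈ Ioo 0 T) :
    p * (u x t ^ p * (w x t - h x t * v x t)) =
      (u x t * lap (fun y => v y t) x - v x t * lap (fun y => u y t) x) +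
        u x t ^ (p + 1) * ((p - 1) * h x t - p * (p - 1) * h x t ^ 2) := by
  have htI : t ∈ Icc 0 T := ⟨ht.1.le, ht.2.le⟩
  have h0 := R.u_pos x hx t htI
  have e1 : u x t ^ (p - 1) * u x t = u x t ^ p := by
    rw [← Real.rpow_add_one h0.ne']; congr 1; ring
  have e2 : u x t ^ (p - 2) * u x t ^ 2 = u x t ^ p := by
    rw [← Real.rpow_natCast, ← Real.rpow_add h0]; congr 1; push_cast; ring
  have e3 : u x t ^ (p + 1) = u x t ^ p * u x t := Real.rpow_add_one h0.ne' p
  have P1 := R.pde x hx t ⟨ht.1, ht.2.le⟩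
  have P2 := R.pde_deriv x hx t ht
  rw [R.v_eq hx htI] at P1 P2 ⊢
  rw [e3]
  linear_combination (u x t) * P2 - (h x t * u x t) * P1 +
    (-(p * w x t) + p * h x t * u x t + p * h x t ^ 2 * u x t) * e1
      - p * (p - 1) * h x t ^ 2 * u x t * e2

/-- The energy identity for `∫ u ^ (p + 1) Φ(t, h)`. -/
lemma hasDerivAt_energy (R : FDRatio Ω φ p b T M m m' u v w h) (D : DefiningFun Ω φ)
    {S : Set ℝ} (hS : IsOpen S) {Φ Φt ψ : ℝ → ℝ → ℝ} {s e K : ℝ} (hs : 0 ≤ s) (he : e ≤ T) (hK : 0 ≤ K)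
    (hmem : ∀ t ∈ Ioo s e, ∀ x ∈ Ω, h x t ∈ S)
    (hΦ : ∀ t ∈ Ioo s e, ContinuousOn (Φ t) S) (hΦt : ∀ t ∈ Ioo s e, ContinuousOn (Φt t) S)
    (hψ : ∀ t ∈ Ioo s e, ContDiffOn ℝ 1 (ψ t) S)
    (hΦK : ∀ t ∈ Ioo s e, ∀ x ∈ Ω, |Φ t (h x t)| ≤ K)
    (hΦtK : ∀ t ∈ Ioo s e, ∀ x ∈ Ω, |Φt t (h x t)| ≤ K)
    (hψK : ∀ t ∈ Ioo s e, ∀ x ∈ Ω, |ψ t (h x t)| ≤ K)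
    (hψ'K : ∀ t ∈ Ioo s e, ∀ x ∈ Ω, |deriv (ψ t) (h x t)| ≤ K)
    (hchain : ∀ t ∈ Ioo s e, ∀ (η : ℝ → ℝ) (η' : ℝ), η t ∈ S → HasDerivAt η η' t →
      HasDerivAt (fun r => Φ r (η r)) (Φt t (η t) + ψ t (η t) * η') t)
    {t : ℝ} (ht : t ∈ Ioo s e) :
    IntegrableOn (fun x => u x t ^ (p + 1) * ((p + 1) * h x t * Φ t (h x t) + Φt t (h x t) +
        ψ t (h x t) * ((p - 1) / p * h x t - (p - 1) * h x t ^ 2))) Ω ∧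
    HasDerivAt (fun t => ∫ x in Ω, u x t ^ (p + 1) * Φ t (h x t))
      ((∫ x in Ω, u x t ^ (p + 1) * ((p + 1) * h x t * Φ t (h x t) + Φt t (h x t) +
        ψ t (h x t) * ((p - 1) / p * h x t - (p - 1) * h x t ^ 2))) -
        1 / p * ∫ x in Ω, deriv (ψ t) (h x t) * (u x t ^ 2 * gradSq (fun y => h y t) x)) t := by
  have hp := R.one_lt
  have hM := R.M_pos
  have hm := R.m_pos
  have hm' := R.m'_pos
  have hIoo : ∀ r ∈ Ioo s e, r ∈ Ioo 0 T := fun r hr => ⟨hs.trans_lt hr.1, hr.2.trans_le he⟩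
  have hIcc : ∀ r ∈ Ioo s e, r ∈ Icc 0 T := fun r hr => Ioo_subset_Icc_self (hIoo r hr)
  obtain ⟨L, hL, hLb⟩ := D.bound_closure D.smooth.continuous
  have hvL : ∀ r ∈ Ioo s e, ∀ x ∈ Ω, |v x r| ≤ M * L := fun r hr x hx =>
    (R.v_bound x hx r (hIcc r hr)).trans
      (mul_le_mul_of_nonneg_left ((le_abs_self _).trans (hLb x (subset_closure hx))) hM.le)
  obtain ⟨K1, hK1, hK1b⟩ := R.exists_rpow_le D (q := p) (by linarith)
  obtain ⟨K2, hK2, hK2b⟩ := R.exists_rpow_le D (q := p + 1) (by linarith)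
  set H := M / m with hH
  have hH0 : 0 ≤ H := by positivity
  have cu : ∀ q : ℝ, ∀ r ∈ Ioo s e, ContinuousOn (fun x => u x r ^ q) Ω := fun q r hr =>
    R.continuousOn_rpow q (hIcc r hr)
  have ch : ∀ r ∈ Ioo s e, ContinuousOn (fun x => h x r) Ω := fun r hr =>
    (R.h_smooth (hIcc r hr)).continuousOn
  have cΦ : ∀ r ∈ Ioo s e, ContinuousOn (fun x => Φ r (h x r)) Ω := fun r hr =>
    (hΦ r hr).comp (ch r hr) (hmem r hr)
  have cΦt : ∀ r ∈ Ioo s e, ContinuousOn (fun x => Φt r (h x r)) Ω := fun r hr =>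
    (hΦt r hr).comp (ch r hr) (hmem r hr)
  have cψ : ∀ r ∈ Ioo s e, ContinuousOn (fun x => ψ r (h x r)) Ω := fun r hr =>
    (hψ r hr).continuousOn.comp (ch r hr) (hmem r hr)
  have hvc : ∀ r ∈ Ioo s e, ContinuousOn (fun x => v x r) Ω := fun r hr =>
    (R.v_smooth r (hIcc r hr)).continuousOn
  have hdρ := D.hasDerivAt_setIntegral (s := s) (e := e)
    (K := K2 * K + (p + 1) * (K1 * (M * L) * K) + K2 * K + K1 * (K * (M + H * (M * L))))
    (ρ := fun x t => u x t ^ (p + 1) * Φ t (h x t))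
    (ρ' := fun x t => (p + 1) * (u x t ^ p * v x t * Φ t (h x t)) + u x t ^ (p + 1) * Φt t (h x t) +
      u x t ^ p * (ψ t (h x t) * (w x t - h x t * v x t)))
    (fun r hr => (cu _ r hr).mul (cΦ r hr))
    (fun r hr x hx => by
      have h1 : |u x r ^ (p + 1) * Φ r (h x r)| ≤ K2 * K := by
        rw [abs_mul, abs_of_nonneg (Real.rpow_nonneg (R.u_pos x hx r (hIcc r hr)).le _)]
        exact mul_le_mul (hK2b x hx r (hIcc r hr)) (hΦK r hr x hx) (abs_nonneg _) hK2
      refine h1.trans ?_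
      have : 0 ≤ (p + 1) * (K1 * (M * L) * K) + K2 * K + K1 * (K * (M + H * (M * L))) := by
        have : 0 ≤ p + 1 := by linarith
        positivity
      linarith)
    (fun r hr => ((continuousOn_const.mul (((cu _ r hr).mul (hvc r hr)).mul (cΦ r hr))).add
      ((cu _ r hr).mul (cΦt r hr))).add ((cu _ r hr).mul ((cψ r hr).mul
        ((R.w_cont r (hIcc r hr)).sub ((ch r hr).mul (hvc r hr))))))
    (fun r hr x hx => by
      have hu0 := (R.u_pos x hx r (hIcc r hr)).le
      have a1 : |(p + 1) * (u x r ^ p * v x r * Φ r (h x r))| ≤ (p + 1) * (K1 * (M * L) * K) := by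
        rw [abs_mul, abs_of_nonneg (by linarith : 0 ≤ p + 1), abs_mul, abs_mul,
          abs_of_nonneg (Real.rpow_nonneg hu0 p)]
        have := hK1b x hx r (hIcc r hr)
        have h2 := hvL r hr x hx
        have h3 := hΦK r hr x hx
        have : 0 ≤ p + 1 := by linarith
        gcongr
      have a2 : |u x r ^ (p + 1) * Φt r (h x r)| ≤ K2 * K := by
        rw [abs_mul, abs_of_nonneg (Real.rpow_nonneg hu0 _)]
        exact mul_le_mul (hK2b x hx r (hIcc r hr)) (hΦtK r hr x hx) (abs_nonneg _) hK2
      have a3 : |u x r ^ p * (ψ r (h x r) * (w x r - h x r * v x r))| ≤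
          K1 * (K * (M + H * (M * L))) := by
        rw [abs_mul, abs_mul, abs_of_nonneg (Real.rpow_nonneg hu0 p)]
        have := hK1b x hx r (hIcc r hr)
        have h2 := hvL r hr x hx
        have h3 := hψK r hr x hx
        have h4 : |w x r - h x r * v x r| ≤ M + H * (M * L) := by
          refine (abs_sub _ _).trans (add_le_add (R.w_bound x hx r (hIcc r hr)) ?_)
          rw [abs_mul]
          exact mul_le_mul (R.h_bound hx (hIcc r hr)) h2 (abs_nonneg _) hH0
        gcongr
      have a4 : 0 ≤ K2 * K := by positivity
      refine (abs_add_le _ _).trans ?_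
      have a5 := abs_add_le ((p + 1) * (u x r ^ p * v x r * Φ r (h x r)))
        (u x r ^ (p + 1) * Φt r (h x r))
      linarith)
    (fun r hr x hx => by
      have hn := Icc_mem_nhds (hIoo r hr).1 (hIoo r hr).2
      have hu0 := R.u_pos x hx r (hIcc r hr)
      have d1 := ((R.u_deriv x hx r (hIcc r hr)).hasDerivAt hn).rpow_const (p := p + 1)
        (Or.inl hu0.ne')
      have d2 := hchain r hr (h x) _ (hmem r hr x hx) ((R.h_deriv hx (hIcc r hr)).hasDerivAt hn)
      refine (d1.mul d2).congr_deriv ?_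
      rw [show p + 1 - 1 = p by ring, Real.rpow_add_one hu0.ne']
      field_simp
      ring) ht
  have htI := hIcc t ht
  have hφ0 : ∀ x ∈ Ω, 0 ≤ φ x := fun x hx => ((D.mem_iff x).1 hx).le
  obtain ⟨I1, I2, hspat⟩ := D.integral_ratio (f := fun x => u x t) (g := fun x => v x t)
    (h := fun x => h x t) (R.u_smooth t htI) (R.v_smooth t htI) (R.h_smooth htI)
    (fun x hx => R.v_eq hx htI) (K := M + m' + H + K) (by positivity)
    (fun x hx => by
      rw [abs_of_pos (R.u_pos x hx t htI)]
      exact (R.u_upper x hx t htI).trans (mul_le_mul_of_nonneg_right (by linarith) (hφ0 x hx)))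
    (fun x hx => (R.v_bound x hx t htI).trans
      (mul_le_mul_of_nonneg_right (by linarith) (hφ0 x hx)))
    (fun i x hx => (R.du_bound i x hx t htI).trans (by linarith))
    (fun i x hx => (R.dv_bound i x hx t htI).trans (by linarith))
    (fun x hx => (R.lapu_bound x hx t htI).trans (by linarith))
    (fun x hx => (R.lapv_bound x hx t htI).trans (by linarith))
    (fun x hx => (R.h_bound hx htI).trans (by linarith))
    hS (hψ t ht) (hmem t ht) (fun x hx => (hψK t ht x hx).trans (by linarith))
    (fun x hx => (hψ'K t ht x hx).trans (by linarith))
  have I3 : IntegrableOn (fun x => u x t ^ (p + 1) * ((p + 1) * h x t * Φ t (h x t) +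
      Φt t (h x t) + ψ t (h x t) * ((p - 1) / p * h x t - (p - 1) * h x t ^ 2))) Ω := by
    have c1 := ch t ht
    refine D.integrableOn_of_bound (M := K2 * ((p + 1) * H * K + K +
      K * ((p - 1) / p * H + (p - 1) * H ^ 2))) ?_ fun x hx => ?_
    · exact (cu _ t ht).mul ((((continuousOn_const.mul c1).mul (cΦ t ht)).add (cΦt t ht)).add
        ((cψ t ht).mul ((continuousOn_const.mul c1).sub (continuousOn_const.mul (c1.pow 2)))))
    · have hu0 := (R.u_pos x hx t htI).le
      have h1 := R.h_bound hx htI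
      have q1 : 0 ≤ p + 1 := by linarith
      have q2 : 0 ≤ p - 1 := by linarith
      have q3 : 0 ≤ (p - 1) / p := by positivity
      rw [abs_mul, abs_of_nonneg (Real.rpow_nonneg hu0 _)]
      refine mul_le_mul (hK2b x hx t htI) ?_ (abs_nonneg _) hK2
      refine (abs_add_le _ _).trans (add_le_add ((abs_add_le _ _).trans
        (add_le_add ?_ (hΦtK t ht x hx))) ?_)
      · rw [abs_mul, abs_mul, abs_of_nonneg q1]
        have := hΦK t ht x hx
        gcongr
      · rw [abs_mul]
        refine mul_le_mul (hψK t ht x hx) ((abs_sub _ _).trans ?_) (abs_nonneg _) hK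
        rw [abs_mul, abs_mul, abs_of_nonneg q2, abs_of_nonneg q3, abs_pow]
        gcongr
  refine ⟨I3, hdρ.congr_deriv ?_⟩
  have hpt : ∀ x ∈ Ω, (p + 1) * (u x t ^ p * v x t * Φ t (h x t)) + u x t ^ (p + 1) * Φt t (h x t) +
      u x t ^ p * (ψ t (h x t) * (w x t - h x t * v x t)) =
      u x t ^ (p + 1) * ((p + 1) * h x t * Φ t (h x t) + Φt t (h x t) +
        ψ t (h x t) * ((p - 1) / p * h x t - (p - 1) * h x t ^ 2)) +
      1 / p * (ψ t (h x t) * (u x t * lap (fun y => v y t) x - v x t * lap (fun y => u y t) x)) := by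
    intro x hx
    have e := R.mul_lap_sub hx (hIoo t ht)
    have e4 : u x t ^ p * v x t = u x t ^ (p + 1) * h x t := by
      rw [Real.rpow_add_one (R.u_pos x hx t htI).ne', R.v_eq hx htI]; ring
    have hp0 : p ≠ 0 := by linarith
    field_simp
    linear_combination ψ t (h x t) * e + p * (p + 1) * Φ t (h x t) * e4
  rw [setIntegral_congr_fun D.isOpen.measurableSet hpt, integral_add I3 (I1.const_mul _),
    integral_const_mul, hspat]
  ring

end FDRatio

end Energy

section UpperBound

lemma hasDerivAt_max_zero_pow (j : ℕ) (σ : ℝ) :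
    HasDerivAt (fun σ : ℝ => max σ 0 ^ (j + 2)) ((j + 2) * max σ 0 ^ (j + 1)) σ := by
  rcases lt_trichotomy σ 0 with h | h | h
  · rw [max_eq_right h.le, zero_pow (by omega), mul_zero]
    refine (hasDerivAt_const σ (0:ℝ)).congr_of_eventuallyEq ?_
    filter_upwards [gt_mem_nhds h] with r hr
    rw [max_eq_right (le_of_lt hr), zero_pow (by omega)]
  · subst h
    rw [max_self, zero_pow (by omega), mul_zero, hasDerivAt_iff_tendsto_slope]
    have hc : Tendsto (fun σ : ℝ => max σ 0 ^ (j + 1)) (𝓝 0) (𝓝 0) := by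
      have : Continuous fun σ : ℝ => max σ 0 ^ (j + 1) := by fun_prop
      simpa using this.tendsto 0
    refine (hc.mono_left nhdsWithin_le_nhds).congr' ?_
    filter_upwards [self_mem_nhdsWithin] with r hr
    have hr0 : r ≠ 0 := hr
    rw [slope_def_field, max_self, zero_pow (by omega), sub_zero, sub_zero, eq_div_iff hr0]
    rcases le_total r 0 with h | h
    · rw [max_eq_right h, zero_pow (by omega), zero_pow (by omega), zero_mul]
    · rw [max_eq_left h]; ring
  · rw [max_eq_left h.le]
    refine HasDerivAt.congr_of_eventuallyEq (f := fun r : ℝ => r ^ (j + 2)) ?_ ?_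
    · simpa using hasDerivAt_pow (j + 2) σ
    · filter_upwards [lt_mem_nhds h] with r hr
      rw [max_eq_left (le_of_lt hr)]

lemma contDiff_max_zero_pow (j : ℕ) : ContDiff ℝ 1 fun σ : ℝ => max σ 0 ^ (j + 2) := by
  rw [contDiff_one_iff_deriv]
  refine ⟨fun σ => (hasDerivAt_max_zero_pow j σ).differentiableAt, ?_⟩
  rw [show deriv (fun σ : ℝ => max σ 0 ^ (j + 2)) =
      fun σ : ℝ => ((j : ℝ) + 2) * max σ 0 ^ (j + 1) from
    funext fun σ => (hasDerivAt_max_zero_pow j σ).deriv]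
  fun_prop

variable {n : ℕ} {Ω : Set (EuclideanSpace ℝ (Fin n))} {φ : EuclideanSpace ℝ (Fin n) → ℝ}

lemma DefiningFun.eq_zero_of_setIntegral_nonpos (D : DefiningFun Ω φ)
    {f : EuclideanSpace ℝ (Fin n) → ℝ} (hf : ContinuousOn f Ω) (hi : IntegrableOn f Ω)
    (h0 : ∀ x ∈ Ω, 0 ≤ f x) (hint : ∫ x in Ω, f x ≤ 0) {x : EuclideanSpace ℝ (Fin n)} (hx : x ∈ Ω) :
    f x = 0 := by
  have hm := D.isOpen.measurableSet
  have h1 : 0 ≤ᵐ[volume.restrict Ω] f := (ae_restrict_iff' hm).2 (ae_of_all _ h0)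
  have h2 := (setIntegral_eq_zero_iff_of_nonneg_ae h1 hi).1
    (le_antisymm hint (setIntegral_nonneg hm h0))
  exact Measure.eqOn_open_of_ae_eq h2 D.isOpen hf continuousOn_const hx

lemma FDRatio.le_div {p b T M m m' : ℝ} {u v w h : EuclideanSpace ℝ (Fin n) → ℝ → ℝ}
    (R : FDRatio Ω φ p b T M m m' u v w h) (D : DefiningFun Ω φ) {j : ℕ}
    (hj : p + 1 ≤ (p - 1) * (j + 3)) {x : EuclideanSpace ℝ (Fin n)} (hx : x ∈ Ω) {t : ℝ}
    (ht : t ∈ Ioc 0 T) : h x t ≤ (j + 3) * (1 + T) / t := by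
  have hp := R.one_lt
  have hT := R.T_pos
  have hM := R.M_pos
  have hm := R.m_pos
  set B : ℝ := (j + 3) * (1 + T) with hB
  have hB0 : 0 ≤ B := by positivity
  set H := M / m with hH
  have hH0 : 0 ≤ H := by positivity
  set Q := T * H with hQ
  have hQ0 : 0 ≤ Q := by positivity
  have hQb : ∀ r ∈ Icc 0 T, ∀ x ∈ Ω, max (r * h x r - B) 0 ≤ Q := by
    intro r hr x hx
    refine max_le ?_ hQ0
    have := (le_abs_self _).trans (R.h_bound hx hr)
    nlinarith [hr.1, hr.2]
  have hchain : ∀ (i : ℕ) (η : ℝ → ℝ) (η' r : ℝ), HasDerivAt η η' r →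
      HasDerivAt (fun r => max (r * η r - B) 0 ^ (i + 2))
        ((i + 2) * max (r * η r - B) 0 ^ (i + 1) * (η r + r * η')) r := by
    intro i η η' r hη
    have h1 : HasDerivAt (fun r => r * η r - B) (η r + r * η') r := by
      simpa using ((hasDerivAt_id r).mul hη).sub_const B
    exact (hasDerivAt_max_zero_pow i _).comp r h1
  have hderiv : ∀ r s, deriv (fun s => ((j : ℝ) + 3) * max (r * s - B) 0 ^ (j + 2) * r) s =
      (j + 3) * (j + 2) * max (r * s - B) 0 ^ (j + 1) * r ^ 2 := by
    intro r s
    have h1 : HasDerivAt (fun s => r * s - B) r s := by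
      simpa using ((hasDerivAt_id s).const_mul r).sub_const B
    have h2 := (hasDerivAt_max_zero_pow j (r * s - B)).comp s h1
    have h3 := (h2.const_mul ((j : ℝ) + 3)).mul_const r
    have h4 := h3.deriv
    rw [show (fun s => ((j : ℝ) + 3) * max (r * s - B) 0 ^ (j + 2) * r) = fun y => (↑j + 3) *
      ((fun σ : ℝ => max σ 0 ^ (j + 2)) ∘ fun s => r * s - B) y * r from rfl, h4]
    ring
  have hj3 : (0:ℝ) ≤ j + 3 := by positivity
  set K : ℝ := Q ^ (j + 3) + (j + 3) * Q ^ (j + 2) * H + (j + 3) * Q ^ (j + 2) * T +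
    (j + 3) * (j + 2) * Q ^ (j + 1) * T ^ 2 with hK
  have hEn : ∀ r ∈ Ioo 0 T, _ := fun r hr => R.hasDerivAt_energy D isOpen_univ
    (Φ := fun r s => max (r * s - B) 0 ^ (j + 3))
    (Φt := fun r s => (j + 3) * max (r * s - B) 0 ^ (j + 2) * s)
    (ψ := fun r s => (j + 3) * max (r * s - B) 0 ^ (j + 2) * r) (s := 0) (e := T) (K := K) le_rfl le_rfl
    (by positivity)
    (fun _ _ _ _ => mem_univ _)
    (fun _ _ => Continuous.continuousOn (by fun_prop))
    (fun _ _ => Continuous.continuousOn (by fun_prop))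
    (fun r _ => by
      refine ContDiff.contDiffOn ?_
      exact (contDiff_const.mul ((contDiff_max_zero_pow j).comp
        ((contDiff_const.mul contDiff_id).sub contDiff_const))).mul contDiff_const)
    (fun r hr x hx => by
      have := hQb r (Ioo_subset_Icc_self hr) x hx
      have h0 := le_max_right (r * h x r - B) 0
      rw [abs_of_nonneg (by positivity)]
      have := pow_le_pow_left₀ h0 this (j + 3)
      have h2 : 0 ≤ (j + 3) * Q ^ (j + 2) * H + (j + 3) * Q ^ (j + 2) * T +
        (j + 3) * (j + 2) * Q ^ (j + 1) * T ^ 2 := by positivity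
      linarith)
    (fun r hr x hx => by
      have := hQb r (Ioo_subset_Icc_self hr) x hx
      have h0 := le_max_right (r * h x r - B) 0
      rw [abs_mul, abs_of_nonneg (by positivity)]
      have h1 := R.h_bound hx (Ioo_subset_Icc_self hr)
      have : (j + 3) * max (r * h x r - B) 0 ^ (j + 2) * |h x r| ≤ (j + 3) * Q ^ (j + 2) * H := by
        gcongr
      have h2 : 0 ≤ Q ^ (j + 3) + (j + 3) * Q ^ (j + 2) * T +
        (j + 3) * (j + 2) * Q ^ (j + 1) * T ^ 2 := by positivity
      linarith)
    (fun r hr x hx => by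
      have := hQb r (Ioo_subset_Icc_self hr) x hx
      have h0 := le_max_right (r * h x r - B) 0
      have hr0 := hr.1.le
      have hrT := hr.2.le
      rw [abs_of_nonneg (by positivity)]
      have : (j + 3) * max (r * h x r - B) 0 ^ (j + 2) * r ≤ (j + 3) * Q ^ (j + 2) * T := by
        gcongr
      have h2 : 0 ≤ Q ^ (j + 3) + (j + 3) * Q ^ (j + 2) * H +
        (j + 3) * (j + 2) * Q ^ (j + 1) * T ^ 2 := by positivity
      linarith)
    (fun r hr x hx => by
      have := hQb r (Ioo_subset_Icc_self hr) x hx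
      have h0 := le_max_right (r * h x r - B) 0
      have hr0 := hr.1.le
      have hrT := hr.2.le
      rw [hderiv, abs_of_nonneg (by positivity)]
      have : (j + 3) * (j + 2) * max (r * h x r - B) 0 ^ (j + 1) * r ^ 2 ≤
          (j + 3) * (j + 2) * Q ^ (j + 1) * T ^ 2 := by
        gcongr
      have h2 : 0 ≤ Q ^ (j + 3) + (j + 3) * Q ^ (j + 2) * H + (j + 3) * Q ^ (j + 2) * T := by
        positivity
      linarith)
    (fun r hr η η' _ hη => by
      refine (hchain (j + 1) η η' r hη).congr_deriv ?_
      push_cast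
      ring) hr
  set Y : ℝ → ℝ := fun t => ∫ x in Ω, u x t ^ (p + 1) * max (t * h x t - B) 0 ^ (j + 3) with hY
  obtain ⟨K2, hK2, hK2b⟩ := R.exists_rpow_le D (q := p + 1) (by linarith)
  have hcx : ∀ r ∈ Icc 0 T,
      ContinuousOn (fun x => u x r ^ (p + 1) * max (r * h x r - B) 0 ^ (j + 3)) Ω := fun r hr => by
    have h1 : Continuous fun s => max (r * s - B) 0 ^ (j + 3) := by fun_prop
    exact (R.continuousOn_rpow (p + 1) hr).mul
      (h1.comp_continuousOn (R.h_smooth hr).continuousOn)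
  have hbd : ∀ r ∈ Icc 0 T, ∀ x ∈ Ω,
      |u x r ^ (p + 1) * max (r * h x r - B) 0 ^ (j + 3)| ≤ K2 * Q ^ (j + 3) := fun r hr x hx => by
    have := hQb r hr x hx
    have h0 := le_max_right (r * h x r - B) 0
    have h1 := hK2b x hx r hr
    have hu0 := (R.u_pos x hx r hr).le
    rw [abs_of_nonneg (by positivity)]
    gcongr
  have hYc : ContinuousOn Y (Icc 0 T) := by
    refine D.continuousOn_setIntegral hcx hbd fun x hx => ?_
    have h1 : Continuous fun s => max (s - B) 0 ^ (j + 3) := by fun_prop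
    exact (R.continuousOn_rpowT (p + 1) hx).mul
      (h1.comp_continuousOn (continuousOn_id.mul (R.h_contT hx)))
  have hanti : AntitoneOn Y (Icc 0 T) := by
    refine antitoneOn_of_deriv_nonpos (convex_Icc 0 T) hYc ?_ ?_
    · rw [interior_Icc]
      exact fun r hr => (hEn r hr).2.differentiableAt.differentiableWithinAt
    · rw [interior_Icc]
      intro r hr
      rw [(hEn r hr).2.deriv]
      have hr0 := hr.1
      have hrT := hr.2
      have i1 : (∫ x in Ω, u x r ^ (p + 1) * ((p + 1) * h x r * max (r * h x r - B) 0 ^ (j + 3) +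
          (j + 3) * max (r * h x r - B) 0 ^ (j + 2) * h x r +
          (j + 3) * max (r * h x r - B) 0 ^ (j + 2) * r *
            ((p - 1) / p * h x r - (p - 1) * h x r ^ 2))) ≤ 0 := by
        refine setIntegral_nonpos D.isOpen.measurableSet fun x hx => ?_
        refine mul_nonpos_of_nonneg_of_nonpos
          (Real.rpow_nonneg (R.u_pos x hx r (Ioo_subset_Icc_self hr)).le _) ?_
        set s := h x r
        rcases le_total (r * s - B) 0 with hle | hge
        · rw [max_eq_right hle, zero_pow (by omega), zero_pow (by omega)]; simp
        · rw [max_eq_left hge]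
          have hs0 : 0 ≤ s := by
            by_contra hlt
            nlinarith
          have e : (p + 1) * s * (r * s - B) ^ (j + 3) + (j + 3) * (r * s - B) ^ (j + 2) * s +
              (j + 3) * (r * s - B) ^ (j + 2) * r * ((p - 1) / p * s - (p - 1) * s ^ 2) =
              (s * (r * s - B) ^ (j + 2)) * ((p + 1) * (r * s - B) + (j + 3) +
                (j + 3) * r * ((p - 1) / p) - (j + 3) * (p - 1) * (r * s)) := by ring
          rw [e]
          refine mul_nonpos_of_nonneg_of_nonpos (by positivity) ?_
          have h1 : (p - 1) / p ≤ 1 := by rw [div_le_one (by linarith)]; linarith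
          have h2 : (j + 3) * r * ((p - 1) / p) ≤ (j + 3) * T := by
            calc (j + 3) * r * ((p - 1) / p) ≤ (j + 3) * r * 1 := by gcongr
              _ ≤ (j + 3) * T := by rw [mul_one]; gcongr
          have h3 : (p + 1) * (r * s) ≤ (p - 1) * (j + 3) * (r * s) :=
            mul_le_mul_of_nonneg_right hj (by positivity)
          have h4 : B ≤ (p + 1) * B := by nlinarith
          rw [hB] at h4 ⊢
          nlinarith
      have i2 : 0 ≤ ∫ x in Ω, deriv (fun s => ((j : ℝ) + 3) * max (r * s - B) 0 ^ (j + 2) * r) (h x r) *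
          (u x r ^ 2 * gradSq (fun y => h y r) x) := by
        refine setIntegral_nonneg D.isOpen.measurableSet fun x hx => ?_
        rw [hderiv]
        have h0 := le_max_right (r * h x r - B) 0
        have := gradSq_nonneg (fun y => h y r) x
        positivity
      have i3 : 0 ≤ 1 / p * ∫ x in Ω, deriv (fun s => ((j : ℝ) + 3) * max (r * s - B) 0 ^ (j + 2) * r)
          (h x r) * (u x r ^ 2 * gradSq (fun y => h y r) x) := by
        have : 0 ≤ 1 / p := by positivity
        exact mul_nonneg this i2
      linarith
  have hY0 : Y 0 = 0 := by
    simp only [hY, zero_mul, zero_sub]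
    rw [max_eq_right (by linarith), zero_pow (by omega)]
    simp
  have htI : t ∈ Icc 0 T := ⟨ht.1.le, ht.2⟩
  have hYt : Y t ≤ 0 := hY0 ▸ hanti (left_mem_Icc.2 hT.le) htI ht.1.le
  have hz := D.eq_zero_of_setIntegral_nonpos (hcx t htI)
    (D.integrableOn_of_bound (hcx t htI) (hbd t htI)) (fun y hy => by
      have h0 := le_max_right (t * h y t - B) 0
      have hu0 := (R.u_pos y hy t htI).le
      positivity) hYt hx
  have hz2 := (mul_eq_zero.1 hz).resolve_left (Real.rpow_pos_of_pos (R.u_pos x hx t htI) _).ne'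
  have hz3 := eq_zero_of_pow_eq_zero hz2
  rw [le_div_iff₀ ht.1]
  have := le_max_left (t * h x t - B) 0
  linarith

end UpperBound

section PowerEnergy

variable {n : ℕ} {Ω : Set (EuclideanSpace ℝ (Fin n))} {φ : EuclideanSpace ℝ (Fin n) → ℝ}

/-- The weighted integrals `∫ u ^ (p + 1) (A - h) ^ q`. -/
def powerEnergy (Ω : Set (EuclideanSpace ℝ (Fin n))) (p A : ℝ)
    (u h : EuclideanSpace ℝ (Fin n) → ℝ → ℝ) (q t : ℝ) : ℝ :=
  ∫ x in Ω, u x t ^ (p + 1) * (A - h x t) ^ q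

namespace FDRatio

variable {p b T M m m' A s : ℝ} {u v w h : EuclideanSpace ℝ (Fin n) → ℝ → ℝ}

lemma one_le_sub (hA : ∀ x ∈ Ω, ∀ t ∈ Icc s T, h x t ≤ A - 1) {t : ℝ} (ht : t ∈ Icc s T)
    {x : EuclideanSpace ℝ (Fin n)} (hx : x ∈ Ω) : 1 ≤ A - h x t := by
  linarith [hA x hx t ht]

lemma sub_rpow_le (R : FDRatio Ω φ p b T M m m' u v w h) (hs : 0 ≤ s)
    (hA : ∀ x ∈ Ω, ∀ t ∈ Icc s T, h x t ≤ A - 1) {r q : ℝ} (hr : r ≤ q) (hq : 0 ≤ q) {t : ℝ}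
    (ht : t ∈ Icc s T) {x : EuclideanSpace ℝ (Fin n)} (hx : x ∈ Ω) :
    (A - h x t) ^ r ≤ (|A| + M / m) ^ q := by
  have h1 := one_le_sub hA ht hx
  refine (Real.rpow_le_rpow_of_exponent_le h1 hr).trans (Real.rpow_le_rpow (by linarith) ?_ hq)
  have := R.h_bound hx ⟨hs.trans ht.1, ht.2⟩
  linarith [neg_abs_le (h x t), le_abs_self A]

lemma continuousOn_sub_rpow (R : FDRatio Ω φ p b T M m m' u v w h) (hs : 0 ≤ s)
    (hA : ∀ x ∈ Ω, ∀ t ∈ Icc s T, h x t ≤ A - 1) (q : ℝ) {t : ℝ} (ht : t ∈ Icc s T) :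
    ContinuousOn (fun x => (A - h x t) ^ q) Ω :=
  (continuousOn_const.sub (R.h_smooth ⟨hs.trans ht.1, ht.2⟩).continuousOn).rpow_const
    fun _ hx => Or.inl (ne_of_gt (lt_of_lt_of_le one_pos (one_le_sub hA ht hx)))

lemma continuousOn_density (R : FDRatio Ω φ p b T M m m' u v w h) (hs : 0 ≤ s)
    (hA : ∀ x ∈ Ω, ∀ t ∈ Icc s T, h x t ≤ A - 1) (q : ℝ) {t : ℝ} (ht : t ∈ Icc s T) :
    ContinuousOn (fun x => u x t ^ (p + 1) * (A - h x t) ^ q) Ω :=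
  (R.continuousOn_rpow (p + 1) ⟨hs.trans ht.1, ht.2⟩).mul (R.continuousOn_sub_rpow hs hA q ht)

lemma exists_density_le (R : FDRatio Ω φ p b T M m m' u v w h) (D : DefiningFun Ω φ) (hs : 0 ≤ s)
    (hA : ∀ x ∈ Ω, ∀ t ∈ Icc s T, h x t ≤ A - 1) (q : ℝ) :
    ∃ K, ∀ t ∈ Icc s T, ∀ x ∈ Ω, |u x t ^ (p + 1) * (A - h x t) ^ q| ≤ K := by
  obtain ⟨K, hK, hKb⟩ := R.exists_rpow_le D (q := p + 1) (by linarith [R.one_lt])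
  refine ⟨K * (|A| + M / m) ^ |q|, fun t ht x hx => ?_⟩
  have htI : t ∈ Icc 0 T := ⟨hs.trans ht.1, ht.2⟩
  have h1 : 0 ≤ A - h x t := by linarith [one_le_sub hA ht hx]
  have h2 := (R.u_pos x hx t htI).le
  rw [abs_of_nonneg (by positivity)]
  exact mul_le_mul (hKb x hx t htI) (R.sub_rpow_le hs hA (le_abs_self q) (abs_nonneg q) ht hx)
    (by positivity) hK

lemma density_nonneg (R : FDRatio Ω φ p b T M m m' u v w h) (hs : 0 ≤ s)
    (hA : ∀ x ∈ Ω, ∀ t ∈ Icc s T, h x t ≤ A - 1) (q : ℝ) {t : ℝ} (ht : t ∈ Icc s T)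
    {x : EuclideanSpace ℝ (Fin n)} (hx : x ∈ Ω) : 0 ≤ u x t ^ (p + 1) * (A - h x t) ^ q := by
  have h1 : 0 ≤ A - h x t := by linarith [one_le_sub hA ht hx]
  have h2 := (R.u_pos x hx t ⟨hs.trans ht.1, ht.2⟩).le
  positivity

lemma integrableOn_density (R : FDRatio Ω φ p b T M m m' u v w h) (D : DefiningFun Ω φ) (hs : 0 ≤ s)
    (hA : ∀ x ∈ Ω, ∀ t ∈ Icc s T, h x t ≤ A - 1) (q : ℝ) {t : ℝ} (ht : t ∈ Icc s T) :
    IntegrableOn (fun x => u x t ^ (p + 1) * (A - h x t) ^ q) Ω := by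
  obtain ⟨K, hK⟩ := R.exists_density_le D hs hA q
  exact D.integrableOn_of_bound (R.continuousOn_density hs hA q ht) (hK t ht)

lemma powerEnergy_nonneg (R : FDRatio Ω φ p b T M m m' u v w h) (D : DefiningFun Ω φ) (hs : 0 ≤ s)
    (hA : ∀ x ∈ Ω, ∀ t ∈ Icc s T, h x t ≤ A - 1) (q : ℝ) {t : ℝ} (ht : t ∈ Icc s T) :
    0 ≤ powerEnergy Ω p A u h q t :=
  setIntegral_nonneg D.isOpen.measurableSet fun _ hx => R.density_nonneg hs hA q ht hx

lemma continuousOn_powerEnergy (R : FDRatio Ω φ p b T M m m' u v w h) (D : DefiningFun Ω φ)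
    (hs : 0 ≤ s) (hA : ∀ x ∈ Ω, ∀ t ∈ Icc s T, h x t ≤ A - 1) (q : ℝ) :
    ContinuousOn (powerEnergy Ω p A u h q) (Icc s T) := by
  obtain ⟨K, hK⟩ := R.exists_density_le D hs hA q
  have hsub : Icc s T ⊆ Icc 0 T := Icc_subset_Icc_left hs
  refine D.continuousOn_setIntegral (fun t ht => R.continuousOn_density hs hA q ht) hK
    fun x hx => ?_
  exact ((R.continuousOn_rpowT (p + 1) hx).mono hsub).mul
    ((continuousOn_const.sub ((R.h_contT hx).mono hsub)).rpow_const
      fun t ht => Or.inl (ne_of_gt (lt_of_lt_of_le one_pos (one_le_sub hA ht hx))))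

lemma powerEnergy_le_add (R : FDRatio Ω φ p b T M m m' u v w h) (D : DefiningFun Ω φ)
    (hs : 0 ≤ s) (hA : ∀ x ∈ Ω, ∀ t ∈ Icc s T, h x t ≤ A - 1) {q q₁ q₂ a₁ a₂ : ℝ}
    (hle : ∀ k : ℝ, 1 ≤ k → k ^ q ≤ a₁ * k ^ q₁ + a₂ * k ^ q₂) {t : ℝ} (ht : t ∈ Icc s T) :
    powerEnergy Ω p A u h q t ≤
      a₁ * powerEnergy Ω p A u h q₁ t + a₂ * powerEnergy Ω p A u h q₂ t := by
  simp only [powerEnergy]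
  have I1 := (R.integrableOn_density D hs hA q₁ ht).const_mul a₁
  have I2 := (R.integrableOn_density D hs hA q₂ ht).const_mul a₂
  rw [← integral_const_mul, ← integral_const_mul, ← integral_add I1 I2]
  refine setIntegral_mono_on (R.integrableOn_density D hs hA q ht) (I1.add I2)
    D.isOpen.measurableSet fun x hx => ?_
  have h2 := Real.rpow_nonneg (R.u_pos x hx t ⟨hs.trans ht.1, ht.2⟩).le (p + 1)
  have := mul_le_mul_of_nonneg_left (hle _ (one_le_sub hA ht hx)) h2
  linarith

lemma powerEnergy_holder (R : FDRatio Ω φ p b T M m m' u v w h) (D : DefiningFun Ω φ)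
    (hs : 0 ≤ s) (hA : ∀ x ∈ Ω, ∀ t ∈ Icc s T, h x t ≤ A - 1) {κ : ℝ} (h0 : 0 < κ) (h1 : κ < 1)
    (q₁ q₂ : ℝ) {t : ℝ} (ht : t ∈ Icc s T) :
    powerEnergy Ω p A u h (q₁ * (1 - κ) + q₂ * κ) t ≤
      powerEnergy Ω p A u h q₁ t ^ (1 - κ) * powerEnergy Ω p A u h q₂ t ^ κ := by
  have h1' : 0 < 1 - κ := by linarith
  have hm := D.isOpen.measurableSet
  have hconj : (1 / (1 - κ)).HolderConjugate (1 / κ) := by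
    rw [Real.holderConjugate_iff]
    refine ⟨by rw [lt_div_iff₀ h1']; linarith, by field_simp; ring⟩
  have hkey : ∀ (r α : ℝ), 0 < α → 0 ≤ᵐ[volume.restrict Ω]
      (fun x => (u x t ^ (p + 1) * (A - h x t) ^ r) ^ α) ∧
      MemLp (fun x => (u x t ^ (p + 1) * (A - h x t) ^ r) ^ α) (ENNReal.ofReal (1 / α))
        (volume.restrict Ω) := by
    intro r α hα
    obtain ⟨K, hK⟩ := R.exists_density_le D hs hA r
    refine ⟨(ae_restrict_iff' hm).2 (ae_of_all _ fun x hx =>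
      Real.rpow_nonneg (R.density_nonneg hs hA r ht hx) _), ?_⟩
    have : IsFiniteMeasure (volume.restrict Ω) :=
      ⟨by rw [Measure.restrict_apply_univ]; exact D.volume_lt_top⟩
    refine MemLp.of_bound (C := |K| ^ α) (((R.continuousOn_density hs hA r ht).rpow_const
      fun x hx => Or.inr hα.le).aestronglyMeasurable hm)
      ((ae_restrict_iff' hm).2 (ae_of_all _ fun x hx => ?_))
    have h2 := R.density_nonneg hs hA r ht hx
    rw [Real.norm_eq_abs, abs_of_nonneg (Real.rpow_nonneg h2 _)]
    exact Real.rpow_le_rpow h2 ((le_abs_self _).trans ((hK t ht x hx).trans (le_abs_self K))) hα.le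
  have := integral_mul_le_Lp_mul_Lq_of_nonneg hconj (hkey q₁ (1 - κ) h1').1 (hkey q₂ κ h0).1
    (hkey q₁ (1 - κ) h1').2 (hkey q₂ κ h0).2
  simp only [one_div, inv_inv] at this
  have e : ∀ (r α : ℝ), 0 < α → ∫ x in Ω, ((u x t ^ (p + 1) * (A - h x t) ^ r) ^ α) ^ α⁻¹ =
      powerEnergy Ω p A u h r t := fun r α hα => by
    refine setIntegral_congr_fun hm fun x hx => ?_
    rw [← Real.rpow_mul (R.density_nonneg hs hA r ht hx), mul_inv_cancel₀ hα.ne', Real.rpow_one]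
  rw [e _ _ h1', e _ _ h0] at this
  refine le_trans (le_of_eq (setIntegral_congr_fun hm fun x hx => ?_)) this
  have hk : 0 < A - h x t := by linarith [one_le_sub hA ht hx]
  have hu := Real.rpow_pos_of_pos (R.u_pos x hx t ⟨hs.trans ht.1, ht.2⟩) (p + 1)
  rw [Real.mul_rpow hu.le (by positivity), Real.mul_rpow hu.le (by positivity),
    ← Real.rpow_mul hk.le, ← Real.rpow_mul hk.le, mul_mul_mul_comm, ← Real.rpow_add hu,
    ← Real.rpow_add hk, sub_add_cancel, Real.rpow_one]

end FDRatio

end PowerEnergy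

section PowerEnergyInequality

variable {n : ℕ} {Ω : Set (EuclideanSpace ℝ (Fin n))} {φ : EuclideanSpace ℝ (Fin n) → ℝ}

/-- The weighted Dirichlet integral `∫ (A - h) ^ (q - 2) u ^ 2 |∇h| ^ 2`. -/
def powerDirichlet (Ω : Set (EuclideanSpace ℝ (Fin n))) (A : ℝ)
    (u h : EuclideanSpace ℝ (Fin n) → ℝ → ℝ) (q t : ℝ) : ℝ :=
  ∫ x in Ω, (A - h x t) ^ (q - 2) * (u x t ^ 2 * gradSq (fun y => h y t) x)

namespace FDRatio

variable {p b T M m m' A s : ℝ} {u v w h : EuclideanSpace ℝ (Fin n) → ℝ → ℝ}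

lemma abs_mul_pderiv'_le (R : FDRatio Ω φ p b T M m m' u v w h) (D : DefiningFun Ω φ) {t : ℝ}
    (ht : t ∈ Icc 0 T) {x : EuclideanSpace ℝ (Fin n)} (hx : x ∈ Ω) (i : Fin n) :
    |u x t * pderiv' i (fun y => h y t) x| ≤ M + M / m * M := by
  have d1 := ContDiffOn.differentiableAt_mem D.isOpen (m := 1) (R.h_smooth ht) le_rfl hx
  have d2 := ContDiffOn.differentiableAt_mem D.isOpen (m := 2) (R.u_smooth t ht) (by norm_num) hx
  have e1 : pderiv' i (fun y => v y t) x =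
      h x t * pderiv' i (fun y => u y t) x + pderiv' i (fun y => h y t) x * u x t := by
    rw [pderiv'_congr D.isOpen (g := fun y => h y t * u y t) (fun y hy => R.v_eq hy ht) hx i]
    exact pderiv'_mul d1 d2 i
  have hM := R.M_pos
  have hm := R.m_pos
  rw [show u x t * pderiv' i (fun y => h y t) x =
    pderiv' i (fun y => v y t) x - h x t * pderiv' i (fun y => u y t) x by rw [e1]; ring]
  refine (abs_sub _ _).trans (add_le_add (R.dv_bound i x hx t ht) ?_)
  rw [abs_mul]
  exact mul_le_mul (R.h_bound hx ht) (R.du_bound i x hx t ht) (abs_nonneg _) (by positivity)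

lemma integrableOn_powerDirichlet (R : FDRatio Ω φ p b T M m m' u v w h) (D : DefiningFun Ω φ)
    (hs : 0 ≤ s) (hA : ∀ x ∈ Ω, ∀ t ∈ Icc s T, h x t ≤ A - 1) (q : ℝ) {t : ℝ}
    (ht : t ∈ Icc s T) :
    IntegrableOn (fun x => (A - h x t) ^ (q - 2) * (u x t ^ 2 * gradSq (fun y => h y t) x)) Ω := by
  have htI : t ∈ Icc 0 T := ⟨hs.trans ht.1, ht.2⟩
  refine D.integrableOn_of_bound ((R.continuousOn_sub_rpow hs hA (q - 2) ht).mul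
    (((R.u_smooth t htI).continuousOn.pow 2).mul (continuousOn_gradSq D.isOpen (R.h_smooth htI))))
    (M := (|A| + M / m) ^ |q - 2| * ∑ _i : Fin n, (M + M / m * M) ^ 2) fun x hx => ?_
  have h1 : 0 < A - h x t := by linarith [one_le_sub hA ht hx]
  have h2 : u x t ^ 2 * gradSq (fun y => h y t) x =
      ∑ i, (u x t * pderiv' i (fun y => h y t) x) ^ 2 := by
    simp only [gradSq, Finset.mul_sum, mul_pow]
  rw [h2, abs_of_nonneg (by positivity)]
  refine mul_le_mul (R.sub_rpow_le hs hA (le_abs_self _) (abs_nonneg _) ht hx)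
    (Finset.sum_le_sum fun i _ => ?_) (by positivity) ?_
  · rw [← sq_abs]
    exact pow_le_pow_left₀ (abs_nonneg _) (R.abs_mul_pderiv'_le D htI hx i) 2
  · have := R.m_pos
    have := R.M_pos
    positivity

lemma powerDirichlet_nonneg (D : DefiningFun Ω φ)
    (hA : ∀ x ∈ Ω, ∀ t ∈ Icc s T, h x t ≤ A - 1) (q : ℝ) {t : ℝ} (ht : t ∈ Icc s T) :
    0 ≤ powerDirichlet Ω A u h q t :=
  setIntegral_nonneg D.isOpen.measurableSet fun x hx => by
    have h1 : 0 < A - h x t := by linarith [one_le_sub hA ht hx]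
    have := gradSq_nonneg (fun y => h y t) x
    positivity

/-- The energy inequality for `∫ u ^ (p + 1) (A - h) ^ q`, before using a Sobolev inequality. -/
lemma hasDerivAt_powerEnergy (R : FDRatio Ω φ p b T M m m' u v w h) (D : DefiningFun Ω φ)
    (hs : 0 ≤ s) (hA0 : 0 < A) (hA : ∀ x ∈ Ω, ∀ t ∈ Icc s T, h x t ≤ A - 1) {q : ℝ} (hq : 1 ≤ q)
    {t : ℝ} (ht : t ∈ Ioo s T) :
    ∃ d, HasDerivAt (powerEnergy Ω p A u h q) d t ∧
      d ≤ ((p - 1) * q - (p + 1)) * powerEnergy Ω p A u h (q + 1) t +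
        ((p + 1) * A + (p - 1) * A ^ 2 + (p - 1)) * q * powerEnergy Ω p A u h q t -
        1 / p * (q * (q - 1)) * powerDirichlet Ω A u h q t := by
  have hp := R.one_lt
  have hM := R.M_pos
  have hm := R.m_pos
  set H := M / m with hH
  have hH0 : 0 ≤ H := by positivity
  set N := (|A| + H) ^ q with hN
  have hN0 : 0 ≤ N := by positivity
  set K := (q ^ 2 + q + 1) * N with hK
  have hIcc : ∀ {r}, r ∈ Ioo s T → r ∈ Icc s T := fun hr => Ioo_subset_Icc_self hr
  have hk0 : ∀ r ∈ Ioo s T, ∀ x ∈ Ω, 0 < A - h x r := fun r hr x hx => by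
    linarith [one_le_sub hA (hIcc hr) hx]
  have hd : ∀ a r : ℝ, r ∈ Iio A →
      HasDerivAt (fun r => (A - r) ^ a) (-(a * (A - r) ^ (a - 1))) r := by
    intro a r hr
    have h1 : HasDerivAt (fun r => A - r) (-1) r := by
      simpa using (hasDerivAt_id r).const_sub A
    exact (h1.rpow_const (p := a) (Or.inl (sub_pos.2 hr).ne')).congr_deriv (by ring)
  have hderiv : ∀ r ∈ Iio A, deriv (fun r => -q * (A - r) ^ (q - 1)) r =
      q * (q - 1) * (A - r) ^ (q - 2) := fun r hr => by
    rw [((hd (q - 1) r hr).const_mul (-q)).deriv, show q - 1 - 1 = q - 2 by ring]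
    ring
  have cont : ∀ a : ℝ, ContinuousOn (fun r => (A - r) ^ a) (Iio A) := fun a r hr =>
    (hd a r hr).continuousAt.continuousWithinAt
  obtain ⟨I, hE⟩ := R.hasDerivAt_energy D (S := Iio A) isOpen_Iio
    (Φ := fun _ r => (A - r) ^ q) (Φt := fun _ _ => 0) (ψ := fun _ r => -q * (A - r) ^ (q - 1))
    (s := s) (e := T) (K := K) hs le_rfl (by positivity)
    (fun r hr x hx => sub_pos.1 (hk0 r hr x hx))
    (fun _ _ => cont q) (fun _ _ => continuousOn_const)
    (fun _ _ => contDiffOn_const.mul ((contDiffOn_const.sub contDiffOn_id).rpow_const_of_ne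
      fun r hr => (sub_pos.2 hr).ne'))
    (fun r hr x hx => by
      have h1 := R.sub_rpow_le hs hA (le_refl q) (by linarith) (hIcc hr) hx
      have h0 := hk0 r hr x hx
      rw [abs_of_nonneg (by positivity)]
      have : 0 ≤ (q ^ 2 + q) * N := by positivity
      simp only [hK, hN, hH] at *
      linarith)
    (fun r hr x hx => by rw [abs_zero]; positivity)
    (fun r hr x hx => by
      have h1 := R.sub_rpow_le hs hA (by linarith : q - 1 ≤ q) (by linarith) (hIcc hr) hx
      have h0 := hk0 r hr x hx
      have h2 : q * (A - h x r) ^ (q - 1) ≤ q * N := by gcongr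
      rw [neg_mul, abs_neg, abs_of_nonneg (by positivity)]
      have : 0 ≤ (q ^ 2 + 1) * N := by positivity
      rw [hK]
      linarith)
    (fun r hr x hx => by
      have h1 := R.sub_rpow_le hs hA (by linarith : q - 2 ≤ q) (by linarith) (hIcc hr) hx
      have h0 := hk0 r hr x hx
      have hq1 : 0 ≤ q - 1 := by linarith
      have h2 : q * (q - 1) * (A - h x r) ^ (q - 2) ≤ q * (q - 1) * N := by gcongr
      rw [hderiv _ (sub_pos.1 h0), abs_of_nonneg (by positivity)]
      have : 0 ≤ (2 * q + 1) * N := by positivity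
      rw [hK]
      linarith)
    (fun r hr η η' hη hη' => by
      refine ((hd q (η r) hη).comp r hη').congr_deriv ?_
      ring) ht
  refine ⟨_, hE, ?_⟩
  have ht' := hIcc ht
  have J1 := (R.integrableOn_density D hs hA (q + 1) ht').const_mul ((p - 1) * q - (p + 1))
  have J2 := (R.integrableOn_density D hs hA q ht').const_mul
    (((p + 1) * A + (p - 1) * A ^ 2 + (p - 1)) * q)
  have e2 : ∫ x in Ω, deriv (fun r => -q * (A - r) ^ (q - 1)) (h x t) *
      (u x t ^ 2 * gradSq (fun y => h y t) x) = q * (q - 1) * powerDirichlet Ω A u h q t := by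
    rw [powerDirichlet, ← integral_const_mul]
    refine setIntegral_congr_fun D.isOpen.measurableSet fun x hx => ?_
    rw [hderiv _ (sub_pos.1 (hk0 t ht x hx))]
    ring
  rw [e2]
  have e3 : (∫ x in Ω, u x t ^ (p + 1) * ((p + 1) * h x t * (A - h x t) ^ q + 0 +
      -q * (A - h x t) ^ (q - 1) * ((p - 1) / p * h x t - (p - 1) * h x t ^ 2))) ≤
      ((p - 1) * q - (p + 1)) * powerEnergy Ω p A u h (q + 1) t +
        ((p + 1) * A + (p - 1) * A ^ 2 + (p - 1)) * q * powerEnergy Ω p A u h q t := by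
    simp only [powerEnergy]
    rw [← integral_const_mul, ← integral_const_mul, ← integral_add J1 J2]
    refine setIntegral_mono_on I (J1.add J2) D.isOpen.measurableSet fun x hx => ?_
    have hu := Real.rpow_nonneg (R.u_pos x hx t ⟨hs.trans ht'.1, ht'.2⟩).le (p + 1)
    have hk1 := one_le_sub hA ht' hx
    generalize hk : A - h x t = k at hk1 ⊢
    have hh : h x t = A - k := by linarith
    have e4 : k ^ (q + 1) = k ^ q * k := Real.rpow_add_one (by linarith) q
    have e5 : k ^ q = k ^ (q - 1) * k := by
      rw [← Real.rpow_add_one (by linarith)]; congr 1; ring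
    have h0 : 0 ≤ k ^ (q - 1) := Real.rpow_nonneg (by linarith) _
    have hp1 : 0 ≤ p - 1 := by linarith
    have hpp : (p - 1) / p ≤ p - 1 := div_le_self hp1 hp.le
    have hpp0 : 0 ≤ (p - 1) / p := by positivity
    rw [hh, e4, e5]
    generalize k ^ (q - 1) = P at h0 ⊢
    have hmain : (p + 1) * (A - k) * (P * k) + 0 +
        -q * P * ((p - 1) / p * (A - k) - (p - 1) * (A - k) ^ 2) ≤
        ((p - 1) * q - (p + 1)) * (P * k * k) +
          ((p + 1) * A + (p - 1) * A ^ 2 + (p - 1)) * q * (P * k) := by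
      have f1 : 0 ≤ (p + 1) * A * (P * k) * (q - 1) := by
        have : 0 ≤ q - 1 := by linarith
        positivity
      have f2 : 0 ≤ q * (p - 1) * P * A ^ 2 * (k - 1) := by
        have : 0 ≤ k - 1 := by linarith
        positivity
      have f3 : 0 ≤ q * (p - 1) * P * (2 * A * k) := by positivity
      have f4 : 0 ≤ q * P * ((p - 1) / p) * A := by positivity
      have f5 : 0 ≤ q * P * k * ((p - 1) - (p - 1) / p) := by
        have : 0 ≤ (p - 1) - (p - 1) / p := by linarith
        positivity
      linarith
    have := mul_le_mul_of_nonneg_left hmain hu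
    linarith
  linarith

/-- The Sobolev inequality applied to `(A - h) ^ (q / 2)`. -/
lemma powerEnergy_rpow_le (R : FDRatio Ω φ p b T M m m' u v w h) (D : DefiningFun Ω φ) {C : ℝ}
    (hC : 0 < C) (hsob : ∀ f : EuclideanSpace ℝ (Fin n) → ℝ, ContDiffOn ℝ 1 f Ω →
      ∀ M, (∀ x ∈ Ω, |f x| ≤ M) → (∀ i, ∀ x ∈ Ω, φ x * |pderiv' i f x| ≤ M) →
      (∫ x in Ω, |φ x * f x| ^ (p + 1)) ^ (2 / (p + 1)) ≤
        C * ∫ x in Ω, (φ x ^ 2 * gradSq f x + φ x ^ (p + 1) * f x ^ 2))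
    (hs : 0 ≤ s) (hA : ∀ x ∈ Ω, ∀ t ∈ Icc s T, h x t ≤ A - 1) {q : ℝ} (hq : 0 ≤ q)
    {t : ℝ} (ht : t ∈ Icc s T) :
    powerEnergy Ω p A u h (q * ((p + 1) / 2)) t ^ (2 / (p + 1)) ≤
      m' ^ 2 * C * ((m ^ 2)⁻¹ + (m ^ (p + 1))⁻¹) *
        (q ^ 2 * powerDirichlet Ω A u h q t + powerEnergy Ω p A u h q t) := by
  have hp := R.one_lt
  have hM := R.M_pos
  have hm := R.m_pos
  have hm' := R.m'_pos
  have htI : t ∈ Icc 0 T := ⟨hs.trans ht.1, ht.2⟩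
  have hp0 : 0 < p + 1 := by linarith
  set N := (|A| + M / m) ^ q with hN
  have hN0 : 0 ≤ N := by positivity
  have hk0 : ∀ x ∈ Ω, 0 < A - h x t := fun x hx => by linarith [one_le_sub hA ht hx]
  have hφ0 : ∀ x ∈ Ω, 0 < φ x := fun x hx => (D.mem_iff x).1 hx
  have hk : ContDiffOn ℝ 1 (fun x => A - h x t) Ω := contDiffOn_const.sub (R.h_smooth htI)
  have hf : ContDiffOn ℝ 1 (fun x => (A - h x t) ^ (q / 2)) Ω :=
    hk.rpow_const_of_ne fun x hx => (hk0 x hx).ne'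
  have hpd : ∀ i, ∀ x ∈ Ω, pderiv' i (fun x => (A - h x t) ^ (q / 2)) x =
      -(q / 2 * (A - h x t) ^ (q / 2 - 1)) * pderiv' i (fun y => h y t) x := by
    intro i x hx
    have h1 : HasDerivAt (fun r => A - r) (-1) (h x t) := by
      simpa using (hasDerivAt_id (h x t)).const_sub A
    have h2 : HasDerivAt (fun r => (A - r) ^ (q / 2)) (-(q / 2 * (A - h x t) ^ (q / 2 - 1)))
        (h x t) := (h1.rpow_const (p := q / 2) (Or.inl (hk0 x hx).ne')).congr_deriv (by ring)
    exact pderiv'_comp (f := fun y => h y t) h2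
      (ContDiffOn.differentiableAt_mem D.isOpen (m := 1) (R.h_smooth htI) le_rfl hx) i
  have hgrad : ∀ x ∈ Ω, gradSq (fun x => (A - h x t) ^ (q / 2)) x =
      q ^ 2 / 4 * ((A - h x t) ^ (q - 2) * gradSq (fun y => h y t) x) := by
    intro x hx
    have e : ((A - h x t) ^ (q / 2 - 1)) ^ 2 = (A - h x t) ^ (q - 2) := by
      rw [← Real.rpow_mul_natCast (hk0 x hx).le]; congr 1; push_cast; ring
    simp only [gradSq, Finset.mul_sum]
    refine Finset.sum_congr rfl fun i _ => ?_
    rw [hpd i x hx, ← e]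
    ring
  have key := hsob _ hf (N + 1 / m * (q / 2 * N * (M + M / m * M)))
    (fun x hx => by
      rw [abs_of_nonneg (Real.rpow_nonneg (hk0 x hx).le _)]
      have := R.sub_rpow_le hs hA (by linarith : q / 2 ≤ q) hq ht hx
      have h2 : 0 ≤ 1 / m * (q / 2 * N * (M + M / m * M)) := by positivity
      linarith)
    (fun i x hx => by
      have h1 := R.sub_rpow_le hs hA (by linarith : q / 2 - 1 ≤ q) hq ht hx
      have h2 := R.abs_mul_pderiv'_le D htI hx i
      have h3 : φ x ≤ 1 / m * u x t := by
        rw [one_div, inv_mul_eq_div, le_div_iff₀ hm]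
        linarith [R.u_lower x hx t htI]
      have h4 := Real.rpow_nonneg (hk0 x hx).le (q / 2 - 1)
      rw [abs_mul, abs_of_pos (R.u_pos x hx t htI)] at h2
      rw [hpd i x hx, abs_mul, abs_neg, abs_of_nonneg (by positivity)]
      calc φ x * (q / 2 * (A - h x t) ^ (q / 2 - 1) * |pderiv' i (fun y => h y t) x|)
          ≤ (1 / m * u x t) * (q / 2 * (A - h x t) ^ (q / 2 - 1) *
            |pderiv' i (fun y => h y t) x|) := by gcongr
        _ = 1 / m * (q / 2 * (A - h x t) ^ (q / 2 - 1) *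
            (u x t * |pderiv' i (fun y => h y t) x|)) := by ring
        _ ≤ 1 / m * (q / 2 * N * (M + M / m * M)) := by
            have := (R.u_pos x hx t htI).le
            gcongr
        _ ≤ _ := by linarith)
  have I1 := R.integrableOn_density D hs hA q ht
  have I2 := R.integrableOn_powerDirichlet D hs hA q ht
  have hY := R.powerEnergy_nonneg D hs hA q ht
  have hD := powerDirichlet_nonneg (u := u) D hA q ht
  have hright : ∫ x in Ω, (φ x ^ 2 * gradSq (fun x => (A - h x t) ^ (q / 2)) x +
      φ x ^ (p + 1) * ((A - h x t) ^ (q / 2)) ^ 2) ≤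
      q ^ 2 / 4 * (m ^ 2)⁻¹ * powerDirichlet Ω A u h q t +
        (m ^ (p + 1))⁻¹ * powerEnergy Ω p A u h q t := by
    simp only [powerEnergy, powerDirichlet]
    have I2' := I2.const_mul (q ^ 2 / 4 * (m ^ 2)⁻¹)
    have I1' := I1.const_mul ((m ^ (p + 1))⁻¹)
    rw [← integral_const_mul, ← integral_const_mul, ← integral_add I2' I1']
    have hle : ∀ x ∈ Ω, φ x ^ 2 * gradSq (fun x => (A - h x t) ^ (q / 2)) x +
        φ x ^ (p + 1) * ((A - h x t) ^ (q / 2)) ^ 2 ≤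
        q ^ 2 / 4 * (m ^ 2)⁻¹ * ((A - h x t) ^ (q - 2) *
          (u x t ^ 2 * gradSq (fun y => h y t) x)) +
        (m ^ (p + 1))⁻¹ * (u x t ^ (p + 1) * (A - h x t) ^ q) := by
      intro x hx
      have h3 := R.u_lower x hx t htI
      have hg := gradSq_nonneg (fun y => h y t) x
      have hφx := (hφ0 x hx).le
      have hkx := (hk0 x hx).le
      have h4 : φ x ^ 2 ≤ (m ^ 2)⁻¹ * u x t ^ 2 := by
        rw [inv_mul_eq_div, le_div_iff₀ (by positivity), mul_comm, ← mul_pow]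
        gcongr
      have h5 : φ x ^ (p + 1) ≤ (m ^ (p + 1))⁻¹ * u x t ^ (p + 1) := by
        rw [inv_mul_eq_div, le_div_iff₀ (by positivity), mul_comm, ← Real.mul_rpow hm.le hφx]
        gcongr
      have e : ((A - h x t) ^ (q / 2)) ^ 2 = (A - h x t) ^ q := by
        rw [← Real.rpow_mul_natCast hkx]; congr 1; push_cast; ring
      rw [hgrad x hx, e]
      refine add_le_add ?_ ?_
      · calc φ x ^ 2 * (q ^ 2 / 4 * ((A - h x t) ^ (q - 2) * gradSq (fun y => h y t) x))
            ≤ (m ^ 2)⁻¹ * u x t ^ 2 *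
              (q ^ 2 / 4 * ((A - h x t) ^ (q - 2) * gradSq (fun y => h y t) x)) := by gcongr
          _ = _ := by ring
      · calc φ x ^ (p + 1) * (A - h x t) ^ q
            ≤ (m ^ (p + 1))⁻¹ * u x t ^ (p + 1) * (A - h x t) ^ q := by gcongr
          _ = _ := by ring
    refine setIntegral_mono_on ((I2'.add I1').mono' (ContinuousOn.aestronglyMeasurable ?_
      D.isOpen.measurableSet) ((ae_restrict_iff' D.isOpen.measurableSet).2
        (ae_of_all _ fun x hx => ?_))) (I2'.add I1') D.isOpen.measurableSet hle
    · exact ((D.smooth.continuous.continuousOn.pow 2).mul (continuousOn_gradSq D.isOpen hf)).add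
        ((D.smooth.continuous.continuousOn.rpow_const fun x hx => Or.inl (hφ0 x hx).ne').mul
          (hf.continuousOn.pow 2))
    · have hg := gradSq_nonneg (fun x => (A - h x t) ^ (q / 2)) x
      have hφx := (hφ0 x hx).le
      have hkx := (hk0 x hx).le
      rw [Real.norm_eq_abs, abs_of_nonneg (by positivity)]
      exact hle x hx
  have hleft : powerEnergy Ω p A u h (q * ((p + 1) / 2)) t ≤
      m' ^ (p + 1) * ∫ x in Ω, |φ x * (A - h x t) ^ (q / 2)| ^ (p + 1) := by
    rw [powerEnergy, ← integral_const_mul]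
    obtain ⟨L, hL, hLb⟩ := D.bound_closure D.smooth.continuous
    refine setIntegral_mono_on (R.integrableOn_density D hs hA _ ht)
      ((D.integrableOn_of_bound (M := (L * N) ^ (p + 1)) ?_ fun x hx => ?_).const_mul _)
      D.isOpen.measurableSet fun x hx => ?_
    · exact ((D.smooth.continuous.continuousOn.mul hf.continuousOn).abs).rpow_const
        fun x hx => Or.inr hp0.le
    · rw [abs_of_nonneg (by positivity), abs_mul]
      have h1 := hLb x (subset_closure hx)
      have h2 := R.sub_rpow_le hs hA (by linarith : q / 2 ≤ q) hq ht hx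
      rw [← abs_of_nonneg (Real.rpow_nonneg (hk0 x hx).le (q / 2))] at h2
      gcongr
    · have hφx := (hφ0 x hx).le
      have hkx := (hk0 x hx).le
      rw [abs_of_nonneg (by positivity), Real.mul_rpow hφx (by positivity), ← Real.rpow_mul hkx,
        ← mul_assoc, ← Real.mul_rpow hm'.le hφx, show q / 2 * (p + 1) = q * ((p + 1) / 2) by ring]
      have h1 := R.u_upper x hx t htI
      have h2 := (R.u_pos x hx t htI).le
      gcongr
  have hint : 0 ≤ ∫ x in Ω, |φ x * (A - h x t) ^ (q / 2)| ^ (p + 1) :=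
    setIntegral_nonneg D.isOpen.measurableSet fun x _ => by positivity
  have e1 : (m' ^ (p + 1)) ^ (2 / (p + 1)) = m' ^ 2 := by
    rw [← Real.rpow_mul hm'.le, mul_div_cancel₀ _ hp0.ne']; norm_cast
  calc powerEnergy Ω p A u h (q * ((p + 1) / 2)) t ^ (2 / (p + 1))
      ≤ (m' ^ (p + 1) * ∫ x in Ω, |φ x * (A - h x t) ^ (q / 2)| ^ (p + 1)) ^ (2 / (p + 1)) :=
        Real.rpow_le_rpow (R.powerEnergy_nonneg D hs hA _ ht) hleft (by positivity)
    _ = m' ^ 2 * (∫ x in Ω, |φ x * (A - h x t) ^ (q / 2)| ^ (p + 1)) ^ (2 / (p + 1)) := by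
        rw [Real.mul_rpow (by positivity) hint, e1]
    _ ≤ m' ^ 2 * (C * (q ^ 2 / 4 * (m ^ 2)⁻¹ * powerDirichlet Ω A u h q t +
        (m ^ (p + 1))⁻¹ * powerEnergy Ω p A u h q t)) := by
        gcongr
        exact key.trans (by gcongr)
    _ ≤ _ := by
        have f1 : 0 ≤ 3 / 4 * (q ^ 2 * (m ^ 2)⁻¹ * powerDirichlet Ω A u h q t) := by positivity
        have f2 : 0 ≤ q ^ 2 * (m ^ (p + 1))⁻¹ * powerDirichlet Ω A u h q t := by positivity
        have f3 : 0 ≤ (m ^ 2)⁻¹ * powerEnergy Ω p A u h q t := by positivity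
        refine (mul_le_mul_of_nonneg_left (mul_le_mul_of_nonneg_left
          (?_ : _ ≤ ((m ^ 2)⁻¹ + (m ^ (p + 1))⁻¹) * (q ^ 2 * powerDirichlet Ω A u h q t +
            powerEnergy Ω p A u h q t)) hC.le) (sq_nonneg m')).trans (le_of_eq (by ring))
        linarith

end FDRatio

end PowerEnergyInequality

section Moser

lemma sub_le_integral_of_hasDerivAt_le {g G : ℝ → ℝ} {α β : ℝ} (hαβ : α ≤ β)
    (hg : ContinuousOn g (Icc α β)) (hG : ContinuousOn G (Icc α β))
    (hd : ∀ t ∈ Ioo α β, ∃ d, HasDerivAt g d t ∧ d ≤ G t) :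
    g β - g α ≤ ∫ t in α..β, G t := by
  choose! d hd1 hd2 using hd
  exact intervalIntegral.sub_le_integral_of_hasDeriv_right_of_le hαβ hg
    (fun t ht => (hd1 t ht).hasDerivWithinAt) hG.integrableOn_Icc hd2

lemma integral_mono_of_subset {G : ℝ → ℝ} {α β γ δ : ℝ} (h1 : α ≤ β) (h2 : β ≤ γ) (h3 : γ ≤ δ)
    (hG : ContinuousOn G (Icc α δ)) (h0 : ∀ t ∈ Icc α δ, 0 ≤ G t) :
    ∫ t in β..γ, G t ≤ ∫ t in α..δ, G t := by
  have hαδ := h1.trans (h2.trans h3)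
  refine intervalIntegral.integral_mono_interval h1 h2 h3
    ((ae_restrict_iff' measurableSet_Ioc).2 (ae_of_all _ fun t ht => h0 t ⟨ht.1.le, ht.2⟩))
    (hG.intervalIntegrable_of_Icc hαδ)

/-- Local-in-time bounds from a differential inequality `Y' ≤ A Y - D`. -/
lemma add_integral_le_of_deriv_le {Y D : ℝ → ℝ} {s s' e A : ℝ} (hs : s < s') (hA : 0 ≤ A)
    (hY : ContinuousOn Y (Icc s e)) (hD : ContinuousOn D (Icc s e))
    (hY0 : ∀ t ∈ Icc s e, 0 ≤ Y t) (hD0 : ∀ t ∈ Icc s e, 0 ≤ D t)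
    (hd : ∀ t ∈ Ioo s e, ∃ d, HasDerivAt Y d t ∧ d ≤ A * Y t - D t) {t : ℝ} (ht : t ∈ Icc s' e) :
    Y t + ∫ r in s'..t, D r ≤ (A + 1 / (s' - s)) * ∫ r in s..e, Y r := by
  have hse : s' ≤ e := ht.1.trans ht.2
  have hpos : 0 < s' - s := sub_pos.2 hs
  have sub1 : Icc s s' ⊆ Icc s e := Icc_subset_Icc_right hse
  have sub2 : Icc s' t ⊆ Icc s e := Icc_subset_Icc hs.le ht.2
  have c1 : ContinuousOn (fun r => (r - s) / (s' - s) * Y r) (Icc s s') :=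
    ((continuousOn_id.sub continuousOn_const).div_const _).mul (hY.mono sub1)
  have F1 := sub_le_integral_of_hasDerivAt_le hs.le c1 ((hY.mono sub1).const_smul (A + 1 / (s' - s)))
    (fun r hr => by
      obtain ⟨d, h1, h2⟩ := hd r ⟨hr.1, hr.2.trans_le hse⟩
      refine ⟨_, (((hasDerivAt_id r).sub_const s).div_const (s' - s)).mul h1, ?_⟩
      have hY0' := hY0 r ⟨hr.1.le, hr.2.le.trans hse⟩
      have hD0' := hD0 r ⟨hr.1.le, hr.2.le.trans hse⟩
      have hw0 : 0 ≤ (r - s) / (s' - s) := div_nonneg (by linarith [hr.1]) hpos.le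
      have hw1 : (r - s) / (s' - s) ≤ 1 := (div_le_one hpos).2 (by linarith [hr.2])
      simp only [id, smul_eq_mul, Pi.smul_apply]
      have : (r - s) / (s' - s) * d ≤ 1 * (A * Y r) :=
        (mul_le_mul_of_nonneg_left (h2.trans (by linarith : _ ≤ A * Y r)) hw0).trans
          (mul_le_mul_of_nonneg_right hw1 (by positivity))
      linarith)
  have F2 := sub_le_integral_of_hasDerivAt_le (G := fun r => A * Y r - D r) ht.1 (hY.mono sub2)
    ((continuousOn_const.mul (hY.mono sub2)).sub (hD.mono sub2))
    (fun r hr => hd r ⟨hs.trans hr.1, hr.2.trans_le ht.2⟩)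
  have i1 : IntervalIntegrable Y volume s' t := (hY.mono sub2).intervalIntegrable_of_Icc ht.1
  have i2 : IntervalIntegrable D volume s' t := (hD.mono sub2).intervalIntegrable_of_Icc ht.1
  have i3 : IntervalIntegrable Y volume s s' := (hY.mono sub1).intervalIntegrable_of_Icc hs.le
  rw [intervalIntegral.integral_sub (i1.const_mul A) i2, intervalIntegral.integral_const_mul] at F2
  simp only [Pi.smul_apply, smul_eq_mul, intervalIntegral.integral_const_mul, sub_self, zero_div,
    zero_mul, sub_zero, div_self hpos.ne', one_mul] at F1
  have h3 := intervalIntegral.integral_add_adjacent_intervals i3 i1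
  have h4 := integral_mono_of_subset le_rfl (hs.le.trans ht.1) ht.2 hY hY0
  have h5 : 0 ≤ ∫ r in s'..t, Y r :=
    intervalIntegral.integral_nonneg ht.1 fun r hr => hY0 r (sub2 hr)
  have h6 : 0 ≤ 1 / (s' - s) * ∫ r in s'..t, Y r := by positivity
  have h7 : (A + 1 / (s' - s)) * ∫ r in s..t, Y r ≤ (A + 1 / (s' - s)) * ∫ r in s..e, Y r := by
    gcongr
  rw [← h3] at h7
  linarith

/-- Superlinear iteration: `X (j + 1) ≤ (N B ^ j X j) ^ θ` forces double exponential bounds. -/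
lemma exists_forall_le_rpow_pow {θ N B K : ℝ} (hθ : 1 < θ) (hN : 0 < N) (hB : 1 ≤ B) (hK : 0 < K) :
    ∃ R, 0 < R ∧ ∀ X : ℕ → ℝ, (∀ j, 0 ≤ X j) → X 0 ≤ K →
      (∀ j, X (j + 1) ≤ (N * B ^ j * X j) ^ θ) → ∀ j, N * B ^ j * X j ≤ R ^ θ ^ j := by
  have hκ : 0 < θ - 1 := sub_pos.2 hθ
  have hB0 : 0 < B := by linarith
  set μ := B ^ (θ / (θ - 1)) with hμ
  have hμB : B ≤ μ := by
    conv_lhs => rw [← Real.rpow_one B]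
    exact Real.rpow_le_rpow_of_exponent_le hB (by rw [le_div_iff₀ hκ]; linarith)
  have hμ0 : 0 < μ := hB0.trans_le hμB
  have hμκ : μ ^ (θ - 1) = B ^ θ := by
    rw [hμ, ← Real.rpow_mul hB0.le, div_mul_cancel₀ _ hκ.ne']
  set l := max N ((μ * N ^ θ) ^ (1 / (θ - 1))) with hl
  have hlN : N ≤ l := le_max_left _ _
  have hl0 : 0 < l := hN.trans_le hlN
  have hlκ : μ * N ^ θ ≤ l ^ (θ - 1) := by
    have h0 : 0 ≤ μ * N ^ θ := by positivity
    calc μ * N ^ θ = ((μ * N ^ θ) ^ (1 / (θ - 1))) ^ (θ - 1) := by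
          rw [← Real.rpow_mul h0, one_div_mul_cancel hκ.ne', Real.rpow_one]
      _ ≤ _ := Real.rpow_le_rpow (by positivity) (le_max_right _ _) hκ.le
  refine ⟨l * K, by positivity, fun X hX0 hXK hX => ?_⟩
  have hZ : ∀ j, l * μ ^ j * X j ≤ (l * K) ^ θ ^ j := by
    intro j
    induction j with
    | zero => simpa using mul_le_mul_of_nonneg_left hXK hl0.le
    | succ j ih =>
      have hXj := hX0 j
      have step : l * μ ^ (j + 1) * X (j + 1) ≤ (l * μ ^ j * X j) ^ θ := by
        calc l * μ ^ (j + 1) * X (j + 1) ≤ l * μ ^ (j + 1) * (N * B ^ j * X j) ^ θ := by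
              have := hX j
              gcongr
          _ = (μ * N ^ θ) * (l * (μ ^ j * ((B ^ θ) ^ j * X j ^ θ))) := by
              rw [Real.mul_rpow (by positivity) hXj, Real.mul_rpow hN.le (by positivity),
                ← Real.rpow_natCast_mul hB0.le, mul_comm (j : ℝ) θ, Real.rpow_mul_natCast hB0.le,
                pow_succ]
              ring
          _ ≤ l ^ (θ - 1) * (l * (μ ^ j * ((B ^ θ) ^ j * X j ^ θ))) := by gcongr
          _ = (l ^ (θ - 1) * l) * ((μ ^ (θ - 1)) ^ j * μ ^ j) * X j ^ θ := by rw [hμκ]; ring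
          _ = (l * μ ^ j * X j) ^ θ := by
              rw [Real.mul_rpow (by positivity) hXj, Real.mul_rpow hl0.le (by positivity),
                ← Real.rpow_add_one hl0.ne', ← mul_pow, ← Real.rpow_add_one hμ0.ne', sub_add_cancel,
                ← Real.rpow_natCast_mul hμ0.le, mul_comm (j : ℝ) θ, Real.rpow_mul_natCast hμ0.le]
      refine step.trans ((Real.rpow_le_rpow (by positivity) ih (by linarith)).trans (le_of_eq ?_))
      rw [← Real.rpow_mul (by positivity), pow_succ]
  intro j
  refine le_trans ?_ (hZ j)
  have := hX0 j
  gcongr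

/-- A family of power energies satisfying the differential inequalities of Moser's iteration. -/
structure MoserFamily (κ a c C C₀ s e : ℝ) (Y : ℝ → ℝ → ℝ) : Prop where
  cont : ∀ q, ContinuousOn (Y q) (Icc s e)
  nonneg : ∀ q, ∀ t ∈ Icc s e, 0 ≤ Y q t
  mono : ∀ q r, q ≤ r → ∀ t ∈ Icc s e, Y q t ≤ Y r t
  zero_le : ∀ t ∈ Icc s e, Y 0 t ≤ C₀
  holder : ∀ q r, ∀ t ∈ Icc s e, Y (q * (1 - κ) + r * κ) t ≤ Y q t ^ (1 - κ) * Y r t ^ κ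
  interp : ∀ q L ε, 0 < L → 0 < ε → ∀ t ∈ Icc s e,
    Y (q + 1) t ≤ L * Y q t + L ^ (-ε) * Y (q + 1 + ε) t
  interp_zero : ∀ q L, 0 ≤ q → 0 < L → ∀ t ∈ Icc s e, Y q t ≤ L ^ q * Y 0 t + L⁻¹ * Y (q + 1) t
  deriv : ∀ q, 1 ≤ q → ∀ t ∈ Ioo s e, ∃ d, HasDerivAt (Y q) d t ∧
    d ≤ a * (q - 1 / κ) * Y (q + 1) t + C * q * Y q t - c * (1 - 1 / q) * Y (q / (1 - κ)) t ^ (1 - κ)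

namespace MoserFamily

variable {κ a c C C₀ s e : ℝ} {Y : ℝ → ℝ → ℝ}

lemma mono_left (h : MoserFamily κ a c C C₀ s e Y) {s' : ℝ} (hs : s ≤ s') :
    MoserFamily κ a c C C₀ s' e Y := by
  have hsub : Icc s' e ⊆ Icc s e := Icc_subset_Icc_left hs
  exact ⟨fun q => (h.cont q).mono hsub, fun q t ht => h.nonneg q t (hsub ht),
    fun q r hqr t ht => h.mono q r hqr t (hsub ht), fun t ht => h.zero_le t (hsub ht),
    fun q r t ht => h.holder q r t (hsub ht), fun q L ε hL hε t ht => h.interp q L ε hL hε t (hsub ht),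
    fun q L hq hL t ht => h.interp_zero q L hq hL t (hsub ht),
    fun q hq t ht => h.deriv q hq t ⟨hs.trans_lt ht.1, ht.2⟩⟩

/-- The subcritical energies are absorbed by the negative term of the differential inequality. -/
lemma exists_integral_le (hκ : 0 < κ) (hκ1 : κ < 1) (ha : 0 < a) (hc : 0 < c) (hC : 0 < C)
    (hC₀ : 0 < C₀) {s' : ℝ} (hs : s < s') (hse : s' < e) :
    ∃ K, 0 < K ∧ ∀ Y, MoserFamily κ a c C C₀ s e Y → ∫ t in s'..e, Y (1 / κ) t ≤ K := by
  have hq0 : 1 < 1 / κ := by rw [lt_div_iff₀ hκ]; linarith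
  obtain ⟨q, hq1, hqlt, hqge⟩ : ∃ q, 1 ≤ q ∧ q < 1 / κ ∧ 1 / κ ≤ q + 1 :=
    ⟨max 1 (1 / κ - 1 / 2), le_max_left _ _, max_lt hq0 (by linarith), by
      linarith [le_max_right 1 (1 / κ - 1 / 2)]⟩
  have hse' : s < e := hs.trans hse
  set δ := a * (1 / κ - q) with hδ
  have hδ0 : 0 < δ := mul_pos ha (by linarith)
  set B := (q + 1) + (e - s) * (C * q) with hB
  have hes : 0 < e - s := by linarith
  have hB0 : 0 < B := by positivity
  set C' := B * ((2 * B / δ) ^ q * C₀) with hC'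
  have hpos : 0 < s' - s := sub_pos.2 hs
  have hq1' : 0 < q + 1 := by linarith
  refine ⟨((s' - s) ^ (q + 1))⁻¹ * (2 / δ * (C' * (e - s))), by positivity, fun Y h => ?_⟩
  have cτ : ContinuousOn (fun t => (t - s) ^ (q + 1)) (Icc s e) :=
    (continuousOn_id.sub continuousOn_const).rpow_const fun t _ => Or.inr hq1'.le
  have F := sub_le_integral_of_hasDerivAt_le (g := fun t => (t - s) ^ (q + 1) * Y q t)
    (G := fun t => C' - δ / 2 * ((t - s) ^ (q + 1) * Y (q + 1) t)) hse'.le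
    (cτ.mul (h.cont q)) (continuousOn_const.sub (continuousOn_const.mul (cτ.mul (h.cont (q + 1)))))
    (fun t ht => by
      obtain ⟨d, hd, hdle⟩ := h.deriv q hq1 t ht
      have hτ : 0 < t - s := sub_pos.2 ht.1
      have htI : t ∈ Icc s e := Ioo_subset_Icc_self ht
      have h1 : HasDerivAt (fun t => (t - s) ^ (q + 1)) ((q + 1) * (t - s) ^ q) t := by
        refine (((hasDerivAt_id t).sub_const s).rpow_const (p := q + 1)
          (Or.inl hτ.ne')).congr_deriv ?_
        simp
      refine ⟨_, h1.mul hd, ?_⟩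
      have hL : 0 < 2 * B / δ / (t - s) := by positivity
      have hI := h.interp_zero q _ (by linarith) hL t htI
      have h0 := h.zero_le t htI
      have hYq := h.nonneg q t htI
      have hdrop : 0 ≤ c * (1 - 1 / q) * Y (q / (1 - κ)) t ^ (1 - κ) := by
        have : 1 / q ≤ 1 := (div_le_one (by linarith)).2 hq1
        have h3 := Real.rpow_nonneg (h.nonneg (q / (1 - κ)) t htI) (1 - κ)
        have : 0 ≤ 1 - 1 / q := by linarith
        positivity
      have e1 : (t - s) ^ (q + 1) = (t - s) ^ q * (t - s) := Real.rpow_add_one hτ.ne' q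
      have e2 : (t - s) ^ q * (2 * B / δ / (t - s)) ^ q = (2 * B / δ) ^ q := by
        rw [← Real.mul_rpow hτ.le hL.le, mul_div_cancel₀ _ hτ.ne']
      have e3 : B * (2 * B / δ / (t - s))⁻¹ = δ / 2 * (t - s) := by
        field_simp
      have hτq : 0 ≤ (t - s) ^ q := by positivity
      have step1 : (q + 1) * (t - s) ^ q * Y q t + (t - s) ^ (q + 1) * d ≤
          B * ((t - s) ^ q * Y q t) - δ * ((t - s) ^ (q + 1) * Y (q + 1) t) := by
        have hd' : d ≤ C * q * Y q t - δ * Y (q + 1) t := by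
          rw [hδ]; linarith
        have h4 := mul_le_mul_of_nonneg_left hd' (by positivity : 0 ≤ (t - s) ^ (q + 1))
        have h5 : (t - s) ^ q * (t - s) * (C * q * Y q t) ≤
            (t - s) ^ q * (e - s) * (C * q * Y q t) := by
          have : t - s ≤ e - s := by linarith [ht.2]
          gcongr
        rw [e1] at h4 ⊢
        rw [hB]
        linarith
      have step2 : B * ((t - s) ^ q * Y q t) ≤ C' + δ / 2 * ((t - s) ^ (q + 1) * Y (q + 1) t) := by
        have h6 : B * ((t - s) ^ q * Y q t) ≤ B * ((t - s) ^ q *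
            ((2 * B / δ / (t - s)) ^ q * C₀ + (2 * B / δ / (t - s))⁻¹ * Y (q + 1) t)) := by
          gcongr
          refine hI.trans ?_
          gcongr
        refine h6.trans (le_of_eq ?_)
        rw [hC', ← e2, e1]
        linear_combination (t - s) ^ q * Y (q + 1) t * e3
      linarith)
  have hYe := h.nonneg q e ⟨hse'.le, le_rfl⟩
  have i1 : IntervalIntegrable (fun t => (t - s) ^ (q + 1) * Y (q + 1) t) volume s e :=
    (cτ.mul (h.cont (q + 1))).intervalIntegrable_of_Icc hse'.le
  rw [intervalIntegral.integral_sub intervalIntegrable_const (i1.const_mul _),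
    intervalIntegral.integral_const, intervalIntegral.integral_const_mul] at F
  simp only [sub_self, Real.zero_rpow hq1'.ne', zero_mul, sub_zero, smul_eq_mul] at F
  have hW : 0 ≤ (e - s) ^ (q + 1) * Y q e := by positivity
  have h1 : ∫ t in s..e, (t - s) ^ (q + 1) * Y (q + 1) t ≤ 2 / δ * (C' * (e - s)) := by
    rw [div_mul_eq_mul_div, le_div_iff₀ hδ0]
    linarith
  have h2 := integral_mono_of_subset hs.le hse.le le_rfl (cτ.mul (h.cont (q + 1))) fun t ht =>
    mul_nonneg (Real.rpow_nonneg (sub_nonneg.2 ht.1) _) (h.nonneg (q + 1) t ht)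
  have hsub : Icc s' e ⊆ Icc s e := Icc_subset_Icc_left hs.le
  have h3 : ∫ t in s'..e, Y (1 / κ) t ≤
      ∫ t in s'..e, ((s' - s) ^ (q + 1))⁻¹ * ((t - s) ^ (q + 1) * Y (q + 1) t) := by
    refine intervalIntegral.integral_mono_on hse.le
      (((h.cont _).mono hsub).intervalIntegrable_of_Icc hse.le)
      ((((cτ.mul (h.cont (q + 1))).mono hsub).intervalIntegrable_of_Icc hse.le).const_mul _)
      fun t ht => ?_
    have hY1 := h.nonneg (q + 1) t (hsub ht)
    rw [inv_mul_eq_div, le_div_iff₀ (by positivity), mul_comm]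
    have : s' - s ≤ t - s := by linarith [ht.1]
    have h5 := h.mono _ _ hqge t (hsub ht)
    have h6 := h.nonneg (1 / κ) t (hsub ht)
    have h7 : 0 ≤ t - s := hpos.le.trans this
    gcongr
  rw [intervalIntegral.integral_const_mul] at h3
  refine h3.trans ?_
  gcongr
  exact h2.trans h1

end MoserFamily

end Moser

section MoserIteration

namespace MoserFamily

variable {κ a c C C₀ s e : ℝ} {Y : ℝ → ℝ → ℝ}

lemma continuousOn_rpow (h : MoserFamily κ a c C C₀ s e Y) (hκ1 : κ < 1) (q : ℝ) :
    ContinuousOn (fun t => Y q t ^ (1 - κ)) (Icc s e) :=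
  (h.cont q).rpow_const fun _ _ => Or.inr (by linarith)

lemma coeff_le (hκ : 0 < κ) (hc : 0 < c) {q y : ℝ} (hq : 1 / κ ≤ q) (hy : 0 ≤ y) :
    c * (1 - κ) * y ≤ c * (1 - 1 / q) * y := by
  have : 1 / q ≤ κ := by
    rw [one_div]; exact inv_le_of_inv_le₀ hκ (by rwa [one_div] at hq)
  gcongr

/-- Bounds at the critical exponent `1 / κ`. -/
lemma exists_critical_bound (hκ : 0 < κ) (hκ1 : κ < 1) (ha : 0 < a) (hc : 0 < c) (hC : 0 < C)
    (hC₀ : 0 < C₀) {s' : ℝ} (hs : s < s') (hse : s' < e) :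
    ∃ K, 0 < K ∧ ∀ Y, MoserFamily κ a c C C₀ s e Y →
      (∀ t ∈ Icc s' e, Y (1 / κ) t ≤ K) ∧ ∫ t in s'..e, Y (1 / κ + 1) t ≤ K := by
  have hq0 : 1 < 1 / κ := by rw [lt_div_iff₀ hκ]; linarith
  obtain ⟨r, hr1, hr2⟩ := exists_between hs
  obtain ⟨K₁, hK₁, hK₁b⟩ := exists_integral_le hκ hκ1 ha hc hC hC₀ hr1 (hr2.trans hse)
  have hκ1' : 0 < 1 - κ := by linarith
  have hrs : 0 < s' - r := sub_pos.2 hr2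
  set M₀ := (C * (1 / κ) + 1 / (s' - r)) * K₁ with hM₀
  have hM₀0 : 0 < M₀ := by positivity
  refine ⟨max M₀ (M₀ ^ κ * (1 / (c * (1 - κ)) * M₀)), lt_max_of_lt_left hM₀0, fun Y hY => ?_⟩
  have h := hY.mono_left hr1.le
  have hK := hK₁b Y hY
  have hsub : Icc s' e ⊆ Icc r e := Icc_subset_Icc_left hr2.le
  have BL := fun t ht => add_integral_le_of_deriv_le (Y := Y (1 / κ)) (t := t)
    (D := fun t => c * (1 - κ) * Y (1 / κ / (1 - κ)) t ^ (1 - κ)) (A := C * (1 / κ)) hr2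
    (by positivity) (h.cont _) (continuousOn_const.mul (h.continuousOn_rpow hκ1 _)) (h.nonneg _)
    (fun t ht => by have := h.nonneg (1 / κ / (1 - κ)) t ht; positivity)
    (fun t ht => by
      obtain ⟨d, hd, hle⟩ := h.deriv (1 / κ) hq0.le t ht
      refine ⟨d, hd, hle.trans ?_⟩
      have := coeff_le hκ hc (le_refl (1 / κ))
        (Real.rpow_nonneg (h.nonneg (1 / κ / (1 - κ)) t (Ioo_subset_Icc_self ht)) (1 - κ))
      linarith) ht
  have hBL : ∀ t ∈ Icc s' e,
      Y (1 / κ) t + ∫ t in s'..t, c * (1 - κ) * Y (1 / κ / (1 - κ)) t ^ (1 - κ) ≤ M₀ := fun t ht =>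
    (BL t ht).trans (by rw [hM₀]; gcongr)
  have hDnn : ∀ t ∈ Icc r e, 0 ≤ Y (1 / κ / (1 - κ)) t ^ (1 - κ) := fun t ht =>
    Real.rpow_nonneg (h.nonneg _ t ht) _
  have hsup : ∀ t ∈ Icc s' e, Y (1 / κ) t ≤ M₀ := fun t ht => by
    have : 0 ≤ ∫ t in s'..t, c * (1 - κ) * Y (1 / κ / (1 - κ)) t ^ (1 - κ) :=
      intervalIntegral.integral_nonneg ht.1 fun τ hτ => by
        have := hDnn τ ⟨hr2.le.trans hτ.1, hτ.2.trans ht.2⟩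
        positivity
    linarith [hBL t ht]
  refine ⟨fun t ht => (hsup t ht).trans (le_max_left _ _), le_trans ?_ (le_max_right _ _)⟩
  have h1 := hBL e ⟨hse.le, le_rfl⟩
  have h2 := h.nonneg (1 / κ) e ⟨(hr2.trans hse).le, le_rfl⟩
  rw [intervalIntegral.integral_const_mul] at h1
  have h3 : ∫ t in s'..e, Y (1 / κ + 1) t ≤
      ∫ t in s'..e, M₀ ^ κ * Y (1 / κ / (1 - κ)) t ^ (1 - κ) := by
    refine intervalIntegral.integral_mono_on hse.le
      (((h.cont _).mono hsub).intervalIntegrable_of_Icc hse.le)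
      ((((h.continuousOn_rpow hκ1 _).mono hsub).intervalIntegrable_of_Icc hse.le).const_mul _)
      fun t ht => ?_
    have hh := h.holder (1 / κ / (1 - κ)) (1 / κ) t (hsub ht)
    rw [div_mul_cancel₀ _ hκ1'.ne', one_div_mul_cancel hκ.ne'] at hh
    rw [mul_comm]
    have h4 := hDnn t (hsub ht)
    have h5 := hsup t ht
    have h6 := h.nonneg (1 / κ) t (hsub ht)
    refine hh.trans ?_
    gcongr
  rw [intervalIntegral.integral_const_mul] at h3
  refine h3.trans ?_
  gcongr
  rw [one_div_mul_eq_div, le_div_iff₀ (by positivity)]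
  linarith

/-- Beyond the critical exponent the energies satisfy a closed differential inequality. -/
lemma exists_closed_inequality (hκ : 0 < κ) (hκ1 : κ < 1) (ha : 0 < a) (hc : 0 < c) (hC : 0 < C)
    (hC₀ : 0 < C₀) {s' : ℝ} (hs : s < s') (hse : s' < e) :
    ∃ G ν : ℝ, 0 < G ∧ 0 < ν ∧ ∀ Y, MoserFamily κ a c C C₀ s e Y → ∀ q, 1 / κ ≤ q → ∀ t ∈ Ioo s' e,
      ∃ d, HasDerivAt (Y q) d t ∧
        d ≤ G * q ^ ν * Y q t - c * (1 - κ) / 2 * Y (q / (1 - κ)) t ^ (1 - κ) := by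
  have hq0 : 1 < 1 / κ := by rw [lt_div_iff₀ hκ]; linarith
  obtain ⟨r, hr1, hr2⟩ := exists_between hs
  obtain ⟨K, hK, hKb⟩ := exists_critical_bound hκ hκ1 ha hc hC hC₀ hr1 (hr2.trans hse)
  have hκ1' : 0 < 1 - κ := by linarith
  have hrs : 0 < s' - r := sub_pos.2 hr2
  obtain ⟨δ, hδ0, hδ1, hδ⟩ : ∃ δ, 0 < δ ∧ δ ≤ 1 ∧ a * δ * K ^ κ ≤ c * (1 - κ) := by
    refine ⟨min 1 (c * (1 - κ) / (a * K ^ κ)), by positivity, min_le_left _ _, ?_⟩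
    have := min_le_right 1 (c * (1 - κ) / (a * K ^ κ))
    rw [le_div_iff₀ (by positivity)] at this
    linarith
  set q₁ := 1 / κ + δ with hq₁
  have hq₁1 : 1 ≤ q₁ := by linarith
  set M₁ := (C * q₁ + 1 / (s' - r)) * K with hM₁
  have hM₁0 : 0 < M₁ := by positivity
  set Λ := 2 * a * M₁ ^ κ / (c * (1 - κ)) with hΛ
  have hΛ0 : 0 < Λ := by positivity
  have hε : 0 < δ * κ := by positivity
  refine ⟨a * Λ ^ (1 / (δ * κ)) + C, 1 + 1 / (δ * κ), by positivity, by positivity,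
    fun Y hY q hq t ht => ?_⟩
  obtain ⟨hsup, hint⟩ := hKb Y hY
  have h := hY.mono_left hr1.le
  have hsub : Icc s' e ⊆ Icc r e := Icc_subset_Icc_left hr2.le
  have hM : ∀ t ∈ Icc s' e, Y q₁ t ≤ M₁ := by
    intro t ht
    have BL := add_integral_le_of_deriv_le (Y := Y q₁) (D := fun _ => 0) (A := C * q₁) hr2
      (by positivity) (h.cont _) continuousOn_const (h.nonneg _) (fun _ _ => le_rfl)
      (fun t ht => by
        have htI := Ioo_subset_Icc_self ht
        obtain ⟨d, hd, hle⟩ := h.deriv q₁ hq₁1 t ht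
        refine ⟨d, hd, hle.trans ?_⟩
        have hh := h.holder (q₁ / (1 - κ)) (1 / κ) t htI
        rw [div_mul_cancel₀ _ hκ1'.ne', one_div_mul_cancel hκ.ne'] at hh
        have h1 := Real.rpow_nonneg (h.nonneg (q₁ / (1 - κ)) t htI) (1 - κ)
        have h2 := coeff_le hκ hc (by linarith : 1 / κ ≤ q₁) h1
        have h3 : Y (1 / κ) t ^ κ ≤ K ^ κ :=
          Real.rpow_le_rpow (h.nonneg _ t htI) (hsup t htI) hκ.le
        have h4 : a * (q₁ - 1 / κ) * Y (q₁ + 1) t ≤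
            a * δ * (Y (q₁ / (1 - κ)) t ^ (1 - κ) * K ^ κ) := by
          rw [show q₁ - 1 / κ = δ by rw [hq₁]; ring]
          gcongr
          exact hh.trans (by gcongr)
        have h5 := mul_le_mul_of_nonneg_right hδ h1
        linarith) ht
    simp only [intervalIntegral.integral_zero, add_zero] at BL
    refine BL.trans ?_
    rw [hM₁]
    gcongr
    refine le_trans ?_ hint
    exact intervalIntegral.integral_mono_on (hr2.trans hse).le
      ((h.cont _).intervalIntegrable_of_Icc (hr2.trans hse).le)
      ((h.cont _).intervalIntegrable_of_Icc (hr2.trans hse).le)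
      fun t ht => h.mono _ _ (by linarith) t ht
  have ht' : t ∈ Icc s' e := Ioo_subset_Icc_self ht
  have htI := hsub ht'
  have hqpos : 0 < q := by linarith
  obtain ⟨d, hd, hle⟩ := h.deriv q (by linarith) t ⟨hr2.trans ht.1, ht.2⟩
  refine ⟨d, hd, hle.trans ?_⟩
  set L := (Λ * q) ^ (1 / (δ * κ)) with hL
  have hL0 : 0 < L := by positivity
  have hLε : L ^ (-(δ * κ)) = (Λ * q)⁻¹ := by
    rw [hL, ← Real.rpow_mul (by positivity), ← Real.rpow_neg_one]
    congr 1
    field_simp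
  have hI := h.interp q L (δ * κ) hL0 hε t htI
  rw [hLε] at hI
  have hh := h.holder (q / (1 - κ)) q₁ t htI
  rw [div_mul_cancel₀ _ hκ1'.ne', show q + q₁ * κ = q + 1 + δ * κ by
    rw [hq₁]; field_simp; ring] at hh
  have h1 := Real.rpow_nonneg (h.nonneg (q / (1 - κ)) t htI) (1 - κ)
  have h2 := coeff_le hκ hc hq h1
  have h3 : Y q₁ t ^ κ ≤ M₁ ^ κ := Real.rpow_le_rpow (h.nonneg _ t htI) (hM t ht') hκ.le
  have hYq := h.nonneg q t htI
  have hYq1 := h.nonneg (q + 1) t htI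
  have h4 : a * (q - 1 / κ) * Y (q + 1) t ≤ a * q * Y (q + 1) t := by
    have : q - 1 / κ ≤ q := by linarith
    gcongr
  have h5 : Y (q + 1) t ≤ L * Y q t + (Λ * q)⁻¹ * (Y (q / (1 - κ)) t ^ (1 - κ) * M₁ ^ κ) := by
    refine hI.trans ?_
    gcongr
    exact hh.trans (by gcongr)
  have h6 : a * q * Y (q + 1) t ≤ a * q * L * Y q t +
      c * (1 - κ) / 2 * Y (q / (1 - κ)) t ^ (1 - κ) := by
    refine (mul_le_mul_of_nonneg_left h5 (by positivity)).trans (le_of_eq ?_)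
    have : a * q * ((Λ * q)⁻¹ * M₁ ^ κ) = c * (1 - κ) / 2 := by
      rw [hΛ]
      have : M₁ ^ κ ≠ 0 := by positivity
      field_simp
    linear_combination Y (q / (1 - κ)) t ^ (1 - κ) * this
  have hqν : q ^ (1 + 1 / (δ * κ)) = q * q ^ (1 / (δ * κ)) := by
    rw [Real.rpow_add hqpos, Real.rpow_one]
  have hLq : L = Λ ^ (1 / (δ * κ)) * q ^ (1 / (δ * κ)) := Real.mul_rpow hΛ0.le hqpos.le
  have h7 : C * q * Y q t ≤ C * (q * q ^ (1 / (δ * κ))) * Y q t := by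
    have : 1 ≤ q ^ (1 / (δ * κ)) := Real.one_le_rpow (by linarith) (by positivity)
    have : q ≤ q * q ^ (1 / (δ * κ)) := le_mul_of_one_le_right hqpos.le this
    gcongr
  rw [hqν]
  rw [hLq] at h6
  linarith

/-- Moser iteration: a uniform bound for arbitrarily large exponents. -/
theorem exists_frequently_le (hκ : 0 < κ) (hκ1 : κ < 1) (ha : 0 < a) (hc : 0 < c) (hC : 0 < C)
    (hC₀ : 0 < C₀) {s' : ℝ} (hs : s < s') (hse : s' < e) :
    ∃ R, 0 < R ∧ ∀ Y, MoserFamily κ a c C C₀ s e Y → ∀ t ∈ Icc s' e, ∃ᶠ q in atTop,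
      Y q t ≤ R ^ q := by
  have hq0 : 1 < 1 / κ := by rw [lt_div_iff₀ hκ]; linarith
  obtain ⟨r, hr1, hr2⟩ := exists_between hs
  obtain ⟨G, ν, hG, hν, hGb⟩ := exists_closed_inequality hκ hκ1 ha hc hC hC₀ hr1 (hr2.trans hse)
  obtain ⟨K, hK, hKb⟩ := exists_critical_bound hκ hκ1 ha hc hC hC₀ hr1 (hr2.trans hse)
  have hκ1' : 0 < 1 - κ := by linarith
  have hrs : 0 < s' - r := sub_pos.2 hr2
  set θ := 1 + κ with hθ
  have hθ0 : 0 < θ := by linarith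
  set q : ℕ → ℝ := fun j => 1 / κ * θ ^ j with hq
  set ρ : ℕ → ℝ := fun j => s' - (s' - r) / 2 ^ j with hρ
  have hρ1 : ∀ j, ρ (j + 1) - ρ j = (s' - r) / 2 ^ (j + 1) := fun j => by
    simp only [hρ, pow_succ]; field_simp; ring
  have hρlt : ∀ j, ρ j < ρ (j + 1) := fun j => by
    have : 0 < (s' - r) / 2 ^ (j + 1) := by positivity
    linarith [hρ1 j]
  have hρs : ∀ j, ρ j ≤ s' := fun j => by
    have : 0 ≤ (s' - r) / 2 ^ j := by positivity
    simp only [hρ]; linarith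
  have hρr : ∀ j, r ≤ ρ j := fun j => by
    have : (s' - r) / 2 ^ j ≤ s' - r := div_le_self hrs.le (one_le_pow₀ (by norm_num))
    simp only [hρ]; linarith
  set B := 2 * θ ^ ν with hB
  have hθν : 1 ≤ θ ^ ν := Real.one_le_rpow (by linarith) hν.le
  have hB1 : 1 ≤ B := by linarith
  set c' := c * (1 - κ) / 2 with hc'
  have hc'0 : 0 < c' := by positivity
  set l := max 1 (c'⁻¹ ^ (1 / θ)) with hl
  have hl1 : 1 ≤ l := le_max_left _ _
  have hl0 : 0 < l := by linarith
  set N := l * (G * (1 / κ) ^ ν + 2 / (s' - r)) with hN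
  have hN0 : 0 < N := by positivity
  obtain ⟨R, hR, hRb⟩ := exists_forall_le_rpow_pow (by linarith : 1 < θ) hN0 hB1 hK
  refine ⟨R ^ κ, by positivity, fun Y hY t ht => ?_⟩
  have hq1 : ∀ j, 1 / κ ≤ q j := fun j =>
    le_mul_of_one_le_right (by positivity) (one_le_pow₀ (by linarith))
  have hY' : ∀ j, MoserFamily κ a c C C₀ (ρ j) e Y := fun j =>
    hY.mono_left (hr1.le.trans (hρr j))
  have hρe : ∀ j, ρ j < e := fun j => (hρs j).trans_lt hse
  have hX0 : ∀ j, 0 ≤ ∫ t in ρ j..e, Y (q j) t := fun j =>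
    intervalIntegral.integral_nonneg (hρe j).le ((hY' j).nonneg _)
  have hcoef : ∀ j, l * (G * q j ^ ν + 1 / (ρ (j + 1) - ρ j)) ≤ N * B ^ j := fun j => by
    have e1 : q j ^ ν = (1 / κ) ^ ν * (θ ^ ν) ^ j := by
      simp only [hq]
      rw [Real.mul_rpow (by positivity) (by positivity), ← Real.rpow_natCast_mul hθ0.le,
        mul_comm (j : ℝ) ν, Real.rpow_mul_natCast hθ0.le]
    have e2 : 1 / (ρ (j + 1) - ρ j) = 2 / (s' - r) * 2 ^ j := by
      rw [hρ1, pow_succ]; field_simp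
    have b1 : (θ ^ ν) ^ j ≤ B ^ j := by gcongr; linarith
    have b2 : (2 : ℝ) ^ j ≤ B ^ j := by gcongr; linarith
    rw [e1, e2, hN, mul_assoc]
    refine mul_le_mul_of_nonneg_left ?_ hl0.le
    have : G * ((1 / κ) ^ ν * (θ ^ ν) ^ j) ≤ G * ((1 / κ) ^ ν * B ^ j) := by gcongr
    have : 2 / (s' - r) * 2 ^ j ≤ 2 / (s' - r) * B ^ j := by gcongr
    linarith
  have BL : ∀ j, ∀ t ∈ Icc (ρ (j + 1)) e,
      Y (q j) t + (∫ t in ρ (j + 1)..t, c' * Y (q j / (1 - κ)) t ^ (1 - κ)) ≤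
        (G * q j ^ ν + 1 / (ρ (j + 1) - ρ j)) * ∫ t in ρ j..e, Y (q j) t := by
    intro j t ht
    have hqj := (zero_lt_one.trans hq0).trans_le (hq1 j)
    exact add_integral_le_of_deriv_le (Y := Y (q j))
      (D := fun t => c' * Y (q j / (1 - κ)) t ^ (1 - κ)) (hρlt j) (by positivity) ((hY' j).cont _)
      (continuousOn_const.mul ((hY' j).continuousOn_rpow hκ1 _)) ((hY' j).nonneg _)
      (fun t ht => by have := (hY' j).nonneg (q j / (1 - κ)) t ht; positivity)
      (fun t ht => hGb Y hY (q j) (hq1 j) t ⟨(hρr j).trans_lt ht.1, ht.2⟩) ht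
  have hDnn : ∀ j, ∀ t ∈ Icc (ρ j) e, 0 ≤ Y (q j / (1 - κ)) t ^ (1 - κ) := fun j t ht =>
    Real.rpow_nonneg ((hY' j).nonneg _ t ht) _
  set X : ℕ → ℝ := fun j => (G * q j ^ ν + 1 / (ρ (j + 1) - ρ j)) * ∫ t in ρ j..e, Y (q j) t with hX
  have hXnn : ∀ j, 0 ≤ X j := fun j => by
    have h1 := hX0 j
    have h2 : 0 < ρ (j + 1) - ρ j := sub_pos.2 (hρlt j)
    have hqj := (zero_lt_one.trans hq0).trans_le (hq1 j)
    simp only [hX]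
    positivity
  have hlX : ∀ j, l * X j ≤ N * B ^ j * ∫ t in ρ j..e, Y (q j) t := fun j => by
    simp only [hX]
    rw [← mul_assoc]
    exact mul_le_mul_of_nonneg_right (hcoef j) (hX0 j)
  have hsup : ∀ j, ∀ t ∈ Icc (ρ (j + 1)) e, Y (q j) t ≤ X j := fun j t ht => by
    have : 0 ≤ ∫ t in ρ (j + 1)..t, c' * Y (q j / (1 - κ)) t ^ (1 - κ) :=
      intervalIntegral.integral_nonneg ht.1 fun τ hτ => by
        have := hDnn j τ ⟨(hρlt j).le.trans hτ.1, hτ.2.trans ht.2⟩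
        positivity
    linarith [BL j t ht]
  have hstep : ∀ j, ∫ t in ρ (j + 1)..e, Y (q (j + 1)) t ≤
      (N * B ^ j * ∫ t in ρ j..e, Y (q j) t) ^ θ := by
    intro j
    have hsub : Icc (ρ (j + 1)) e ⊆ Icc (ρ j) e := Icc_subset_Icc_left (hρlt j).le
    have hXj := hXnn j
    have h1 : ∫ t in ρ (j + 1)..e, Y (q (j + 1)) t ≤
        ∫ t in ρ (j + 1)..e, X j ^ κ * Y (q j / (1 - κ)) t ^ (1 - κ) := by
      refine intervalIntegral.integral_mono_on (hρe (j + 1)).le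
        (((hY' (j + 1)).cont _).intervalIntegrable_of_Icc (hρe (j + 1)).le)
        ((((hY' (j + 1)).continuousOn_rpow hκ1 _).intervalIntegrable_of_Icc
          (hρe (j + 1)).le).const_mul _) fun t ht => ?_
      have hh := (hY' j).holder (q j / (1 - κ)) (q j) t (hsub ht)
      rw [div_mul_cancel₀ _ hκ1'.ne', show q j + q j * κ = q (j + 1) by
        simp only [hq, pow_succ, hθ]; ring] at hh
      have h4 := hDnn j t (hsub ht)
      have h5 := hsup j t ht
      have h6 := (hY' j).nonneg (q j) t (hsub ht)
      rw [mul_comm]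
      exact hh.trans (by gcongr)
    rw [intervalIntegral.integral_const_mul] at h1
    have h2 := BL j e ⟨(hρe (j + 1)).le, le_rfl⟩
    rw [intervalIntegral.integral_const_mul] at h2
    have h3 := (hY' j).nonneg (q j) e ⟨(hρe j).le, le_rfl⟩
    have h4 : ∫ t in ρ (j + 1)..e, Y (q j / (1 - κ)) t ^ (1 - κ) ≤ c'⁻¹ * X j := by
      rw [inv_mul_eq_div, le_div_iff₀ hc'0]
      linarith
    have h5 : c'⁻¹ ≤ l ^ θ := by
      calc c'⁻¹ = (c'⁻¹ ^ (1 / θ)) ^ θ := by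
            rw [← Real.rpow_mul (by positivity), one_div_mul_cancel hθ0.ne', Real.rpow_one]
        _ ≤ _ := Real.rpow_le_rpow (by positivity) (le_max_right _ _) hθ0.le
    have h6 : X j ^ κ * X j = X j ^ θ := by
      rw [hθ, Real.rpow_add' hXj (by linarith), Real.rpow_one, mul_comm]
    calc ∫ t in ρ (j + 1)..e, Y (q (j + 1)) t ≤ X j ^ κ * (c'⁻¹ * X j) := h1.trans (by gcongr)
      _ = c'⁻¹ * X j ^ θ := by rw [← h6]; ring
      _ ≤ l ^ θ * X j ^ θ := by gcongr
      _ = (l * X j) ^ θ := (Real.mul_rpow hl0.le hXj).symm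
      _ ≤ _ := Real.rpow_le_rpow (by positivity) (hlX j) hθ0.le
  have hbase : ∫ t in ρ 0..e, Y (q 0) t ≤ K := by
    have e1 : ρ 0 = r := by simp [hρ]
    have h := hY.mono_left hr1.le
    rw [e1]
    refine le_trans (intervalIntegral.integral_mono_on (hr2.trans hse).le
      ((h.cont _).intervalIntegrable_of_Icc (hr2.trans hse).le)
      ((h.cont _).intervalIntegrable_of_Icc (hr2.trans hse).le)
      fun t ht => h.mono _ _ ?_ t ht) (hKb Y hY).2
    simp [hq]
  have hfin : ∀ j, Y (q j) t ≤ (R ^ κ) ^ q j := fun j => by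
    have h1 := hRb (fun j => ∫ t in ρ j..e, Y (q j) t) hX0 hbase hstep j
    have h2 : X j ≤ l * X j := le_mul_of_one_le_left (hXnn j) hl1
    have e1 : (R ^ κ) ^ q j = R ^ θ ^ j := by
      rw [← Real.rpow_mul hR.le]
      congr 1
      simp only [hq]
      field_simp
    rw [e1]
    exact (hsup j t ⟨(hρs _).trans ht.1, ht.2⟩).trans (h2.trans ((hlX j).trans h1))
  have hlim : Tendsto q atTop atTop :=
    (tendsto_pow_atTop_atTop_of_one_lt (by linarith : 1 < θ)).const_mul_atTop (by positivity)
  exact hlim.frequently (Frequently.of_forall hfin)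

end MoserFamily

end MoserIteration

section RatioBound

variable {n : ℕ} {Ω : Set (EuclideanSpace ℝ (Fin n))} {φ : EuclideanSpace ℝ (Fin n) → ℝ}

namespace FDRatio

variable {p b T M m m' A s : ℝ} {u v w h : EuclideanSpace ℝ (Fin n) → ℝ → ℝ}

/-- The weighted integrals of powers of `A - h` form a Moser family. -/
lemma moserFamily (R : FDRatio Ω φ p b T M m m' u v w h) (D : DefiningFun Ω φ) {C C₀ : ℝ}
    (hC : 0 < C) (hsob : ∀ f : EuclideanSpace ℝ (Fin n) → ℝ, ContDiffOn ℝ 1 f Ω →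
      ∀ M, (∀ x ∈ Ω, |f x| ≤ M) → (∀ i, ∀ x ∈ Ω, φ x * |pderiv' i f x| ≤ M) →
      (∫ x in Ω, |φ x * f x| ^ (p + 1)) ^ (2 / (p + 1)) ≤
        C * ∫ x in Ω, (φ x ^ 2 * gradSq f x + φ x ^ (p + 1) * f x ^ 2))
    (hs : 0 ≤ s) (hA0 : 0 < A) (hA : ∀ x ∈ Ω, ∀ t ∈ Icc s T, h x t ≤ A - 1)
    (hC₀ : ∀ t ∈ Icc s T, ∫ x in Ω, u x t ^ (p + 1) ≤ C₀) :
    MoserFamily ((p - 1) / (p + 1)) (p - 1)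
      (1 / (p * (m' ^ 2 * C * ((m ^ 2)⁻¹ + (m ^ (p + 1))⁻¹))))
      ((p + 1) * A + (p - 1) * A ^ 2 + (p - 1) + 1 / p) C₀ s T (powerEnergy Ω p A u h) := by
  have hp := R.one_lt
  have hm := R.m_pos
  have hm' := R.m'_pos
  have hp1 : 0 < p + 1 := by linarith
  have hκ : 0 < (p - 1) / (p + 1) := div_pos (by linarith) hp1
  have hκ1 : (p - 1) / (p + 1) < 1 := by rw [div_lt_one hp1]; linarith
  have e1 : 1 - (p - 1) / (p + 1) = 2 / (p + 1) := by field_simp; ring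
  set K := m' ^ 2 * C * ((m ^ 2)⁻¹ + (m ^ (p + 1))⁻¹) with hK
  have hK0 : 0 < K := by positivity
  refine ⟨R.continuousOn_powerEnergy D hs hA, fun q t ht => R.powerEnergy_nonneg D hs hA q ht,
    fun q r hqr t ht => ?_, fun t ht => ?_, fun q r t ht => R.powerEnergy_holder D hs hA hκ hκ1 q r ht,
    fun q L ε hL hε t ht => ?_, fun q L hq hL t ht => ?_, fun q hq t ht => ?_⟩
  · have := R.powerEnergy_le_add D hs hA (q := q) (q₁ := r) (q₂ := r) (a₁ := 1) (a₂ := 0)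
      (fun k hk => by
        simpa using Real.rpow_le_rpow_of_exponent_le hk hqr) ht
    linarith
  · simpa [powerEnergy] using hC₀ t ht
  · refine R.powerEnergy_le_add D hs hA (fun k hk => ?_) ht
    have hk0 : 0 < k := by linarith
    rcases le_total k L with h1 | h1
    · have : k ^ (q + 1) ≤ L * k ^ q := by
        rw [Real.rpow_add_one hk0.ne', mul_comm]; gcongr
      have h2 : 0 ≤ L ^ (-ε) * k ^ (q + 1 + ε) := by positivity
      linarith
    · have h3 : k ^ (q + 1) = k ^ (-ε) * k ^ (q + 1 + ε) := by
        rw [← Real.rpow_add hk0]; congr 1; ring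
      have h4 : k ^ (-ε) ≤ L ^ (-ε) := Real.rpow_le_rpow_of_nonpos hL h1 (by linarith)
      have h5 : k ^ (q + 1) ≤ L ^ (-ε) * k ^ (q + 1 + ε) := by rw [h3]; gcongr
      have h2 : 0 ≤ L * k ^ q := by positivity
      linarith
  · refine R.powerEnergy_le_add D hs hA (fun k hk => ?_) ht
    have hk0 : 0 < k := by linarith
    rw [Real.rpow_zero, mul_one]
    rcases le_total k L with h1 | h1
    · have : k ^ q ≤ L ^ q := by gcongr
      have h2 : 0 ≤ L⁻¹ * k ^ (q + 1) := by positivity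
      linarith
    · have h5 : k ^ q ≤ L⁻¹ * k ^ (q + 1) := by
        rw [Real.rpow_add_one hk0.ne', inv_mul_eq_div, le_div_iff₀ hL]; gcongr
      have h2 : 0 ≤ L ^ q := by positivity
      linarith
  · obtain ⟨d, hd, hle⟩ := R.hasDerivAt_powerEnergy D hs hA0 hA hq ht
    refine ⟨d, hd, hle.trans ?_⟩
    have htI : t ∈ Icc s T := Ioo_subset_Icc_self ht
    have hS := R.powerEnergy_rpow_le D hC hsob hs hA (by linarith : 0 ≤ q) htI
    have hY := R.powerEnergy_nonneg D hs hA q htI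
    rw [← hK] at hS
    rw [e1, show q / (2 / (p + 1)) = q * ((p + 1) / 2) by field_simp]
    set Z := powerEnergy Ω p A u h (q * ((p + 1) / 2)) t ^ (2 / (p + 1))
    set Y := powerEnergy Ω p A u h q t
    set Y1 := powerEnergy Ω p A u h (q + 1) t
    set Di := powerDirichlet Ω A u h q t
    have hq0 : 0 < q := by linarith
    have h1 : Z / K - Y ≤ q ^ 2 * Di := by
      rw [sub_le_iff_le_add, div_le_iff₀ hK0]; linarith
    have hc : 0 ≤ 1 / p * (1 - 1 / q) := by
      have : 1 / q ≤ 1 := by rw [div_le_one hq0]; exact hq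
      exact mul_nonneg (by positivity) (by linarith)
    have h2 := mul_le_mul_of_nonneg_left h1 hc
    have e2 : 1 / p * (1 - 1 / q) * (q ^ 2 * Di) = 1 / p * (q * (q - 1)) * Di := by
      field_simp
    have e3 : 1 / p * (1 - 1 / q) * (Z / K - Y) =
        1 / (p * K) * (1 - 1 / q) * Z - 1 / p * (1 - 1 / q) * Y := by
      field_simp
    have h3 : 1 / p * (1 - 1 / q) * Y ≤ 1 / p * q * Y := by
      have : 1 - 1 / q ≤ q := by
        have : 0 < 1 / q := by positivity
        linarith
      gcongr
    have e4 : (p - 1) * (q - 1 / ((p - 1) / (p + 1))) = (p - 1) * q - (p + 1) := by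
      have : p - 1 ≠ 0 := by linarith
      field_simp
    rw [e4]
    rw [e2, e3] at h2
    linarith

/-- Uniform growth bounds on the moments bound the function itself. -/
lemma sub_le_of_frequently (R : FDRatio Ω φ p b T M m m' u v w h) (D : DefiningFun Ω φ)
    (hs : 0 ≤ s) (hA : ∀ x ∈ Ω, ∀ t ∈ Icc s T, h x t ≤ A - 1) {B : ℝ} (hB : 0 < B)
    {t : ℝ} (ht : t ∈ Icc s T) (hfreq : ∃ᶠ q in atTop, powerEnergy Ω p A u h q t ≤ B ^ q)
    {x : EuclideanSpace ℝ (Fin n)} (hx : x ∈ Ω) : A - h x t ≤ B := by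
  by_contra! hlt
  have htI : t ∈ Icc 0 T := ⟨hs.trans ht.1, ht.2⟩
  obtain ⟨B', hB', hB'x⟩ := exists_between hlt
  have hm := D.isOpen.measurableSet
  have ck : ContinuousOn (fun x => A - h x t) Ω :=
    continuousOn_const.sub (R.h_smooth htI).continuousOn
  set U := Ω ∩ (fun x => A - h x t) ⁻¹' Ioi B' with hU
  have hUo : IsOpen U := ck.isOpen_inter_preimage D.isOpen isOpen_Ioi
  have hUm := hUo.measurableSet
  have hUΩ : U ⊆ Ω := inter_subset_left
  have hint : IntegrableOn (fun x => u x t ^ (p + 1)) Ω := by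
    simpa using R.integrableOn_density D hs hA 0 ht
  set ε := ∫ x in U, u x t ^ (p + 1) with hε
  have hε0 : 0 < ε := by
    rw [hε, setIntegral_pos_iff_support_of_nonneg_ae
      ((ae_restrict_iff' hUm).2 (ae_of_all _ fun y hy =>
        Real.rpow_nonneg (R.u_pos y (hUΩ hy) t htI).le _)) (hint.mono_set hUΩ)]
    have : Function.support (fun x => u x t ^ (p + 1)) ∩ U = U :=
      inter_eq_right.2 fun y hy => (Real.rpow_pos_of_pos (R.u_pos y (hUΩ hy) t htI) _).ne'
    rw [this]
    exact hUo.measure_pos volume ⟨x, hx, hB'x⟩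
  have hB'0 : 0 < B' := hB.trans hB'
  have hlow : ∀ q, 0 ≤ q → ε * B' ^ q ≤ powerEnergy Ω p A u h q t := by
    intro q hq
    have hi := R.integrableOn_density D hs hA q ht
    calc ε * B' ^ q = ∫ x in U, u x t ^ (p + 1) * B' ^ q := by rw [integral_mul_const]
      _ ≤ ∫ x in U, u x t ^ (p + 1) * (A - h x t) ^ q := by
          refine setIntegral_mono_on ((hint.mono_set hUΩ).mul_const _) (hi.mono_set hUΩ) hUm
            fun y hy => ?_
          have h1 := R.u_pos y (hUΩ hy) t htI
          have h2 : B' ≤ A - h y t := le_of_lt hy.2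
          gcongr
      _ ≤ _ := setIntegral_mono_set hi ((ae_restrict_iff' hm).2 (ae_of_all _ fun y hy =>
          R.density_nonneg hs hA q ht hy)) (ae_of_all _ hUΩ)
  have hlim : Tendsto (fun q : ℝ => (B' / B) ^ q) atTop atTop :=
    tendsto_rpow_atTop_of_base_gt_one _ ((one_lt_div hB).2 hB')
  obtain ⟨q, hq, h1, h2⟩ :=
    (hfreq.and_eventually ((hlim.eventually_gt_atTop ε⁻¹).and (eventually_ge_atTop 0))).exists
  have h3 := (hlow q h2).trans hq
  rw [Real.div_rpow hB'0.le hB.le, lt_div_iff₀ (by positivity), inv_mul_lt_iff₀ hε0] at h1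
  linarith

end FDRatio

/-- Interior-in-time bound for `∂ₜ u / u`. -/
theorem RegularDefiningFun.exists_ratio_bound (D : RegularDefiningFun Ω φ) (hn : 1 ≤ n) {p T : ℝ}
    (hp : 1 < p) (hpn : n ≤ 2 ∨ p ≤ ((n : ℝ) + 2) / ((n : ℝ) - 2)) {m m' s' : ℝ} (hm : 0 < m)
    (hm' : 0 < m') (hs' : 0 < s') (hsT : s' < T) :
    ∃ C, 0 < C ∧ ∀ (b M : ℝ) (u v w h : EuclideanSpace ℝ (Fin n) → ℝ → ℝ),
      FDRatio Ω φ p b T M m m' u v w h → ∀ x ∈ Ω, ∀ t ∈ Icc s' T, |h x t| ≤ C := by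
  obtain ⟨S, hS, hsob⟩ := D.exists_weighted_sobolev hn hp hpn
  obtain ⟨j, hj⟩ := exists_nat_ge ((p + 1) / (p - 1))
  have hp1 : 0 < p - 1 := by linarith
  have hj' : p + 1 ≤ (p - 1) * (j + 3) := by
    rw [div_le_iff₀ hp1] at hj
    nlinarith
  have hT : 0 < T := hs'.trans hsT
  obtain ⟨L, hL, hLb⟩ := D.bound_closure D.smooth.continuous
  set s := s' / 2 with hs
  have hs0 : 0 < s := by positivity
  have hss' : s < s' := by linarith
  set A := (j + 3) * (1 + T) / s + 1 with hA
  have hA0 : 0 < A := by positivity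
  set C₀ := (m' * L) ^ (p + 1) * volume.real Ω + 1 with hC₀
  have hC₀0 : 0 < C₀ := by positivity
  have hp2 : 0 < p + 1 := by linarith
  have hp0 : 0 < p := by linarith
  obtain ⟨B, hB, hBb⟩ := MoserFamily.exists_frequently_le (κ := (p - 1) / (p + 1)) (a := p - 1)
    (c := 1 / (p * (m' ^ 2 * S * ((m ^ 2)⁻¹ + (m ^ (p + 1))⁻¹))))
    (C := (p + 1) * A + (p - 1) * A ^ 2 + (p - 1) + 1 / p) (C₀ := C₀)
    (div_pos hp1 hp2) (by rw [div_lt_one hp2]; linarith) hp1 (by positivity) (by positivity) hC₀0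
    hss' hsT
  refine ⟨A + B, by positivity, fun b M u v w h R x hx t ht => ?_⟩
  have D' := D.toDefiningFun
  have hAb : ∀ x ∈ Ω, ∀ t ∈ Icc s T, h x t ≤ A - 1 := fun x hx t ht => by
    have ht0 : 0 < t := hs0.trans_le ht.1
    have := R.le_div D' hj' hx ⟨ht0, ht.2⟩
    refine this.trans ?_
    rw [hA, add_sub_cancel_right]
    gcongr
    exact ht.1
  have hCb : ∀ t ∈ Icc s T, ∫ x in Ω, u x t ^ (p + 1) ≤ C₀ := fun t ht => by
    have htI : t ∈ Icc 0 T := ⟨hs0.le.trans ht.1, ht.2⟩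
    have h1 : ∫ x in Ω, u x t ^ (p + 1) ≤ ∫ _x in Ω, (m' * L) ^ (p + 1) := by
      refine setIntegral_mono_on (by simpa using R.integrableOn_density D' hs0.le hAb 0 ht)
        (integrableOn_const D'.volume_lt_top.ne) D'.isOpen.measurableSet fun x hx => ?_
      refine Real.rpow_le_rpow (R.u_pos x hx t htI).le ((R.u_upper x hx t htI).trans ?_) hp2.le
      exact mul_le_mul_of_nonneg_left ((le_abs_self _).trans (hLb x (subset_closure hx))) hm'.le
    rw [setIntegral_const, smul_eq_mul, mul_comm] at h1
    linarith
  have F := R.moserFamily D' hS hsob hs0.le hA0 hAb hCb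
  have ht' : t ∈ Icc s T := ⟨hss'.le.trans ht.1, ht.2⟩
  have h1 := R.sub_le_of_frequently D' hs0.le hAb hB ht' (hBb _ F t ht) hx
  have h2 := hAb x hx t ht'
  rw [abs_le]
  constructor <;> linarith

end RatioBound

section Dirichlet

variable {n : ℕ} {Ω : Set (EuclideanSpace ℝ (Fin n))} {φ : EuclideanSpace ℝ (Fin n) → ℝ}

/-- Green's formula for functions vanishing at the boundary. -/
lemma DefiningFun.integral_mul_lap (D : DefiningFun Ω φ) {f g : EuclideanSpace ℝ (Fin n) → ℝ}
    (hf : ContDiffOn ℝ 1 f Ω) (hg : ContDiffOn ℝ 2 g Ω) {K : ℝ} (hK : 0 ≤ K)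
    (hfK : ∀ x ∈ Ω, |f x| ≤ K * φ x)
    (hfd : ∀ i, ∀ x ∈ Ω, |pderiv' i f x| ≤ K) (hgd : ∀ i, ∀ x ∈ Ω, |pderiv' i g x| ≤ K)
    (hgl : ∀ x ∈ Ω, |lap g x| ≤ K) :
    ∫ x in Ω, f x * lap g x = -∫ x in Ω, ∑ i, pderiv' i f x * pderiv' i g x := by
  have hΩ := D.isOpen
  obtain ⟨L, hL, hLb⟩ := D.bound_closure D.smooth.continuous
  have hφL : ∀ x ∈ Ω, φ x ≤ L := fun x hx => (le_abs_self _).trans (hLb x (subset_closure hx))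
  have df : ∀ x ∈ Ω, DifferentiableAt ℝ f x := fun x hx =>
    ContDiffOn.differentiableAt_mem hΩ (m := 1) hf le_rfl hx
  have cg : ∀ i, ContDiffOn ℝ 1 (pderiv' i g) Ω := fun i =>
    ContDiffOn.pderiv' hΩ (m := 2) hg (by norm_num) i
  have cdf : ∀ i, ContinuousOn (pderiv' i f) Ω := fun i =>
    (ContDiffOn.pderiv' hΩ (m := 1) (k := 0) hf (by norm_num) i).continuousOn
  have ddg : ∀ i, ∀ x ∈ Ω, DifferentiableAt ℝ (pderiv' i g) x := fun i x hx =>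
    ContDiffOn.differentiableAt_mem hΩ (m := 1) (cg i) le_rfl hx
  have I1 : IntegrableOn (fun x => f x * lap g x) Ω := by
    refine D.integrableOn_of_bound (hf.continuousOn.mul (continuousOn_lap hΩ hg))
      (M := K * L * K) fun x hx => ?_
    rw [abs_mul]
    exact mul_le_mul ((hfK x hx).trans (mul_le_mul_of_nonneg_left (hφL x hx) hK)) (hgl x hx)
      (abs_nonneg _) (by positivity)
  have I2 : IntegrableOn (fun x => ∑ i, pderiv' i f x * pderiv' i g x) Ω := by
    refine D.integrableOn_of_bound (continuousOn_finsetSum _ fun i _ =>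
      (cdf i).mul (cg i).continuousOn) (M := ∑ _i : Fin n, K * K) fun x hx => ?_
    refine (Finset.abs_sum_le_sum_abs _ _).trans (Finset.sum_le_sum fun i _ => ?_)
    rw [abs_mul]
    exact mul_le_mul (hfd i x hx) (hgd i x hx) (abs_nonneg _) hK
  have hdiv : ∀ x ∈ Ω, ∑ i, pderiv' i (fun y => f y * pderiv' i g y) x =
      f x * lap g x + ∑ i, pderiv' i f x * pderiv' i g x := fun x hx => by
    rw [lap, Finset.mul_sum, ← Finset.sum_add_distrib]
    exact Finset.sum_congr rfl fun i _ => pderiv'_mul (df x hx) (ddg i x hx) i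
  have key := D.integral_div_eq_zero (X := fun i y => f y * pderiv' i g y) (M := K * K)
    (fun i => hf.mul (cg i)) (fun i x hx => by
      have h1 := hfK x hx
      rw [abs_mul]
      calc |f x| * |pderiv' i g x| ≤ K * φ x * K :=
            mul_le_mul h1 (hgd i x hx) (abs_nonneg _) ((abs_nonneg _).trans h1)
        _ = K * K * φ x := by ring)
    ((I1.add I2).congr_fun (fun x hx => (hdiv x hx).symm) hΩ.measurableSet)
  rw [setIntegral_congr_fun hΩ.measurableSet hdiv, integral_add I1 I2] at key
  linarith

namespace FDSolution

variable {p b T M : ℝ} {u v w : EuclideanSpace ℝ (Fin n) → ℝ → ℝ}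

lemma gradSq_v_le (R : FDSolution Ω φ p b T M u v w) {x : EuclideanSpace ℝ (Fin n)} (hx : x ∈ Ω)
    {t : ℝ} (ht : t ∈ Icc 0 T) : gradSq (fun y => v y t) x ≤ ∑ _i : Fin n, M ^ 2 :=
  Finset.sum_le_sum fun i _ => by
    rw [← sq_abs]; exact pow_le_pow_left₀ (abs_nonneg _) (R.dv_bound i x hx t ht) 2

lemma continuousOn_gradSq_v (R : FDSolution Ω φ p b T M u v w) (D : DefiningFun Ω φ)
    {t : ℝ} (ht : t ∈ Icc 0 T) : ContinuousOn (gradSq fun y => v y t) Ω :=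
  continuousOn_gradSq D.isOpen ((R.v_smooth t ht).of_le (by norm_num))

lemma continuousOn_dirichlet (R : FDSolution Ω φ p b T M u v w) (D : DefiningFun Ω φ) :
    ContinuousOn (fun t => ∫ x in Ω, gradSq (fun y => v y t) x) (Icc 0 T) := by
  refine D.continuousOn_setIntegral (ρ := fun x t => gradSq (fun y => v y t) x)
    (K := ∑ _i : Fin n, M ^ 2) (fun t ht => R.continuousOn_gradSq_v D ht)
    (fun t ht x hx => ?_) fun x hx => continuousOn_finsetSum _ fun i _ => (R.dv_contT i x hx).pow 2
  rw [abs_of_nonneg (gradSq_nonneg _ _)]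
  exact R.gradSq_v_le hx ht

lemma integral_v_mul_lap (R : FDSolution Ω φ p b T M u v w) (D : DefiningFun Ω φ) {t : ℝ}
    (ht : t ∈ Icc 0 T) :
    ∫ x in Ω, v x t * lap (fun y => v y t) x = -∫ x in Ω, gradSq (fun y => v y t) x := by
  rw [D.integral_mul_lap ((R.v_smooth t ht).of_le (by norm_num)) (R.v_smooth t ht) R.M_pos.le
    (fun x hx => R.v_bound x hx t ht) (fun i x hx => R.dv_bound i x hx t ht)
    (fun i x hx => R.dv_bound i x hx t ht) fun x hx => R.lapv_bound x hx t ht]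
  simp only [gradSq, sq]

lemma dirichlet_sub (R : FDSolution Ω φ p b T M u v w) (D : DefiningFun Ω φ) {t r : ℝ}
    (ht : t ∈ Icc 0 T) (hr : r ∈ Icc 0 T) :
    (∫ x in Ω, gradSq (fun y => v y r) x) - ∫ x in Ω, gradSq (fun y => v y t) x =
      -∫ x in Ω, (v x r - v x t) * (lap (fun y => v y r) x + lap (fun y => v y t) x) := by
  have hΩ := D.isOpen
  have hM := R.M_pos
  have dv : ∀ t ∈ Icc 0 T, ∀ x ∈ Ω, DifferentiableAt ℝ (fun y => v y t) x := fun t ht x hx =>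
    ContDiffOn.differentiableAt_mem hΩ (m := 2) (R.v_smooth t ht) (by norm_num) hx
  have cv : ∀ t ∈ Icc 0 T, ∀ i, ContDiffOn ℝ 1 (pderiv' i fun y => v y t) Ω := fun t ht i =>
    ContDiffOn.pderiv' hΩ (m := 2) (R.v_smooth t ht) (by norm_num) i
  have ddv : ∀ t ∈ Icc 0 T, ∀ i, ∀ x ∈ Ω, DifferentiableAt ℝ (pderiv' i fun y => v y t) x :=
    fun t ht i x hx => ContDiffOn.differentiableAt_mem hΩ (m := 1) (cv t ht i) le_rfl hx
  have hlap : ∀ x ∈ Ω, lap (fun y => v y r + v y t) x =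
      lap (fun y => v y r) x + lap (fun y => v y t) x := fun x hx => by
    simp only [lap, ← Finset.sum_add_distrib]
    refine Finset.sum_congr rfl fun i _ => ?_
    rw [pderiv'_congr hΩ (g := fun y => pderiv' i (fun y => v y r) y + pderiv' i (fun y => v y t) y)
      (fun y hy => pderiv'_add (dv r hr y hy) (dv t ht y hy) i) hx]
    exact pderiv'_add (ddv r hr i x hx) (ddv t ht i x hx) i
  have key := D.integral_mul_lap (f := fun y => v y r - v y t) (g := fun y => v y r + v y t)
    (((R.v_smooth r hr).sub (R.v_smooth t ht)).of_le (by norm_num))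
    ((R.v_smooth r hr).add (R.v_smooth t ht)) (K := 2 * M) (by positivity)
    (fun x hx => by
      have h1 := R.v_bound x hx r hr
      have h2 := R.v_bound x hx t ht
      exact (abs_sub _ _).trans (by linarith))
    (fun i x hx => by
      have h1 := R.dv_bound i x hx r hr
      have h2 := R.dv_bound i x hx t ht
      rw [pderiv'_sub (dv r hr x hx) (dv t ht x hx)]
      exact (abs_sub _ _).trans (by linarith))
    (fun i x hx => by
      have h1 := R.dv_bound i x hx r hr
      have h2 := R.dv_bound i x hx t ht
      rw [pderiv'_add (dv r hr x hx) (dv t ht x hx)]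
      exact (abs_add_le _ _).trans (by linarith))
    (fun x hx => by
      have h1 := R.lapv_bound x hx r hr
      have h2 := R.lapv_bound x hx t ht
      rw [hlap x hx]
      exact (abs_add_le _ _).trans (by linarith))
  have hI : ∀ t ∈ Icc 0 T, IntegrableOn (fun x => gradSq (fun y => v y t) x) Ω := fun t ht =>
    D.integrableOn_of_bound (R.continuousOn_gradSq_v D ht) (M := ∑ _i : Fin n, M ^ 2)
      fun x hx => by rw [abs_of_nonneg (gradSq_nonneg _ _)]; exact R.gradSq_v_le hx ht
  rw [setIntegral_congr_fun hΩ.measurableSet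
    (g := fun x => (v x r - v x t) * (lap (fun y => v y r) x + lap (fun y => v y t) x))
    (fun x hx => by simp only [hlap x hx])] at key
  rw [key, neg_neg, ← integral_sub (hI r hr) (hI t ht)]
  refine setIntegral_congr_fun hΩ.measurableSet fun x hx => ?_
  simp only [gradSq, ← Finset.sum_sub_distrib]
  refine Finset.sum_congr rfl fun i _ => ?_
  rw [pderiv'_sub (dv r hr x hx) (dv t ht x hx), pderiv'_add (dv r hr x hx) (dv t ht x hx)]
  ring

lemma hasDerivAt_v (R : FDSolution Ω φ p b T M u v w) {x : EuclideanSpace ℝ (Fin n)} (hx : x ∈ Ω)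
    {t : ℝ} (ht : t ∈ Ioo 0 T) : HasDerivAt (v x) (w x t) t :=
  (R.v_deriv x hx t (Ioo_subset_Icc_self ht)).hasDerivAt (Icc_mem_nhds ht.1 ht.2)

/-- The time derivative of the Dirichlet integral of `∂ₜ u`. -/
lemma hasDerivAt_dirichlet (R : FDSolution Ω φ p b T M u v w) (D : DefiningFun Ω φ) {t : ℝ}
    (ht : t ∈ Ioo 0 T) :
    HasDerivAt (fun t => ∫ x in Ω, gradSq (fun y => v y t) x)
      (-(2 * ∫ x in Ω, w x t * lap (fun y => v y t) x)) t := by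
  have hΩ := D.isOpen
  have hm := hΩ.measurableSet
  have hM := R.M_pos
  have htI : t ∈ Icc 0 T := Ioo_subset_Icc_self ht
  have hev : ∀ᶠ r in 𝓝[≠] t, r ∈ Icc 0 T ∧ r ≠ t :=
    (eventually_nhdsWithin_of_eventually_nhds (Icc_mem_nhds ht.1 ht.2)).and self_mem_nhdsWithin
  rw [hasDerivAt_iff_tendsto_slope]
  have hlim : Tendsto (fun r => ∫ x in Ω, (r - t)⁻¹ * (v x r - v x t) *
      (lap (fun y => v y r) x + lap (fun y => v y t) x)) (𝓝[≠] t)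
      (𝓝 (∫ x in Ω, w x t * (lap (fun y => v y t) x + lap (fun y => v y t) x))) := by
    refine tendsto_integral_filter_of_dominated_convergence (fun _ => M * (2 * M)) ?_ ?_
      (integrableOn_const D.volume_lt_top.ne) ?_
    · filter_upwards [hev] with r hr
      exact ((continuousOn_const.mul ((R.v_smooth r hr.1).continuousOn.sub
        (R.v_smooth t htI).continuousOn)).mul ((continuousOn_lap hΩ (R.v_smooth r hr.1)).add
        (continuousOn_lap hΩ (R.v_smooth t htI)))).aestronglyMeasurable hm
    · filter_upwards [hev] with r hr
      refine (ae_restrict_iff' hm).2 (ae_of_all _ fun x hx => ?_)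
      have h1 : ‖v x r - v x t‖ ≤ M * ‖r - t‖ :=
        (convex_Icc 0 T).norm_image_sub_le_of_norm_hasDerivWithin_le
          (fun τ hτ => R.v_deriv x hx τ hτ) (fun τ hτ => R.w_bound x hx τ hτ) htI hr.1
      have h0 : 0 < ‖r - t‖ := norm_pos_iff.2 (sub_ne_zero.2 hr.2)
      rw [norm_mul, norm_mul, norm_inv]
      refine mul_le_mul (by rwa [inv_mul_le_iff₀ h0, mul_comm]) ?_ (norm_nonneg _) hM.le
      have h2 := R.lapv_bound x hx r hr.1
      have h3 := R.lapv_bound x hx t htI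
      exact (abs_add_le _ _).trans (by linarith)
    · refine (ae_restrict_iff' hm).2 (ae_of_all _ fun x hx => ?_)
      have h1 := hasDerivAt_iff_tendsto_slope.1 (R.hasDerivAt_v hx ht)
      have h2 : Tendsto (fun r => lap (fun y => v y r) x) (𝓝[≠] t) (𝓝 (lap (fun y => v y t) x)) :=
        ((R.lapv_contT x hx).continuousAt (Icc_mem_nhds ht.1 ht.2)).tendsto.mono_left
          nhdsWithin_le_nhds
      exact h1.mul (h2.add tendsto_const_nhds)
  have e : -(2 * ∫ x in Ω, w x t * lap (fun y => v y t) x) =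
      -∫ x in Ω, w x t * (lap (fun y => v y t) x + lap (fun y => v y t) x) := by
    rw [← integral_const_mul]
    congr 1
    refine setIntegral_congr_fun hm fun x _ => ?_
    ring
  rw [e]
  refine hlim.neg.congr' ?_
  filter_upwards [hev] with r hr
  rw [slope_def_field, R.dirichlet_sub D htI hr.1, neg_div, div_eq_inv_mul, ← integral_const_mul]
  simp only [mul_assoc]

end FDSolution

end Dirichlet

section SecondEnergy

variable {n : ℕ} {Ω : Set (EuclideanSpace ℝ (Fin n))} {φ : EuclideanSpace ℝ (Fin n) → ℝ}

namespace FDRatio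

variable {p b T M m m' s H U : ℝ} {u v w h : EuclideanSpace ℝ (Fin n) → ℝ → ℝ}

lemma continuousOn_setIntegral_rpow_mul_sq (R : FDRatio Ω φ p b T M m m' u v w h)
    (D : DefiningFun Ω φ) {q : ℝ} (hq : 0 ≤ q) {f : EuclideanSpace ℝ (Fin n) → ℝ → ℝ} {N : ℝ}
    (hN : ∀ x ∈ Ω, ∀ t ∈ Icc 0 T, |f x t| ≤ N)
    (hf : ∀ t ∈ Icc 0 T, ContinuousOn (fun x => f x t) Ω)
    (hfT : ∀ x ∈ Ω, ContinuousOn (f x) (Icc 0 T)) :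
    (∀ t ∈ Icc 0 T, IntegrableOn (fun x => u x t ^ q * f x t ^ 2) Ω) ∧
      ContinuousOn (fun t => ∫ x in Ω, u x t ^ q * f x t ^ 2) (Icc 0 T) := by
  obtain ⟨K, hK, hKb⟩ := R.exists_rpow_le D hq
  have hb : ∀ t ∈ Icc 0 T, ∀ x ∈ Ω, |u x t ^ q * f x t ^ 2| ≤ K * N ^ 2 := fun t ht x hx => by
    have h1 := Real.rpow_nonneg (R.u_pos x hx t ht).le q
    rw [abs_mul, abs_of_nonneg h1, abs_of_nonneg (sq_nonneg _), ← sq_abs (f x t)]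
    exact mul_le_mul (hKb x hx t ht) (pow_le_pow_left₀ (abs_nonneg _) (hN x hx t ht) 2)
      (by positivity) hK
  have hc : ∀ t ∈ Icc 0 T, ContinuousOn (fun x => u x t ^ q * f x t ^ 2) Ω := fun t ht =>
    (R.continuousOn_rpow q ht).mul ((hf t ht).pow 2)
  exact ⟨fun t ht => D.integrableOn_of_bound (hc t ht) (hb t ht),
    D.continuousOn_setIntegral hc hb fun x hx => (R.continuousOn_rpowT q hx).mul ((hfT x hx).pow 2)⟩

lemma integral_rpow_mul_sq_le (R : FDRatio Ω φ p b T M m m' u v w h) (D : DefiningFun Ω φ)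
    {q : ℝ} (hq : 0 ≤ q) {f : EuclideanSpace ℝ (Fin n) → ℝ → ℝ} {N : ℝ} (hU : 0 ≤ U)
    {t : ℝ} (ht : t ∈ Icc 0 T) (huU : ∀ x ∈ Ω, u x t ≤ U) (hN : ∀ x ∈ Ω, |f x t| ≤ N)
    (hf : IntegrableOn (fun x => u x t ^ q * f x t ^ 2) Ω) :
    ∫ x in Ω, u x t ^ q * f x t ^ 2 ≤ U ^ q * N ^ 2 * volume.real Ω := by
  have h1 : ∫ x in Ω, u x t ^ q * f x t ^ 2 ≤ ∫ _x in Ω, U ^ q * N ^ 2 := by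
    refine setIntegral_mono_on hf (integrableOn_const D.volume_lt_top.ne) D.isOpen.measurableSet
      fun x hx => ?_
    have h2 := R.u_pos x hx t ht
    have h3 := huU x hx
    have h4 : f x t ^ 2 ≤ N ^ 2 := by
      rw [← sq_abs]; exact pow_le_pow_left₀ (abs_nonneg _) (hN x hx) 2
    gcongr
  rwa [setIntegral_const, smul_eq_mul, mul_comm] at h1

/-- Energy inequality for `∫ u ^ (p + 1) h ^ 2`, controlling `∫ |∇∂ₜu| ^ 2`. -/
lemma exists_hasDerivAt_ratio_energy (R : FDRatio Ω φ p b T M m m' u v w h) (D : DefiningFun Ω φ)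
    (hs : 0 ≤ s) (hH0 : 0 ≤ H) (hU0 : 0 ≤ U) (hH : ∀ x ∈ Ω, ∀ t ∈ Icc s T, |h x t| ≤ H)
    (hU : ∀ x ∈ Ω, ∀ t ∈ Icc 0 T, u x t ≤ U) {t : ℝ} (ht : t ∈ Ioo s T) :
    ∃ d, HasDerivAt (fun t => p / 2 * ∫ x in Ω, u x t ^ (p + 1) * h x t ^ 2) d t ∧
      d ≤ (|b| * U ^ 2 * H ^ 2 + p * U ^ (p + 1) * H ^ 2 + p * (p - 1) / 2 * U ^ (p + 1) * H ^ 3) *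
        volume.real Ω - ∫ x in Ω, gradSq (fun y => v y t) x := by
  have hp := R.one_lt
  have hM := R.M_pos
  have hm := D.isOpen.measurableSet
  have hIcc : ∀ r ∈ Ioo s T, r ∈ Icc 0 T := fun r hr => ⟨hs.trans hr.1.le, hr.2.le⟩
  have hIccs : ∀ r ∈ Ioo s T, r ∈ Icc s T := fun r hr => Ioo_subset_Icc_self hr
  have htI := hIcc t ht
  have ht0 : t ∈ Ioo 0 T := ⟨hs.trans_lt ht.1, ht.2⟩
  have hv : ∀ r ∈ Ioo s T, ∀ x ∈ Ω, |v x r| ≤ H * U := fun r hr x hx => by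
    rw [R.v_eq hx (hIcc r hr), abs_mul, abs_of_pos (R.u_pos x hx r (hIcc r hr))]
    exact mul_le_mul (hH x hx r (hIccs r hr)) (hU x hx r (hIcc r hr))
      (R.u_pos x hx r (hIcc r hr)).le hH0
  have hrp : ∀ q : ℝ, 0 ≤ q → ∀ r ∈ Ioo s T, ∀ x ∈ Ω, |u x r ^ q| ≤ U ^ q := fun q hq r hr x hx => by
    have h1 := (R.u_pos x hx r (hIcc r hr)).le
    rw [abs_of_nonneg (Real.rpow_nonneg h1 q)]
    exact Real.rpow_le_rpow h1 (hU x hx r (hIcc r hr)) hq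
  have hc' : ∀ r ∈ Ioo s T, ContinuousOn
      (fun x => u x r ^ p * (h x r * ((p - 1) * (h x r * v x r) + 2 * w x r))) Ω := fun r hr => by
    have ch := (R.h_smooth (hIcc r hr)).continuousOn
    exact (R.continuousOn_rpow _ (hIcc r hr)).mul (ch.mul ((continuousOn_const.mul
      (ch.mul (R.v_smooth r (hIcc r hr)).continuousOn)).add
        (continuousOn_const.mul (R.w_cont r (hIcc r hr)))))
  have hb' : ∀ r ∈ Ioo s T, ∀ x ∈ Ω,
      |u x r ^ p * (h x r * ((p - 1) * (h x r * v x r) + 2 * w x r))| ≤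
        U ^ p * (H * ((p - 1) * (H * (H * U)) + 2 * M)) := fun r hr x hx => by
    have h1 := hH x hx r (hIccs r hr)
    have h2 := hv r hr x hx
    have h3 := R.w_bound x hx r (hIcc r hr)
    have h4 := hrp p (by linarith) r hr x hx
    have hp1 : 0 ≤ p - 1 := by linarith
    rw [abs_mul, abs_mul]
    have h5 : |(p - 1) * (h x r * v x r) + 2 * w x r| ≤ (p - 1) * (H * (H * U)) + 2 * M := by
      refine (abs_add_le _ _).trans ?_
      rw [abs_mul, abs_mul, abs_mul, abs_of_nonneg hp1, abs_two]
      gcongr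
    gcongr
  have hd := D.hasDerivAt_setIntegral (s := s) (e := T)
    (ρ := fun x t => u x t ^ (p + 1) * h x t ^ 2)
    (ρ' := fun x t => u x t ^ p * (h x t * ((p - 1) * (h x t * v x t) + 2 * w x t)))
    (K := max (U ^ (p + 1) * H ^ 2) (U ^ p * (H * ((p - 1) * (H * (H * U)) + 2 * M))))
    (fun r hr => (R.continuousOn_rpow _ (hIcc r hr)).mul ((R.h_smooth (hIcc r hr)).continuousOn.pow 2))
    (fun r hr x hx => by
      refine le_trans ?_ (le_max_left _ _)
      rw [abs_mul, abs_pow]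
      exact mul_le_mul (hrp _ (by linarith) r hr x hx)
        (pow_le_pow_left₀ (abs_nonneg _) (hH x hx r (hIccs r hr)) 2) (by positivity) (by positivity))
    hc'
    (fun r hr x hx => (hb' r hr x hx).trans (le_max_right _ _))
    (fun r hr x hx => by
      have h0 := R.u_pos x hx r (hIcc r hr)
      have hn : Icc 0 T ∈ 𝓝 r := Icc_mem_nhds (hs.trans_lt hr.1) hr.2
      have du := (R.u_deriv x hx r (hIcc r hr)).hasDerivAt hn
      have dh := (R.h_deriv hx (hIcc r hr)).hasDerivAt hn
      refine ((du.rpow_const (p := p + 1) (Or.inl h0.ne')).fun_mul (dh.fun_pow 2)).congr_deriv ?_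
      rw [add_sub_cancel_right, Real.rpow_add_one h0.ne', R.v_eq hx (hIcc r hr)]
      push_cast
      field_simp
      ring) ht
  refine ⟨_, hd.const_mul (p / 2), ?_⟩
  have I1 : IntegrableOn (fun x => v x t * lap (fun y => v y t) x) Ω :=
    D.integrableOn_of_bound ((R.v_smooth t htI).continuousOn.mul
      (continuousOn_lap D.isOpen (R.v_smooth t htI))) (M := H * U * M) fun x hx => by
        rw [abs_mul]
        exact mul_le_mul (hv t ht x hx) (R.lapv_bound x hx t htI) (abs_nonneg _) (by positivity)
  set C := |b| * U ^ 2 * H ^ 2 + p * U ^ (p + 1) * H ^ 2 +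
    p * (p - 1) / 2 * U ^ (p + 1) * H ^ 3 with hCdef
  have I2 : IntegrableOn (fun _ => C) Ω := integrableOn_const D.volume_lt_top.ne
  have hC : ∫ _x in Ω, C = C * volume.real Ω := by rw [setIntegral_const, smul_eq_mul, mul_comm]
  have e0 : C * volume.real Ω - ∫ x in Ω, gradSq (fun y => v y t) x =
      ∫ x in Ω, (C + v x t * lap (fun y => v y t) x) := by
    rw [integral_add I2 I1, hC, R.integral_v_mul_lap D htI, sub_eq_add_neg]
  rw [e0, ← integral_const_mul]
  have I3 : IntegrableOn (fun x => p / 2 * (u x t ^ p * (h x t * ((p - 1) * (h x t * v x t) +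
      2 * w x t)))) Ω :=
    (D.integrableOn_of_bound (hc' t ht) (hb' t ht)).const_mul _
  refine setIntegral_mono_on I3 (I2.add I1) hm fun x hx => ?_
  have h0 := R.u_pos x hx t htI
  have e1 : u x t ^ (p - 1) * u x t = u x t ^ p := by
    rw [← Real.rpow_add_one h0.ne']; congr 1; ring
  have e2 : u x t ^ (p - 2) * u x t ^ 2 = u x t ^ p := by
    rw [← Real.rpow_natCast, ← Real.rpow_add h0]; congr 1; push_cast; ring
  have e3 : u x t ^ (p + 1) = u x t ^ p * u x t := Real.rpow_add_one h0.ne' p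
  have P := R.pde_deriv x hx t ht0
  have hve := R.v_eq hx htI
  have key : p / 2 * (u x t ^ p * (h x t * ((p - 1) * (h x t * v x t) + 2 * w x t))) =
      b * u x t ^ 2 * h x t ^ 2 + p * u x t ^ (p + 1) * h x t ^ 2 -
        p * (p - 1) / 2 * u x t ^ (p + 1) * h x t ^ 3 + v x t * lap (fun y => v y t) x := by
    rw [hve] at P ⊢
    rw [e3]
    linear_combination (h x t * u x t) * P +
      (-(p * h x t * w x t) + p * h x t ^ 2 * u x t) * e1 - p * (p - 1) * h x t ^ 3 * u x t * e2
  rw [key]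
  have b1 : b * u x t ^ 2 * h x t ^ 2 ≤ |b| * U ^ 2 * H ^ 2 := by
    have := hU x hx t htI
    have h2 := hH x hx t (hIccs t ht)
    have h3 := le_abs_self b
    rw [← sq_abs (h x t)]
    gcongr
  have b2 : p * u x t ^ (p + 1) * h x t ^ 2 ≤ p * U ^ (p + 1) * H ^ 2 := by
    have := hU x hx t htI
    have h2 := hH x hx t (hIccs t ht)
    rw [← sq_abs (h x t)]
    gcongr
  have b3 : -(p * (p - 1) / 2 * u x t ^ (p + 1) * h x t ^ 3) ≤
      p * (p - 1) / 2 * U ^ (p + 1) * H ^ 3 := by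
    have := hU x hx t htI
    have h2 := hH x hx t (hIccs t ht)
    have hp1 : 0 ≤ p - 1 := by linarith
    rw [← mul_neg]
    have : -h x t ^ 3 ≤ |h x t| ^ 3 := by rw [← abs_pow]; exact neg_le_abs _
    have : -h x t ^ 3 ≤ H ^ 3 := this.trans (pow_le_pow_left₀ (abs_nonneg _) h2 3)
    refine (mul_le_mul_of_nonneg_left this (by positivity)).trans ?_
    gcongr
  rw [hCdef]
  linarith

/-- Energy inequality for the Dirichlet integral of `∂ₜu`, controlling `∫ u ^ (p - 1) |∂ₜ²u| ^ 2`. -/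
lemma exists_hasDerivAt_dirichlet_energy (R : FDRatio Ω φ p b T M m m' u v w h) (D : DefiningFun Ω φ)
    (hs : 0 ≤ s) (hU0 : 0 ≤ U) (hH : ∀ x ∈ Ω, ∀ t ∈ Icc s T, |h x t| ≤ H)
    (hU : ∀ x ∈ Ω, ∀ t ∈ Icc 0 T, u x t ≤ U) {t : ℝ} (ht : t ∈ Ioo s T) :
    ∃ d, HasDerivAt (fun t => 1 / 2 * (∫ x in Ω, gradSq (fun y => v y t) x) -
        b / 2 * ∫ x in Ω, v x t ^ 2) d t ∧
      d ≤ p / 2 * U ^ (p + 1) * (H + (p - 1) * H ^ 2) ^ 2 * volume.real Ω -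
        p / 2 * ∫ x in Ω, u x t ^ (p - 1) * w x t ^ 2 := by
  have hp := R.one_lt
  have hM := R.M_pos
  have hm := D.isOpen.measurableSet
  have htI : t ∈ Icc 0 T := ⟨hs.trans ht.1.le, ht.2.le⟩
  have hts : t ∈ Icc s T := Ioo_subset_Icc_self ht
  have ht0 : t ∈ Ioo 0 T := ⟨hs.trans_lt ht.1, ht.2⟩
  obtain ⟨L, hL, hLb⟩ := D.bound_closure D.smooth.continuous
  have hv : ∀ r ∈ Ioo 0 T, ∀ x ∈ Ω, |v x r| ≤ M * L := fun r hr x hx =>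
    (R.v_bound x hx r (Ioo_subset_Icc_self hr)).trans
      (mul_le_mul_of_nonneg_left ((le_abs_self _).trans (hLb x (subset_closure hx))) hM.le)
  have cv := fun r (hr : r ∈ Ioo 0 T) => (R.v_smooth r (Ioo_subset_Icc_self hr)).continuousOn
  have cw := fun r (hr : r ∈ Ioo 0 T) => R.w_cont r (Ioo_subset_Icc_self hr)
  have hd := D.hasDerivAt_setIntegral (s := 0) (e := T) (ρ := fun x t => v x t ^ 2)
    (ρ' := fun x t => 2 * (w x t * v x t)) (K := max ((M * L) ^ 2) (2 * (M * (M * L))))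
    (fun r hr => (cv r hr).pow 2)
    (fun r hr x hx => by
      refine le_trans ?_ (le_max_left _ _)
      rw [abs_pow]
      exact pow_le_pow_left₀ (abs_nonneg _) (hv r hr x hx) 2)
    (fun r hr => continuousOn_const.mul ((cw r hr).mul (cv r hr)))
    (fun r hr x hx => by
      refine le_trans ?_ (le_max_right _ _)
      have h1 := R.w_bound x hx r (Ioo_subset_Icc_self hr)
      have h2 := hv r hr x hx
      rw [abs_mul, abs_mul, abs_two]
      gcongr)
    (fun r hr x hx => ((R.hasDerivAt_v hx hr).fun_pow 2).congr_deriv (by push_cast; ring)) ht0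
  refine ⟨_, ((R.hasDerivAt_dirichlet D ht0).const_mul (1 / 2)).sub (hd.const_mul (b / 2)), ?_⟩
  have I1 : IntegrableOn (fun x => w x t * lap (fun y => v y t) x) Ω :=
    D.integrableOn_of_bound ((cw t ht0).mul
      (continuousOn_lap D.isOpen (R.v_smooth t htI))) (M := M * M) fun x hx => by
        rw [abs_mul]
        exact mul_le_mul (R.w_bound x hx t htI) (R.lapv_bound x hx t htI) (abs_nonneg _) hM.le
  have I2 : IntegrableOn (fun x => w x t * v x t) Ω :=
    D.integrableOn_of_bound ((cw t ht0).mul (cv t ht0)) (M := M * (M * L)) fun x hx => by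
        rw [abs_mul]
        exact mul_le_mul (R.w_bound x hx t htI) (hv t ht0 x hx) (abs_nonneg _) hM.le
  have I3 := (R.continuousOn_setIntegral_rpow_mul_sq D (q := p - 1) (by linarith) R.w_bound
    R.w_cont R.w_contT).1 t htI
  set C := p / 2 * U ^ (p + 1) * (H + (p - 1) * H ^ 2) ^ 2
  have I4 : IntegrableOn (fun _ => C) Ω := integrableOn_const D.volume_lt_top.ne
  have hC : ∫ _x in Ω, C = C * volume.real Ω := by rw [setIntegral_const, smul_eq_mul, mul_comm]
  have I1n : IntegrableOn (fun x => -(w x t * lap (fun y => v y t) x)) Ω := I1.neg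
  have e1 : 1 / 2 * -(2 * ∫ x in Ω, w x t * lap (fun y => v y t) x) -
      b / 2 * ∫ x in Ω, 2 * (w x t * v x t) =
      ∫ x in Ω, (-(w x t * lap (fun y => v y t) x) - b * (w x t * v x t)) := by
    rw [integral_sub I1n (I2.const_mul b), integral_neg, integral_const_mul, integral_const_mul]
    ring
  have e2 : C * volume.real Ω - p / 2 * ∫ x in Ω, u x t ^ (p - 1) * w x t ^ 2 =
      ∫ x in Ω, (C - p / 2 * (u x t ^ (p - 1) * w x t ^ 2)) := by
    rw [integral_sub I4 (I3.const_mul _), hC, integral_const_mul]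
  rw [e1, e2]
  refine setIntegral_mono_on (I1n.sub (I2.const_mul b)) (I4.sub (I3.const_mul _)) hm
    fun x hx => ?_
  have h0 := R.u_pos x hx t htI
  have e3 : u x t ^ (p - 2) * u x t = u x t ^ (p - 1) := by
    rw [← Real.rpow_add_one h0.ne']; congr 1; ring
  have e4 : u x t ^ (p + 1) = u x t ^ (p - 1) * u x t ^ 2 := by
    rw [← Real.rpow_natCast, ← Real.rpow_add h0]; congr 1; push_cast; ring
  have P := R.pde_deriv x hx t ht0
  have hve := R.v_eq hx htI
  have ha : 0 ≤ u x t ^ (p - 1) := by positivity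
  have key : -(w x t * lap (fun y => v y t) x) - b * (w x t * v x t) =
      u x t ^ (p - 1) * (-(p * w x t ^ 2) +
        p * (w x t * (u x t * (h x t - (p - 1) * h x t ^ 2)))) := by
    rw [hve] at P ⊢
    linear_combination w x t * P - p * (p - 1) * h x t ^ 2 * u x t * w x t * e3
  have hin : -(p * w x t ^ 2) + p * (w x t * (u x t * (h x t - (p - 1) * h x t ^ 2))) ≤
      p / 2 * (u x t ^ 2 * (h x t - (p - 1) * h x t ^ 2) ^ 2) - p / 2 * w x t ^ 2 := by
    nlinarith [sq_nonneg (w x t - u x t * (h x t - (p - 1) * h x t ^ 2))]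
  have hb : u x t ^ (p + 1) * (h x t - (p - 1) * h x t ^ 2) ^ 2 ≤
      U ^ (p + 1) * (H + (p - 1) * H ^ 2) ^ 2 := by
    have h1 := hU x hx t htI
    have h2 := hH x hx t hts
    have hp1 : 0 ≤ p - 1 := by linarith
    have h3 : |h x t - (p - 1) * h x t ^ 2| ≤ H + (p - 1) * H ^ 2 := by
      refine (abs_sub _ _).trans ?_
      rw [abs_mul, abs_pow, abs_of_nonneg hp1]
      gcongr
    rw [← sq_abs (h x t - (p - 1) * h x t ^ 2)]
    gcongr
  change -(w x t * lap (fun y => v y t) x) - b * (w x t * v x t) ≤ _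
  rw [key]
  refine (mul_le_mul_of_nonneg_left hin ha).trans ?_
  rw [e4] at hb
  have hb' := mul_le_mul_of_nonneg_left hb (by linarith : 0 ≤ p / 2)
  have : C = p / 2 * (U ^ (p + 1) * (H + (p - 1) * H ^ 2) ^ 2) := by ring
  linarith

end FDRatio

end SecondEnergy

section EnergyBounds

variable {n : ℕ} {Ω : Set (EuclideanSpace ℝ (Fin n))} {φ : EuclideanSpace ℝ (Fin n) → ℝ}

/-- If `Y` is bounded by `B`, then the dissipation in `Y' ≤ A Y - P` is bounded. -/
lemma integral_le_of_deriv_le {Y P : ℝ → ℝ} {s s' e A B : ℝ} (hs : s < s') (he : s' ≤ e)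
    (hA : 0 ≤ A) (hY : ContinuousOn Y (Icc s e)) (hP : ContinuousOn P (Icc s e))
    (hY0 : ∀ t ∈ Icc s e, 0 ≤ Y t) (hP0 : ∀ t ∈ Icc s e, 0 ≤ P t)
    (hd : ∀ t ∈ Ioo s e, ∃ d, HasDerivAt Y d t ∧ d ≤ A * Y t - P t)
    (hB : ∫ r in s..e, Y r ≤ B) :
    ∫ r in s'..e, P r ≤ (A + 1 / (s' - s)) * B := by
  have h1 := add_integral_le_of_deriv_le hs hA hY hP hY0 hP0 hd (right_mem_Icc.2 he)
  have h2 := hY0 e (right_mem_Icc.2 (hs.le.trans he))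
  have h3 : 0 < s' - s := sub_pos.2 hs
  have h4 := mul_le_mul_of_nonneg_left hB (by positivity : 0 ≤ A + 1 / (s' - s))
  linarith

/-- Uniform bound for the time integral of the Dirichlet energy of `∂ₜu`. -/
theorem DefiningFun.exists_dirichlet_bound (D : DefiningFun Ω φ) {p b T s s' H U : ℝ} (hp : 1 < p)
    (hs : 0 ≤ s) (hss : s < s') (hsT : s' ≤ T) (hH0 : 0 ≤ H) (hU0 : 0 ≤ U) :
    ∃ C, 0 ≤ C ∧ ∀ (M m m' : ℝ) (u v w h : EuclideanSpace ℝ (Fin n) → ℝ → ℝ),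
      FDRatio Ω φ p b T M m m' u v w h → (∀ x ∈ Ω, ∀ t ∈ Icc s T, |h x t| ≤ H) →
      (∀ x ∈ Ω, ∀ t ∈ Icc 0 T, u x t ≤ U) →
      ∫ t in s'..T, ∫ x in Ω, gradSq (fun y => v y t) x ≤ C := by
  have hp0 : 0 < p := by linarith
  have hp1 : 0 ≤ p - 1 := by linarith
  have hs0 : 0 < s' - s := sub_pos.2 hss
  have hT0 : 0 ≤ T - s := by linarith
  have hsub : Icc s T ⊆ Icc 0 T := Icc_subset_Icc_left hs
  set A := (|b| * U ^ 2 * H ^ 2 + p * U ^ (p + 1) * H ^ 2 +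
    p * (p - 1) / 2 * U ^ (p + 1) * H ^ 3) * volume.real Ω with hAdef
  have hA : 0 ≤ A := by positivity
  set B := p / 2 * (U ^ (p + 1) * H ^ 2 * volume.real Ω) + 1
  refine ⟨(A + 1 / (s' - s)) * (B * (T - s)), by positivity, fun M m m' u v w h R hH hU => ?_⟩
  have hE := R.continuousOn_setIntegral_rpow_mul_sq D (q := p + 1) (by linarith)
    (fun x hx t ht => R.h_bound hx ht) (fun t ht => (R.h_smooth ht).continuousOn)
    fun x hx => R.h_contT hx
  have hE0 : ∀ t ∈ Icc s T, 0 ≤ ∫ x in Ω, u x t ^ (p + 1) * h x t ^ 2 := fun t ht =>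
    setIntegral_nonneg D.isOpen.measurableSet fun x hx => by
      have := R.u_pos x hx t (hsub ht)
      positivity
  have hY : ContinuousOn (fun t => p / 2 * (∫ x in Ω, u x t ^ (p + 1) * h x t ^ 2) + 1) (Icc s T) :=
    ((hE.2.mono hsub).const_smul (p / 2)).add continuousOn_const
  refine integral_le_of_deriv_le hss hsT hA hY ((R.continuousOn_dirichlet D).mono hsub)
    (fun t ht => ?_) (fun t _ => integral_nonneg fun x => gradSq_nonneg _ x) (fun t ht => ?_) ?_
  · have := hE0 t ht
    positivity
  · obtain ⟨d, hd, hle⟩ := R.exists_hasDerivAt_ratio_energy D hs hH0 hU0 hH hU ht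
    refine ⟨d, hd.add_const 1, hle.trans ?_⟩
    have := hE0 t (Ioo_subset_Icc_self ht)
    rw [← hAdef]
    have h2 : 0 ≤ A * (p / 2 * ∫ x in Ω, u x t ^ (p + 1) * h x t ^ 2) := by positivity
    linarith
  · have h1 := intervalIntegral.integral_mono_on (hss.le.trans hsT)
      (hY.intervalIntegrable_of_Icc (hss.le.trans hsT)) (_root_.intervalIntegrable_const (μ := volume) (c := B))
      fun t ht => by
        have := R.integral_rpow_mul_sq_le D (q := p + 1) (by linarith) hU0 (hsub ht)
          (fun x hx => hU x hx t (hsub ht)) (fun x hx => hH x hx t ht) (hE.1 t (hsub ht))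
        have h2 := mul_le_mul_of_nonneg_left this (by linarith : 0 ≤ p / 2)
        exact add_le_add_left h2 1
    rwa [intervalIntegral.integral_const, smul_eq_mul, mul_comm] at h1

/-- Uniform bound for the weighted space-time integral of `|∂ₜ²u| ^ 2`. -/
theorem DefiningFun.exists_weighted_bound (D : DefiningFun Ω φ) {p b T s s' H U : ℝ} (hp : 1 < p)
    (hs : 0 ≤ s) (hss : s < s') (hsT : s' ≤ T) (hH0 : 0 ≤ H) (hU0 : 0 ≤ U) :
    ∃ C, 0 ≤ C ∧ ∀ (M m m' : ℝ) (u v w h : EuclideanSpace ℝ (Fin n) → ℝ → ℝ),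
      FDRatio Ω φ p b T M m m' u v w h → (∀ x ∈ Ω, ∀ t ∈ Icc s T, |h x t| ≤ H) →
      (∀ x ∈ Ω, ∀ t ∈ Icc 0 T, u x t ≤ U) →
      ∫ t in s'..T, ∫ x in Ω, u x t ^ (p - 1) * w x t ^ 2 ≤ C := by
  obtain ⟨r, hsr, hrs⟩ := exists_between hss
  obtain ⟨C0, hC0, hCb⟩ := D.exists_dirichlet_bound (b := b) hp hs hsr (hrs.le.trans hsT) hH0 hU0
  have hp0 : 0 < p := by linarith
  have hp1 : 0 ≤ p - 1 := by linarith
  have hr : 0 < s' - r := sub_pos.2 hrs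
  have hT0 : 0 ≤ T - r := by linarith
  have hrT : r ≤ T := by linarith
  have hr0 : 0 ≤ r := hs.trans hsr.le
  have hsub : Icc r T ⊆ Icc 0 T := Icc_subset_Icc_left hr0
  have hsubs : Icc r T ⊆ Icc s T := Icc_subset_Icc_left hsr.le
  set A := p / 2 * U ^ (p + 1) * (H + (p - 1) * H ^ 2) ^ 2 * volume.real Ω with hAdef
  have hA : 0 ≤ A := by positivity
  set B := |b| / 2 * ((H * U) ^ 2 * volume.real Ω)
  have hB : 0 ≤ B := by positivity
  refine ⟨2 / p * ((A + 1 / (s' - r)) * (1 / 2 * C0 + (2 * B + 1) * (T - r))), by positivity,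
    fun M m m' u v w h R hH hU => ?_⟩
  have hP := R.continuousOn_dirichlet D
  have hP0 : ∀ t, 0 ≤ ∫ x in Ω, gradSq (fun y => v y t) x := fun t =>
    integral_nonneg fun x => gradSq_nonneg _ x
  obtain ⟨L, hL, hLb⟩ := D.bound_closure D.smooth.continuous
  have hV := R.continuousOn_setIntegral_rpow_mul_sq D (q := 0) le_rfl (f := v) (N := M * L)
    (fun x hx t ht => (R.v_bound x hx t ht).trans
      (mul_le_mul_of_nonneg_left ((le_abs_self _).trans (hLb x (subset_closure hx))) R.M_pos.le))
    (fun t ht => (R.v_smooth t ht).continuousOn)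
    fun x hx t ht => (R.v_deriv x hx t ht).continuousWithinAt
  simp only [Real.rpow_zero, one_mul] at hV
  have hVb : ∀ t ∈ Icc r T, |b / 2 * ∫ x in Ω, v x t ^ 2| ≤ B := fun t ht => by
    have h1 := R.integral_rpow_mul_sq_le D (q := 0) le_rfl (f := v) (N := H * U) hU0 (hsub ht)
      (fun x hx => hU x hx t (hsub ht))
      (fun x hx => by
        have h2 := R.u_pos x hx t (hsub ht)
        rw [R.v_eq hx (hsub ht), abs_mul, abs_of_pos h2]
        exact mul_le_mul (hH x hx t (hsubs ht)) (hU x hx t (hsub ht)) h2.le hH0)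
      (by simpa only [Real.rpow_zero, one_mul] using hV.1 t (hsub ht))
    simp only [Real.rpow_zero, one_mul] at h1
    rw [abs_mul, abs_div, abs_two, abs_of_nonneg (integral_nonneg fun x => sq_nonneg (v x t))]
    exact mul_le_mul_of_nonneg_left h1 (by positivity)
  have hW := (R.continuousOn_setIntegral_rpow_mul_sq D (q := p - 1) hp1 R.w_bound R.w_cont
    R.w_contT).2
  have hW' : ContinuousOn (fun t => p / 2 * ∫ x in Ω, u x t ^ (p - 1) * w x t ^ 2) (Icc r T) :=
    (hW.mono hsub).const_smul (p / 2)
  have hY : ContinuousOn (fun t => 1 / 2 * (∫ x in Ω, gradSq (fun y => v y t) x) -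
      b / 2 * (∫ x in Ω, v x t ^ 2) + (B + 1)) (Icc r T) :=
    (((hP.mono hsub).const_smul (1 / 2 : ℝ)).sub
      ((hV.2.mono hsub).const_smul (b / 2))).add continuousOn_const
  have key := integral_le_of_deriv_le (B := 1 / 2 * C0 + (2 * B + 1) * (T - r)) hrs hsT hA hY
    hW' (fun t ht => ?_) (fun t ht => ?_) (fun t ht => ?_) ?_
  · rw [intervalIntegral.integral_const_mul] at key
    calc _ = 2 / p * (p / 2 * ∫ t in s'..T, ∫ x in Ω, u x t ^ (p - 1) * w x t ^ 2) := by
          field_simp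
      _ ≤ _ := mul_le_mul_of_nonneg_left key (by positivity)
  · have h1 := hP0 t
    have h2 := (abs_le.1 (hVb t ht)).2
    linarith
  · refine mul_nonneg (by positivity) (setIntegral_nonneg D.isOpen.measurableSet fun x hx => ?_)
    have := R.u_pos x hx t (hsub ht)
    positivity
  · obtain ⟨d, hd, hle⟩ := R.exists_hasDerivAt_dirichlet_energy D hs hU0 hH hU
      ⟨hsr.trans ht.1, ht.2⟩
    refine ⟨d, hd.add_const (B + 1), hle.trans ?_⟩
    have h1 := hP0 t
    have h2 := (abs_le.1 (hVb t (Ioo_subset_Icc_self ht))).2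
    have h3 := mul_le_mul_of_nonneg_left (by linarith : 1 ≤ 1 / 2 *
      (∫ x in Ω, gradSq (fun y => v y t) x) - b / 2 * (∫ x in Ω, v x t ^ 2) + (B + 1)) hA
    rw [← hAdef]
    linarith
  · have hPi : IntervalIntegrable (fun t => ∫ x in Ω, gradSq (fun y => v y t) x) volume r T :=
      (hP.mono hsub).intervalIntegrable_of_Icc hrT
    have h1 := intervalIntegral.integral_mono_on hrT (hY.intervalIntegrable_of_Icc hrT)
      ((hPi.const_mul (1 / 2)).add (_root_.intervalIntegrable_const (μ := volume) (c := 2 * B + 1)))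
      fun t ht => by
        have h2 := (abs_le.1 (hVb t ht)).1
        change _ ≤ 1 / 2 * (∫ x in Ω, gradSq (fun y => v y t) x) + (2 * B + 1)
        linarith
    rw [intervalIntegral.integral_add (hPi.const_mul (1 / 2)) intervalIntegrable_const,
      intervalIntegral.integral_const_mul, intervalIntegral.integral_const, smul_eq_mul] at h1
    have h3 := hCb M m m' u v w h R hH hU
    linarith

end EnergyBounds

/-- Bounds on the first and second time derivatives (Proposition 4.5 of the paper):
`‖∂ₜu‖_{L^∞(Ω × [T/2,T])} ≤ C` and
`∫_{T/2}^T ∫_Ω (|∇∂ₜu|² + |∂ₜ²u|² u^{p-1}) ≤ C`.  The constant depends only on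
`n`, `Ω`, `T`, `p`, `b`, `c₀` and (an upper bound `E` for)
`∫_Ω (|∇u(·,0)|² + u(·,0)²)`. -/
theorem stmt13 (n : ℕ) (hn : 1 ≤ n) (Ω : Set (EuclideanSpace ℝ (Fin n)))
    (p b c₀ T E : ℝ) :
    ∃ C : ℝ, 0 < C ∧
      ∀ (u ut utt : EuclideanSpace ℝ (Fin n) → ℝ → ℝ),
        FDSetting Ω p b T c₀ u ut utt →
        (∫ x in Ω, (‖gradient (fun y => u y 0) x‖ ^ 2 + u x 0 ^ 2)) ≤ E →
        (∀ x ∈ Ω, ∀ t ∈ Set.Icc (T / 2) T, |ut x t| ≤ C) ∧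
        (∫ t in Set.Ioc (T / 2) T, ∫ x in Ω,
            (‖gradient (fun y => ut y t) x‖ ^ 2 + (utt x t) ^ 2 * u x t ^ (p - 1)))
          ≤ C := by
  by_cases hyp : IsSmoothDomain Ω ∧ 1 < p ∧ (n ≤ 2 ∨ p ≤ ((n : ℝ) + 2) / ((n : ℝ) - 2)) ∧
    0 < T ∧ 1 ≤ c₀
  swap
  · exact ⟨1, one_pos, fun u ut utt hF =>
      absurd ⟨hF.1, hF.2.1, hF.2.2.1, hF.2.2.2.1, hF.2.2.2.2.1⟩ hyp⟩
  obtain ⟨hΩ, hp, hpn, hT, hc⟩ := hyp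
  obtain ⟨φ, D⟩ := hΩ.exists_regularDefiningFun
  obtain ⟨K, hK, hφd⟩ := D.exists_le_mul_dB hn
  obtain ⟨K', hK', hdφ⟩ := D.exists_dB_le_mul
  obtain ⟨L, hL, hLb⟩ := D.bound_closure D.smooth.continuous
  have hc0 : 0 < c₀ := by linarith
  have hm : 0 < c₀⁻¹ / K := by positivity
  have hm' : 0 < c₀ * K' := by positivity
  obtain ⟨H, hH0, hHb⟩ := D.exists_ratio_bound hn hp hpn hm hm' (by linarith : 0 < T / 4)
    (by linarith : T / 4 < T)
  have hU0 : 0 ≤ c₀ * K' * L := by positivity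
  obtain ⟨C1, hC1, hD⟩ := D.toDefiningFun.exists_dirichlet_bound (b := b) (s' := T / 2) (T := T) hp
    (by linarith : 0 ≤ T / 4) (by linarith) (by linarith) hH0.le hU0
  obtain ⟨C2, hC2, hW⟩ := D.toDefiningFun.exists_weighted_bound (b := b) (s' := T / 2) (T := T) hp
    (by linarith : 0 ≤ T / 4) (by linarith) (by linarith) hH0.le hU0
  refine ⟨H * (c₀ * K' * L) + C1 + C2 + 1, by positivity, fun u v w hF _ => ?_⟩
  obtain ⟨M, hS⟩ := hF.exists_solution D hn
  have hcomp := hF.2.2.2.2.2.2.2.2.2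
  have R : FDRatio Ω φ p b T M (c₀⁻¹ / K) (c₀ * K') u v w (fun x t => v x t / u x t) :=
    { hS with
      m_pos := hm
      m'_pos := hm'
      u_lower := fun x hx t ht => by
        refine le_trans ?_ (hcomp x hx t ht).1
        rw [div_mul_eq_mul_div, mul_div_assoc]
        have := (div_le_iff₀' hK).2 (hφd x hx)
        gcongr
      u_upper := fun x hx t ht => by
        refine (hcomp x hx t ht).2.trans ?_
        rw [mul_assoc]
        exact mul_le_mul_of_nonneg_left (hdφ x hx) hc0.le
      ratio := fun _ _ => rfl }
  have hH := hHb b M u v w _ R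
  have hU : ∀ x ∈ Ω, ∀ t ∈ Icc 0 T, u x t ≤ c₀ * K' * L := fun x hx t ht =>
    (R.u_upper x hx t ht).trans
      (mul_le_mul_of_nonneg_left ((le_abs_self _).trans (hLb x (subset_closure hx))) hm'.le)
  have hsub : Icc (T / 2) T ⊆ Icc 0 T := Icc_subset_Icc_left (by linarith)
  have hTT : T / 2 ≤ T := by linarith
  refine ⟨fun x hx t ht => ?_, ?_⟩
  · have hu := R.u_pos x hx t (hsub ht)
    rw [R.v_eq hx (hsub ht), abs_mul, abs_of_pos hu]
    have := mul_le_mul (hH x hx t ⟨by linarith [ht.1], ht.2⟩) (hU x hx t (hsub ht)) hu.le hH0.le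
    linarith
  · have hWc := R.continuousOn_setIntegral_rpow_mul_sq D.toDefiningFun (q := p - 1) (by linarith)
      R.w_bound R.w_cont R.w_contT
    have hP := R.continuousOn_dirichlet D.toDefiningFun
    have e : ∀ t ∈ Icc 0 T,
        ∫ x in Ω, (‖gradient (fun y => v y t) x‖ ^ 2 + w x t ^ 2 * u x t ^ (p - 1)) =
          (∫ x in Ω, gradSq (fun y => v y t) x) + ∫ x in Ω, u x t ^ (p - 1) * w x t ^ 2 :=
      fun t ht => by
        have I : IntegrableOn (gradSq fun y => v y t) Ω :=
          D.integrableOn_of_bound (R.continuousOn_gradSq_v D.toDefiningFun ht) fun x hx => by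
            rw [abs_of_nonneg (gradSq_nonneg _ _)]
            exact R.gradSq_v_le hx ht
        rw [← integral_add I (hWc.1 t ht)]
        simp only [norm_gradient_sq, mul_comm]
    rw [setIntegral_congr_fun measurableSet_Ioc fun t ht => e t (hsub (Ioc_subset_Icc_self ht)),
      ← intervalIntegral.integral_of_le hTT,
      intervalIntegral.integral_add ((hP.mono hsub).intervalIntegrable_of_Icc hTT)
        ((hWc.2.mono hsub).intervalIntegrable_of_Icc hTT)]
    have h1 := hD M _ _ u v w _ R hH hU
    have h2 := hW M _ _ u v w _ R hH hU
    have h3 : 0 ≤ H * (c₀ * K' * L) := by positivity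
    linarith
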